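/- Let H ⊆ ℝ² be a subset whose subspace topology is Polish. Then the path-connectedness (equivalently, arc-connectedness) equivalence relation ≈_H on H is an essentially hyperfinite Borel equivalence relation. -/

import Mathlib

/-- `E` is a Borel equivalence relation on the measurable space `X`. -/
def IsBorelEquivRel {X : Type} [MeasurableSpace X] (E : X → X → Prop) : Prop :=
  Equivalence E ∧ MeasurableSet {p : X × X | E p.1 p.2}

/-- A finite Borel equivalence relation: every class is finite. -/
def IsFiniteBorelEquivRel {X : Type} [MeasurableSpace X] (E : X → X → Prop) : Prop :=
  IsBorelEquivRel E ∧ ∀ x, {y | E x y}.Finite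

/-- `E` is hyperfinite: an increasing union of finite Borel equivalence relations. -/
def IsHyperfinite {X : Type} [MeasurableSpace X] (E : X → X → Prop) : Prop :=
  ∃ F : ℕ → X → X → Prop,
    (∀ n, IsFiniteBorelEquivRel (F n)) ∧
    (∀ n x y, F n x y → F (n + 1) x y) ∧
    (∀ x y, E x y ↔ ∃ n, F n x y)

/-- Borel reducibility of `E` to `F`. -/
def IsBorelReducible {X Y : Type} [MeasurableSpace X] [MeasurableSpace Y]
    (E : X → X → Prop) (F : Y → Y → Prop) : Prop :=
  ∃ f : X → Y, Measurable f ∧ ∀ x y, E x y ↔ F (f x) (f y)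

/-- `E` is essentially hyperfinite: Borel reducible to a hyperfinite Borel
equivalence relation on some standard Borel space. -/
def IsEssentiallyHyperfinite {X : Type} [MeasurableSpace X] (E : X → X → Prop) : Prop :=
  ∃ (Y : Type) (mY : MeasurableSpace Y), @StandardBorelSpace Y mY ∧
    ∃ F : Y → Y → Prop, @IsBorelEquivRel Y mY F ∧ @IsHyperfinite Y mY F ∧
      @IsBorelReducible X Y _ mY E F

namespace PlanarPaths

section

open Set Filter Topology unitInterval

section

/-- Paths in `M` as continuous maps on the unit interval. -/
abbrev Pth (M : Type*) [TopologicalSpace M] := C(unitInterval, M)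

/-- Two three-legged systems meet along legs of different index. -/
def Meets {M : Type*} [TopologicalSpace M] (t u : Fin 3 → Pth M) : Prop :=
  ∃ i j, i ≠ j ∧ ∃ s r, t i s = u j r

/-- Three-legged systems which are close to a fixed nondegenerate one and whose legs have a
common origin must meet along legs of different index. -/
def MooreProp (M : Type*) [TopologicalSpace M] : Prop :=
  ∀ t : Fin 3 → Pth M, (∀ i j, i ≠ j → ∀ s, t i 1 ≠ t j s) →
    ∃ U ∈ 𝓝 t, ∀ t' ∈ U, ∀ t'' ∈ U, (∀ i j, t' i 0 = t' j 0) → (∀ i j, t'' i 0 = t'' j 0) →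
      Meets t' t''

theorem MooreProp.of_injective {M N : Type*} [TopologicalSpace M] [TopologicalSpace N]
    (hN : MooreProp N) (f : C(M, N)) (hf : Function.Injective f) : MooreProp M := by
  intro t ht
  obtain ⟨U, hU, h⟩ := hN (fun i => f.comp (t i)) (fun i j hij s h => ht i j hij s (hf h))
  have hc : Continuous (fun t : Fin 3 → Pth M => fun i => f.comp (t i)) :=
    continuous_pi fun i => (f.continuous_postcomp).comp (continuous_apply i)
  refine ⟨_, hc.continuousAt.preimage_mem_nhds hU, fun t' h' t'' h'' h1 h2 => ?_⟩
  obtain ⟨i, j, hij, s, r, hs⟩ := h _ h' _ h'' (fun i j => congrArg f (h1 i j))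
    (fun i j => congrArg f (h2 i j))
  exact ⟨i, j, hij, s, r, hf hs⟩

/-- A nonvanishing continuous function on the plane which is approximately odd on a circle
does not exist. -/
theorem no_almost_odd_nonvanishing (G : ℂ → ℂ) (hG : Continuous G) (h0 : ∀ z, G z ≠ 0)
    (hodd : ∀ z : ℂ, ‖z‖ = 4 → ‖G (-z) + G z‖ < ‖G z‖) : False := by
  have hsc : IsSimplyConnected (univ : Set ℂ) := by
    have := (Homeomorph.Set.univ ℂ).contractibleSpace
    exact (inferInstance : SimplyConnectedSpace (univ : Set ℂ))
  obtain ⟨g, hg, hgG⟩ := Complex.exists_continuousOn_eqOn_exp_comp (X := ℂ) (U := univ)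
    hsc isOpen_univ (g := G) hG.continuousOn (by simpa using h0)
  rw [continuousOn_univ] at hg
  have hcon : IsPreconnected (Metric.sphere (0 : ℂ) 4) :=
    (isConnected_sphere (by simp) 0 (by norm_num)).isPreconnected
  let D : ℂ → ℝ := fun z => (g (-z) - g z).im
  have hD : Continuous D := by fun_prop
  have hne : ∀ z ∈ Metric.sphere (0 : ℂ) 4, D z ≠ 0 := by
    intro z hz h
    have hz' := hodd z (by simpa using hz)
    have e1 : G (-z) = G z * Complex.exp (g (-z) - g z) := by
      rw [Complex.exp_sub, ← hgG (mem_univ z), ← hgG (mem_univ (-z))]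
      exact (mul_div_cancel₀ _ (Complex.exp_ne_zero _)).symm
    have e2 : ∃ x : ℝ, g (-z) - g z = x := ⟨(g (-z) - g z).re, by
      apply Complex.ext <;> simp; simpa [D] using h⟩
    obtain ⟨x, hx⟩ := e2
    rw [e1, hx] at hz'
    have : G z * Complex.exp x + G z = G z * ((Real.exp x + 1 : ℝ) : ℂ) := by
      push_cast; ring
    rw [this, norm_mul, Complex.norm_real, Real.norm_of_nonneg (by positivity)] at hz'
    have := Real.exp_pos x
    have := norm_pos_iff.2 (h0 z)
    nlinarith
  have hneg : D (-4) = - D 4 := by simp [D]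
  have h4 : (4 : ℂ) ∈ Metric.sphere (0 : ℂ) 4 := by simp
  have h4' : (-4 : ℂ) ∈ Metric.sphere (0 : ℂ) 4 := by simp
  rcases le_total (D 4) 0 with h | h
  · obtain ⟨z, hz, hz0⟩ := hcon.intermediate_value h4 h4' hD.continuousOn
      (show (0 : ℝ) ∈ Icc (D 4) (D (-4)) from ⟨h, by rw [hneg]; linarith⟩)
    exact hne z hz hz0
  · obtain ⟨z, hz, hz0⟩ := hcon.intermediate_value h4' h4 hD.continuousOn
      (show (0 : ℝ) ∈ Icc (D (-4)) (D 4) from ⟨by rw [hneg]; linarith, h⟩)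
    exact hne z hz hz0

/-- The three coordinates of the parameter plane. -/
private def co (z : ℂ) : Fin 3 → ℝ := ![z.re, z.im, - z.re - z.im]

private def md (z : ℂ) : ℝ := - max (max (co z 0) (co z 1)) (co z 2) - min (min (co z 0) (co z 1)) (co z 2)

private theorem md_neg (z : ℂ) : md (-z) = - md z := by
  have : ∀ i, co (-z) i = - co z i := by intro i; fin_cases i <;> simp [co]; ring
  simp only [md, this, max_neg_neg, min_neg_neg]; ring

private theorem co_neg (z : ℂ) (i) : co (-z) i = - co z i := by
  fin_cases i <;> simp [co]; ring

private theorem co_cont (i) : Continuous fun z => co z i := by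
  fin_cases i <;> simp [co] <;> fun_prop

private theorem md_cont : Continuous md := by
  have := co_cont
  unfold md; fun_prop

private theorem sum3 {A : Type*} [AddCommGroup A] (f : Fin 3 → A) (i k j : Fin 3) (h1 : i ≠ k)
    (h2 : i ≠ j) (h3 : k ≠ j) : ∑ l, f l = f i + f k + f j := by
  have : ∀ i k j : Fin 3, i ≠ k → i ≠ j → k ≠ j → Finset.univ = {i, k, j} := by decide
  rw [this i k j h1 h2 h3, Finset.sum_insert (by simp [h1, h2]), Finset.sum_insert (by simp [h3]),
    Finset.sum_singleton, add_assoc]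

/-- Some ordering `i, k, j` of the indices sorts the coordinates. -/
private theorem exists_order (z : ℂ) : ∃ i k j : Fin 3, i ≠ k ∧ i ≠ j ∧ k ≠ j ∧
    md z ≤ co z i ∧ co z k = md z ∧ co z j ≤ md z := by
  have hs : co z 0 + co z 1 + co z 2 = 0 := by simp [co]
  have key : ∀ i k j : Fin 3, i ≠ k → i ≠ j → k ≠ j → co z k ≤ co z i → co z j ≤ co z k →
      (max (max (co z 0) (co z 1)) (co z 2) = co z i) →
      (min (min (co z 0) (co z 1)) (co z 2) = co z j) → (co z i + co z k + co z j = 0) →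
      ∃ i k j : Fin 3, i ≠ k ∧ i ≠ j ∧ k ≠ j ∧
    md z ≤ co z i ∧ co z k = md z ∧ co z j ≤ md z := by
    intro i k j h1 h2 h3 h4 h5 h6 h7 h8
    have : md z = co z k := by rw [md, h6, h7]; linarith
    exact ⟨i, k, j, h1, h2, h3, by rw [this]; exact h4, this.symm, by rw [this]; exact h5⟩
  rcases le_total (co z 0) (co z 1) with h1 | h1 <;> rcases le_total (co z 1) (co z 2) with h2 | h2
    <;> rcases le_total (co z 0) (co z 2) with h3 | h3
  · exact key 2 1 0 (by decide) (by decide) (by decide) h2 h1 (by simp [*]) (by simp [*]) (by linarith)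
  · exact key 2 1 0 (by decide) (by decide) (by decide) h2 h1 (by simp [*]) (by simp [*]; linarith) (by linarith)
  · exact key 1 2 0 (by decide) (by decide) (by decide) h2 h3 (by simp [*]) (by simp [*]) (by linarith)
  · exact key 1 0 2 (by decide) (by decide) (by decide) h1 h3 (by simp [*]) (by simp [*]) (by linarith)
  · exact key 2 0 1 (by decide) (by decide) (by decide) h3 h1 (by simp [*]) (by simp [*]) (by linarith)
  · exact key 0 2 1 (by decide) (by decide) (by decide) h3 h2 (by simp [*]) (by simp [*]) (by linarith)
  · exact key 0 1 2 (by decide) (by decide) (by decide) h1 h2 (by simp [*]; linarith) (by simp [*]) (by linarith)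
  · exact key 0 1 2 (by decide) (by decide) (by decide) h1 h2 (by simp [*]) (by simp [*]) (by linarith)

/-- The plane has the Moore property. -/
theorem mooreProp_complex : MooreProp ℂ := by
  intro t ht
  obtain ⟨r, hr, hsep⟩ : ∃ r : ℝ, 0 < r ∧ ∀ i j, i ≠ j → ∀ s, r ≤ dist (t i 1) (t j s) := by
    have h1 : ∀ i j, ∃ r : ℝ, 0 < r ∧ (i ≠ j → ∀ s, r ≤ dist (t i 1) (t j s)) := by
      intro i j
      by_cases hij : i = j
      · exact ⟨1, one_pos, fun h => absurd hij h⟩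
      obtain ⟨s0, -, hs0⟩ := isCompact_univ.exists_isMinOn (univ_nonempty (α := I))
        (f := fun s => dist (t i 1) (t j s)) (by fun_prop)
      exact ⟨_, dist_pos.2 (ht i j hij s0), fun _ s => hs0 (mem_univ s)⟩
    choose r hr h using h1
    refine ⟨Finset.univ.inf' Finset.univ_nonempty (fun p : Fin 3 × Fin 3 => r p.1 p.2), ?_, ?_⟩
    · simpa [Finset.lt_inf'_iff] using fun i j => hr i j
    · intro i j hij s
      exact (Finset.inf'_le _ (Finset.mem_univ (i, j))).trans (h i j hij s)
  refine ⟨Metric.ball t (r / 16), Metric.ball_mem_nhds _ (by positivity), ?_⟩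
  intro t' ht' t'' ht'' hc' hc''
  by_contra hm
  have hd' : ∀ i s, dist (t' i s) (t i s) < r / 16 := fun i s =>
    (ContinuousMap.dist_apply_le_dist s).trans_lt ((dist_le_pi_dist t' t i).trans_lt ht')
  have hd'' : ∀ i s, dist (t'' i s) (t i s) < r / 16 := fun i s =>
    (ContinuousMap.dist_apply_le_dist s).trans_lt ((dist_le_pi_dist t'' t i).trans_lt ht'')
  let pr : ℝ → I := fun x => projIcc 0 1 zero_le_one x
  have prc : Continuous pr := continuous_projIcc
  have pr0 : ∀ x ≤ 0, pr x = 0 := fun x hx => projIcc_of_le_left _ hx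
  have pr1 : ∀ x, 1 ≤ x → pr x = 1 := fun x hx => projIcc_of_right_le _ hx
  let G : ℂ → ℂ := fun z => ((∑ i, t' i (pr (co z i - md z))) - 2 * t' 0 0) -
    ((∑ i, t'' i (pr (md z - co z i))) - 2 * t'' 0 0)
  have hG : Continuous G := by
    have := co_cont
    have := md_cont
    fun_prop
  have eG : ∀ z i k j, i ≠ k → i ≠ j → k ≠ j → md z ≤ co z i → co z k = md z → co z j ≤ md z →
      G z = t' i (pr (co z i - md z)) - t'' j (pr (md z - co z j)) := by
    intro z i k j h1 h2 h3 h4 h5 h6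
    simp only [G]
    rw [sum3 _ i k j h1 h2 h3, sum3 _ i k j h1 h2 h3, pr0 (co z k - md z) (by linarith),
      pr0 (co z j - md z) (by linarith), pr0 (md z - co z i) (by linarith),
      pr0 (md z - co z k) (by linarith), hc' k 0, hc' j 0, hc'' k 0, hc'' i 0]
    ring
  refine no_almost_odd_nonvanishing G hG ?_ ?_
  · intro z hz
    obtain ⟨i, k, j, h1, h2, h3, h4, h5, h6⟩ := exists_order z
    rw [eG z i k j h1 h2 h3 h4 h5 h6, sub_eq_zero] at hz
    exact hm ⟨i, j, h2, _, _, hz⟩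
  · intro z hz
    obtain ⟨i, k, j, h1, h2, h3, h4, h5, h6⟩ := exists_order z
    rw [eG z i k j h1 h2 h3 h4 h5 h6, eG (-z) j k i h3.symm h2.symm h1.symm
      (by rw [md_neg, co_neg]; linarith) (by rw [md_neg, co_neg]; linarith)
      (by rw [md_neg, co_neg]; linarith)]
    simp only [co_neg, md_neg]
    rw [show -co z j - -md z = md z - co z j by ring, show -md z - -co z i = co z i - md z by ring]
    have hbig : 1 ≤ co z i - md z ∨ 1 ≤ md z - co z j := by
      by_contra! hcon
      have hs : co z i + co z k + co z j = 0 := by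
        rw [← sum3 (co z) i k j h1 h2 h3, Fin.sum_univ_three]; simp [co]
      have hq : co z i ^ 2 + co z k ^ 2 + co z j ^ 2 = z.re ^ 2 + z.im ^ 2 + (z.re + z.im) ^ 2 := by
        rw [← sum3 (fun l => co z l ^ 2) i k j h1 h2 h3, Fin.sum_univ_three]; simp [co]; ring
      have hn : z.re ^ 2 + z.im ^ 2 = 16 := by
        have := Complex.normSq_apply z
        rw [Complex.normSq_eq_norm_sq, hz] at this; nlinarith
      have ha : 0 ≤ co z i - md z := by linarith
      have hb : 0 ≤ md z - co z j := by linarith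
      have hi : co z i ≤ 1 := by linarith
      have hk : |co z k| ≤ 1 := abs_le.2 ⟨by linarith, by linarith⟩
      have hk2 : co z k ^ 2 ≤ 1 := by rw [← sq_abs]; nlinarith [abs_nonneg (co z k)]
      have hi2 : co z i ^ 2 ≤ 1 := by nlinarith
      have hj2 : co z j ^ 2 ≤ 1 := by nlinarith
      nlinarith [sq_nonneg (z.re + z.im)]
    have hpn : pr (co z i - md z) = 1 ∨ pr (md z - co z j) = 1 := hbig.imp (pr1 _) (pr1 _)
    generalize pr (co z i - md z) = p at hpn ⊢
    generalize pr (md z - co z j) = n at hpn ⊢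
    have d1 := dist_triangle_right (t' i p) (t'' i p) (t i p)
    have d2 := dist_triangle_right (t' j n) (t'' j n) (t j n)
    have e1 : ‖t' j n - t'' i p + (t' i p - t'' j n)‖ ≤ 4 * (r / 16) := by
      rw [show t' j n - t'' i p + (t' i p - t'' j n) = (t' i p - t'' i p) + (t' j n - t'' j n) by ring]
      refine (norm_add_le _ _).trans ?_
      rw [← dist_eq_norm, ← dist_eq_norm]
      linarith [hd' i p, hd'' i p, hd' j n, hd'' j n]
    have e2 : r ≤ dist (t i p) (t j n) := by
      rcases hpn with rfl | rfl
      · exact hsep i j h2 n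
      · rw [dist_comm]; exact hsep j i h2.symm p
    have e3 := dist_triangle4 (t i p) (t' i p) (t'' j n) (t j n)
    rw [dist_eq_norm (t' i p)] at e3
    rw [dist_comm (t i p) (t' i p)] at e3
    linarith [hd' i p, hd'' j n]

end

section

section Arcs

variable {M : Type*} [TopologicalSpace M] [T2Space M]

/-- The curve `γ` agrees at the two ends of every gap of `K`. -/
def GapEq (γ : Pth M) (K : Set I) : Prop :=
  ∀ a ∈ K, ∀ b ∈ K, a < b → K ∩ Ioo a b = ∅ → γ a = γ b

omit [T2Space M] in
theorem exists_gap {K : Set I} (hK : IsClosed K) {a a' b' b : I} (ha : a ∈ K) (hb : b ∈ K)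
    (h1 : a ≤ a') (h2 : a' ≤ b') (h3 : b' ≤ b) (h : K ∩ Icc a' b' = ∅) :
    ∃ c ∈ K, ∃ d ∈ K, a ≤ c ∧ c < a' ∧ b' < d ∧ d ≤ b ∧ K ∩ Ioo c d = ∅ := by
  obtain ⟨c, hc, hc'⟩ := (hK.inter isClosed_Iic).isCompact.exists_isGreatest ⟨a, ha, h1⟩
  obtain ⟨d, hd, hd'⟩ := (hK.inter isClosed_Ici).isCompact.exists_isLeast ⟨b, hb, h3⟩
  have hne : ∀ x ∈ K, a' ≤ x → b' < x := fun x hx h' => by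
    by_contra! h''
    exact (h ▸ ⟨hx, h', h''⟩ : x ∈ (∅ : Set I))
  have hca : c < a' := by
    refine lt_of_le_of_ne hc.2 fun e => ?_
    have := hne c hc.1 e.ge
    exact absurd (this.trans_le hc.2) (not_lt.2 h2)
  refine ⟨c, hc.1, d, hd.1, hc' ⟨ha, h1⟩, hca, hne d hd.1 (h2.trans hd.2), hd' ⟨hb, h3⟩, ?_⟩
  ext x
  simp only [mem_inter_iff, mem_Ioo, mem_empty_iff_false, iff_false, not_and, not_lt]
  intro hx hcx
  by_contra! hxd
  rcases lt_or_ge a' x with h' | h'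
  · exact absurd (hd' ⟨hx, (hne x hx h'.le).le⟩) (not_le.2 hxd)
  · exact absurd (hc' ⟨hx, h'⟩) (not_le.2 hcx)

theorem GapEq.sInter {γ : Pth M} {c : Set (Set I)} (hc : ∀ K ∈ c, IsClosed K ∧ GapEq γ K)
    (hch : IsChain (· ⊆ ·) c) (hne : c.Nonempty) : GapEq γ (⋂₀ c) := by
  intro a ha b hb hab hgap
  by_contra hne'
  have hev : ∀ᶠ p : I × I in 𝓝 a ×ˢ 𝓝 b, γ p.1 ≠ γ p.2 := by
    rw [← nhds_prod_eq]
    exact (isOpen_ne_fun (f := fun p : I × I => γ p.1) (g := fun p : I × I => γ p.2) (by fun_prop) (by fun_prop)).mem_nhds hne'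
  obtain ⟨U, hU, V, hV, hUV⟩ := eventually_prod_iff.1 hev
  obtain ⟨u, hu, hu'⟩ := exists_Ico_subset_of_mem_nhds hU ⟨b, hab⟩
  obtain ⟨l, hl, hl'⟩ := exists_Ioc_subset_of_mem_nhds hV ⟨a, hab⟩
  obtain ⟨a', ha1, ha2⟩ := exists_between (lt_min hu hab)
  obtain ⟨b', hb1, hb2⟩ := exists_between (max_lt hl (ha2.trans_le (min_le_right _ _)))
  obtain ⟨K, hKc, hK⟩ : ∃ K ∈ c, K ∩ Icc a' b' = ∅ := by
    by_contra! hcon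
    have : Nonempty ((fun K => K ∩ Icc a' b') '' c) := (hne.image _).to_subtype
    obtain ⟨x, hx⟩ := IsCompact.nonempty_sInter_of_directed_nonempty_isCompact_isClosed
      (S := (fun K => K ∩ Icc a' b') '' c) (by
        rintro _ ⟨K, hK, rfl⟩ _ ⟨L, hL, rfl⟩
        rcases hch.total hK hL with h | h
        · exact ⟨_, ⟨K, hK, rfl⟩, subset_rfl, inter_subset_inter_left _ h⟩
        · exact ⟨_, ⟨L, hL, rfl⟩, inter_subset_inter_left _ h, subset_rfl⟩)
      (by rintro _ ⟨K, hK, rfl⟩; exact hcon K hK)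
      (by rintro _ ⟨K, hK, rfl⟩; exact ((hc K hK).1.inter isClosed_Icc).isCompact)
      (by rintro _ ⟨K, hK, rfl⟩; exact ((hc K hK).1.inter isClosed_Icc))
    have hx' : x ∈ ⋂₀ c ∩ Ioo a b := by
      refine ⟨fun K hK => (hx _ ⟨K, hK, rfl⟩).1, ?_⟩
      obtain ⟨K, hK⟩ := hne
      have := (hx _ ⟨K, hK, rfl⟩).2
      exact ⟨ha1.trans_le this.1, this.2.trans_lt hb2⟩
    rw [hgap] at hx'; exact hx'
  obtain ⟨x, hx, y, hy, h1, h2, h3, h4, h5⟩ := exists_gap (hc K hKc).1 (ha K hKc) (hb K hKc)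
    ha1.le ((le_max_right l a').trans hb1.le) hb2.le hK
  have hxy : x < y := h2.trans_le (((le_max_right l a').trans hb1.le).trans h3.le)
  refine hUV (x := x) ?_ (y := y) ?_ ((hc K hKc).2 x hx y hy hxy h5)
  · exact hu' ⟨h1, h2.trans (ha2.trans_le (min_le_left _ _))⟩
  · exact hl' ⟨(le_max_left l a').trans_lt (hb1.trans h3), h4⟩

theorem exists_minimal_gapEq (γ : Pth M) : ∃ K : Set I, IsClosed K ∧ 0 ∈ K ∧ 1 ∈ K ∧ GapEq γ K ∧
    ∀ s ∈ K, ∀ t ∈ K, s < t → γ s = γ t → K ∩ Ioo s t = ∅ := by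
  obtain ⟨K, -, hK⟩ := zorn_superset_nonempty {K : Set I | IsClosed K ∧ 0 ∈ K ∧ 1 ∈ K ∧ GapEq γ K}
    (by
      intro c hc hch hne
      refine ⟨⋂₀ c, ⟨isClosed_sInter fun K hK => (hc hK).1, fun K hK => (hc hK).2.1,
        fun K hK => (hc hK).2.2.1, GapEq.sInter (fun K hK => ⟨(hc hK).1, (hc hK).2.2.2⟩) hch hne⟩,
        fun s hs => sInter_subset_of_mem hs⟩)
    univ ⟨isClosed_univ, mem_univ _, mem_univ _, by
      intro a _ b _ hab h
      obtain ⟨x, hx⟩ := exists_between hab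
      exact (h ▸ ⟨mem_univ x, hx⟩ : x ∈ (∅ : Set I)).elim⟩
  obtain ⟨⟨h1, h2, h3, h4⟩, hmin⟩ := hK
  refine ⟨K, h1, h2, h3, h4, fun s hs t ht hst he => ?_⟩
  have hm := hmin (y := K \ Ioo s t) ⟨h1.sdiff isOpen_Ioo, ⟨h2, fun h => not_lt.2 (unitInterval.nonneg s) h.1⟩,
    ⟨h3, fun h => not_lt.2 (unitInterval.le_one t) h.2⟩, ?_⟩ sdiff_subset
  · ext x
    simp only [mem_inter_iff, mem_empty_iff_false, iff_false, not_and]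
    exact fun hx => (hm hx).2
  · intro a ha b hb hab hgap
    by_cases hg : K ∩ Ioo a b = ∅
    · exact h4 a ha.1 b hb.1 hab hg
    obtain ⟨x, hxK, hx⟩ := nonempty_iff_ne_empty.2 hg
    have hx' : x ∈ Ioo s t := by
      by_contra h
      exact (hgap ▸ ⟨⟨hxK, h⟩, hx⟩ : x ∈ (∅ : Set I))
    have has : a ≤ s := by
      by_contra! h
      exact ha.2 ⟨h, hx.1.trans hx'.2⟩
    have hbt : t ≤ b := by
      by_contra! h
      exact hb.2 ⟨hx'.1.trans hx.2, h⟩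
    have has' : a = s := by
      by_contra h
      exact (hgap ▸ ⟨⟨hs, fun h => lt_irrefl _ h.1⟩, lt_of_le_of_ne has h, hx'.1.trans hx.2⟩ : s ∈ (∅ : Set I))
    have hbt' : t = b := by
      by_contra h
      exact (hgap ▸ ⟨⟨ht, fun h => lt_irrefl _ h.2⟩, hx.1.trans hx'.2, lt_of_le_of_ne hbt h⟩ : t ∈ (∅ : Set I))
    rw [has', ← hbt', he]

end Arcs

/-- Every path can be replaced by a path with order-convex fibres with image inside the image of
the given one. -/
theorem exists_monotone_path {M : Type*} [MetricSpace M] (γ : Pth M) :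
    ∃ g : Pth M, g 0 = γ 0 ∧ g 1 = γ 1 ∧ range g ⊆ range γ ∧
      ∀ s u t : I, s ≤ u → u ≤ t → g s = g t → g u = g s := by
  obtain ⟨K, hK, h0, h1, hgap, hmin⟩ := exists_minimal_gapEq γ
  have hp : ∀ t : I, ∃ x, IsGreatest (K ∩ Iic t) x := fun t =>
    (hK.inter isClosed_Iic).isCompact.exists_isGreatest ⟨0, h0, unitInterval.nonneg t⟩
  choose p hp using hp
  have hpK : ∀ t, p t ∈ K := fun t => (hp t).1.1
  have hple : ∀ t, p t ≤ t := fun t => (hp t).1.2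
  have hpm : Monotone p := fun s t h => (hp t).2 ⟨hpK s, (hple s).trans h⟩
  have hpe : ∀ t ∈ K, p t = t := fun t ht => le_antisymm (hple t) ((hp t).2 ⟨ht, le_refl t⟩)
  have key : ∀ s t : I, s ≤ t → p s ≠ p t → ∃ b, s ≤ b ∧ b ≤ p t ∧ γ (p s) = γ b := by
    intro s t hst hne
    have hlt : p s < p t := lt_of_le_of_ne (hpm hst) hne
    have hspt : s ≤ p t := by
      by_contra! h
      exact absurd ((hp s).2 ⟨hpK t, h.le⟩) (not_le.2 hlt)
    by_cases hs : p s = s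
    · exact ⟨s, le_rfl, hspt, by rw [hs]⟩
    obtain ⟨b, hb, hb'⟩ := (hK.inter isClosed_Ici).isCompact.exists_isLeast ⟨p t, hpK t, hspt⟩
    refine ⟨b, hb.2, hb' ⟨hpK t, hspt⟩, hgap _ (hpK s) _ hb.1 ((lt_of_le_of_ne (hple s) hs).trans_le hb.2) ?_⟩
    ext x
    simp only [mem_inter_iff, mem_Ioo, mem_empty_iff_false, iff_false, not_and, not_lt]
    intro hx hx1
    by_contra! hx2
    rcases le_total x s with h | h
    · exact absurd ((hp s).2 ⟨hx, h⟩) (not_le.2 hx1)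
    · exact absurd (hb' ⟨hx, h⟩) (not_le.2 hx2)
  have hcont : Continuous fun t => γ (p t) := by
    have huc := CompactSpace.uniformContinuous_of_continuous γ.continuous
    rw [Metric.uniformContinuous_iff] at huc
    refine UniformContinuous.continuous (Metric.uniformContinuous_iff.2 fun ε hε => ?_)
    obtain ⟨δ, hδ, h⟩ := huc ε hε
    refine ⟨δ, hδ, ?_⟩
    have aux : ∀ s t : I, s ≤ t → dist s t < δ → dist (γ (p s)) (γ (p t)) < ε := by
      intro s t hst hd
      by_cases hne : p s = p t
      · rw [hne, dist_self]; exact hε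
      obtain ⟨b, hb1, hb2, hb3⟩ := key s t hst hne
      rw [hb3]
      refine h (lt_of_le_of_lt ?_ hd)
      rw [Subtype.dist_eq, Subtype.dist_eq, Real.dist_eq, Real.dist_eq, abs_of_nonpos, abs_of_nonpos]
      · have a1 : (s : ℝ) ≤ b := hb1
        have a2 : (p t : ℝ) ≤ t := hple t
        linarith
      · exact sub_nonpos.2 hst
      · exact sub_nonpos.2 hb2
    intro s t hd
    rcases le_total s t with h | h
    · exact aux s t h hd
    · rw [dist_comm]; exact aux t s h (by rwa [dist_comm])
  refine ⟨⟨_, hcont⟩, ?_, ?_, ?_, ?_⟩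
  · simp [hpe 0 h0]
  · simp [hpe 1 h1]
  · rintro _ ⟨t, rfl⟩; exact ⟨p t, rfl⟩
  · intro s u t hsu hut he
    change γ (p u) = γ (p s)
    change γ (p s) = γ (p t) at he
    by_cases h1 : p u = p s
    · rw [h1]
    by_cases h2 : p u = p t
    · rw [h2, he]
    have h3 : p s < p u := lt_of_le_of_ne (hpm hsu) (Ne.symm h1)
    have h4 : p u < p t := lt_of_le_of_ne (hpm hut) h2
    have := hmin _ (hpK s) _ (hpK t) (h3.trans h4) he
    exact (this ▸ ⟨hpK u, h3, h4⟩ : p u ∈ (∅ : Set I)).elim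

end

section

section Canonical

variable {M : Type*} [MetricSpace M] [SecondCountableTopology M] [Nonempty M]

/-- A strictly antitone weight of compact sets. -/
noncomputable def weight (A : Set M) : ℝ :=
  ∑' i : ℕ, (1 / 2 : ℝ) ^ i * min 1 (Metric.infDist (TopologicalSpace.denseSeq M i) A)

theorem weight_summable (A : Set M) :
    Summable fun i : ℕ => (1 / 2 : ℝ) ^ i * min 1 (Metric.infDist (TopologicalSpace.denseSeq M i) A) := by
  refine Summable.of_nonneg_of_le (fun i => ?_) (fun i => ?_) summable_geometric_two
  · exact mul_nonneg (by positivity) (le_min zero_le_one Metric.infDist_nonneg)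
  · exact mul_le_of_le_one_right (by positivity) (min_le_left _ _)

theorem weight_anti {A B : Set M} (hA : A.Nonempty) (h : A ⊆ B) : weight B ≤ weight A := by
  refine (weight_summable B).tsum_le_tsum (fun i => ?_) (weight_summable A)
  have := Metric.infDist_le_infDist_of_subset (x := TopologicalSpace.denseSeq M i) h hA
  gcongr

theorem weight_strictAnti {A B : Set M} (hA : A.Nonempty) (hc : IsClosed A) (h : A ⊆ B) {x : M}
    (hx : x ∈ B) (hxA : x ∉ A) : weight B < weight A := by
  have hpos : 0 < Metric.infDist x A := (hc.notMem_iff_infDist_pos hA).1 hxA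
  obtain ⟨i, hi⟩ : ∃ i, dist x (TopologicalSpace.denseSeq M i) < min 1 (Metric.infDist x A / 2) := by
    exact (TopologicalSpace.denseRange_denseSeq M).exists_dist_lt x (by positivity)
  refine (weight_summable B).tsum_lt_tsum (i := i) (fun i => ?_) ?_ (weight_summable A)
  · have := Metric.infDist_le_infDist_of_subset (x := TopologicalSpace.denseSeq M i) h hA
    gcongr
  · have h1 := Metric.infDist_le_dist_of_mem (x := TopologicalSpace.denseSeq M i) hx
    have h2 := Metric.infDist_le_infDist_add_dist (s := A) (x := x) (y := TopologicalSpace.denseSeq M i)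
    rw [dist_comm] at h1
    have h3 := lt_min_iff.1 hi
    refine mul_lt_mul_of_pos_left ?_ (by positivity)
    rw [min_eq_right (h1.trans h3.1.le)]
    refine lt_min (h1.trans_lt h3.1) (by linarith)

/-- Weight of an initial segment of a path. -/
noncomputable def wt (γ : Pth M) (t : I) : ℝ := weight (γ '' Iic t)

omit [SecondCountableTopology M] [Nonempty M] in
theorem image_Iic (γ : Pth M) (t : I) : γ '' Iic t = (fun u : I => γ (t * u)) '' univ := by
  ext x
  constructor
  · rintro ⟨s, hs, rfl⟩
    rcases eq_or_ne t 0 with rfl | ht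
    · refine ⟨0, mem_univ _, ?_⟩
      have hs0 : s = 0 := le_antisymm hs (unitInterval.nonneg s)
      simp [hs0]
    · have ht' : 0 < (t : ℝ) := unitInterval.pos_iff_ne_zero.2 ht
      refine ⟨⟨s / t, div_nonneg s.2.1 ht'.le, (div_le_one ht').2 hs⟩, mem_univ _, ?_⟩
      simp only
      congr 1
      ext
      simp [mul_div_cancel₀, ht'.ne']
  · rintro ⟨u, -, rfl⟩
    exact ⟨t * u, unitInterval.mul_le_left, rfl⟩

theorem wt_continuous : Continuous fun p : Pth M × I => wt p.1 p.2 := by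
  unfold wt weight
  refine continuous_tsum (u := fun i => (1 / 2 : ℝ) ^ i) (fun i => ?_) summable_geometric_two ?_
  · refine continuous_const.mul (continuous_const.min ?_)
    have : (fun p : Pth M × I => Metric.infDist (TopologicalSpace.denseSeq M i) (p.1 '' Iic p.2)) =
        fun p : Pth M × I => sInf ((fun u => dist (TopologicalSpace.denseSeq M i) (p.1 (p.2 * u))) '' univ) := by
      ext p
      rw [Metric.infDist_eq_iInf, ← sInf_image' (f := dist (TopologicalSpace.denseSeq M i)),
        image_Iic, image_image]
    rw [this]
    refine isCompact_univ.continuous_sInf ?_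
    have : Continuous (fun x : (Pth M × I) × I =>
        dist (TopologicalSpace.denseSeq M i) (x.1.1 (x.1.2 * x.2))) := by
      refine continuous_const.dist ?_
      refine Continuous.eval (by fun_prop) ?_
      fun_prop
    exact this
  · intro i p
    rw [Real.norm_of_nonneg (mul_nonneg (by positivity) (le_min zero_le_one Metric.infDist_nonneg))]
    exact mul_le_of_le_one_right (by positivity) (min_le_left _ _)

/-- Injective paths parametrized proportionally to weight. -/
def Can (α : Pth M) : Prop :=
  Function.Injective α ∧ ∀ t : I, wt α t = wt α 0 + t * (wt α 1 - wt α 0)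

theorem wt_lt {α : Pth M} {s t : I} (h : s < t) (ht : α t ∉ α '' Iic s) : wt α t < wt α s :=
  weight_strictAnti ⟨_, 0, unitInterval.nonneg s, rfl⟩
    ((isClosed_Iic.isCompact.image α.continuous).isClosed) (image_mono (Iic_subset_Iic.2 h.le))
    ⟨t, le_refl t, rfl⟩ ht

omit [SecondCountableTopology M] [Nonempty M] in
/-- An injective path inside the range of an injective path factors through it. -/
theorem exists_factor {α β : Pth M} (hβ : Function.Injective β) (h : range α ⊆ range β) :
    ∃ φ : C(I, I), ∀ t, α t = β (φ t) := by
  let e := (β.continuous.isClosedEmbedding hβ).isEmbedding.toHomeomorph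
  refine ⟨⟨fun t => e.symm ⟨α t, h ⟨t, rfl⟩⟩, by fun_prop⟩, fun t => ?_⟩
  have := e.apply_symm_apply ⟨α t, h ⟨t, rfl⟩⟩
  exact (congrArg Subtype.val this).symm

omit [SecondCountableTopology M] [Nonempty M] in
theorem exists_strictMono_factor {α β : Pth M} (hα : Function.Injective α)
    (hβ : Function.Injective β) (h0 : α 0 = β 0) (h : range α ⊆ range β) :
    ∃ φ : C(I, I), (∀ t, α t = β (φ t)) ∧ StrictMono φ ∧ φ 0 = 0 := by
  obtain ⟨φ, hφ⟩ := exists_factor hβ h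
  have hφ0 : φ 0 = 0 := hβ (by rw [← hφ, h0])
  have hinj : Function.Injective φ := fun s t hst => hα (by rw [hφ, hφ, hst])
  exact ⟨φ, hφ, φ.continuous.strictMono_of_inj_boundedOrder
    (by change φ 0 ≤ φ 1; rw [hφ0]; exact unitInterval.nonneg _) hinj, hφ0⟩

theorem Can.ext {α β : Pth M} (hα : Can α) (hβ : Can β) (h0 : α 0 = β 0)
    (hr : range α = range β) : α = β := by
  obtain ⟨φ, hφ, hmono, hφ0⟩ := exists_strictMono_factor hα.1 hβ.1 h0 hr.subset
  have hsurj : Function.Surjective φ := fun t => by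
    obtain ⟨s, hs⟩ : β t ∈ range α := hr ▸ ⟨t, rfl⟩
    exact ⟨s, hβ.1 (by rw [← hφ, hs])⟩
  have hφ1 : φ 1 = 1 := by
    obtain ⟨s, hs⟩ := hsurj 1
    exact le_antisymm (unitInterval.le_one _) (hs.symm.le.trans (hmono.monotone (unitInterval.le_one s)))
  have hw : ∀ t, wt α t = wt β (φ t) := by
    intro t
    unfold wt
    congr 1
    ext x
    constructor
    · rintro ⟨s, hs, rfl⟩
      exact ⟨φ s, hmono.monotone hs, (hφ s).symm⟩
    · rintro ⟨s, hs, rfl⟩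
      obtain ⟨u, rfl⟩ := hsurj s
      exact ⟨u, hmono.le_iff_le.1 hs, hφ u⟩
  ext t
  have h1 : wt β (φ t) = wt β t := by
    rw [← hw, hα.2, hβ.2, hw 0, hw 1, hφ0, hφ1]
  have h2 : φ t = t := by
    by_contra hne
    rcases lt_or_gt_of_ne hne with h | h
    · refine (wt_lt h ?_).ne' h1
      rintro ⟨s, hs, he⟩
      exact absurd (hβ.1 he ▸ hs) (not_le.2 h)
    · refine (wt_lt h ?_).ne h1
      rintro ⟨s, hs, he⟩
      exact absurd (hβ.1 he ▸ hs) (not_le.2 h)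
  rw [hφ, h2]

theorem wt_continuous_right (g : Pth M) : Continuous (wt g) := by
  have h : Continuous fun t : I => ((g, t) : Pth M × I) := Continuous.prodMk_right g
  have := wt_continuous.comp h
  exact this

/-- Any two distinct points joined by a path are joined by a canonical arc inside it. -/
theorem exists_can (γ : Pth M) (h : γ 0 ≠ γ 1) :
    ∃ α : Pth M, Can α ∧ α 0 = γ 0 ∧ α 1 = γ 1 ∧ range α ⊆ range γ := by
  obtain ⟨g, hg0, hg1, hr, hg⟩ := exists_monotone_path γ
  have hanti : Antitone (wt g) := fun s t hst =>
    weight_anti ⟨_, 0, unitInterval.nonneg s, rfl⟩ (image_mono (Iic_subset_Iic.2 hst))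
  have hne : ∀ s t : I, s < t → g s ≠ g t → wt g t < wt g s := by
    intro s t hst hne
    refine wt_lt hst ?_
    rintro ⟨u, hu, he⟩
    exact hne (by rw [hg u s t hu hst.le he, he])
  have h01 : wt g 1 < wt g 0 := hne 0 1 zero_lt_one (by rw [hg0, hg1]; exact h)
  obtain ⟨H, hHv⟩ : ∃ H : C(I, I), ∀ t, (H t : ℝ) = (wt g 0 - wt g t) / (wt g 0 - wt g 1) :=
    ⟨⟨fun t => ⟨(wt g 0 - wt g t) / (wt g 0 - wt g 1),
      div_nonneg (sub_nonneg.2 (hanti (unitInterval.nonneg t))) (by linarith),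
      (div_le_one (by linarith)).2 (by linarith [hanti (show t ≤ 1 from unitInterval.le_one t)])⟩,
      ((continuous_const.sub (wt_continuous_right g)).div_const _).subtype_mk _⟩, fun t => rfl⟩
  have hH0 : H 0 = 0 := by ext; simp [hHv]
  have hH1 : H 1 = 1 := by ext; rw [hHv, div_self (by linarith)]; rfl
  have hHm : Monotone H := fun s t hst => by
    change (H s : ℝ) ≤ H t
    rw [hHv, hHv]
    have := hanti hst
    exact div_le_div_of_nonneg_right (by linarith) (by linarith)
  have hsurj : Function.Surjective H := fun y => by
    obtain ⟨x, -, hx⟩ := isPreconnected_univ.intermediate_value (mem_univ (0 : I)) (mem_univ 1)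
      H.continuous.continuousOn (show y ∈ Icc (H 0) (H 1) by
        rw [hH0, hH1]; exact ⟨unitInterval.nonneg _, unitInterval.le_one _⟩)
    exact ⟨x, hx⟩
  have hHg : ∀ s t, H s = H t ↔ g s = g t := by
    have hw : ∀ s t, H s = H t ↔ wt g s = wt g t := fun s t => by
      rw [Subtype.ext_iff, hHv, hHv, div_left_inj' (by linarith)]
      constructor <;> intro h <;> linarith
    have : ∀ s t, s < t → (wt g s = wt g t ↔ g s = g t) := by
      intro s t hst
      constructor
      · intro h
        by_contra hn
        exact (hne s t hst hn).ne' h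
      · intro h
        unfold wt
        congr 1
        refine subset_antisymm (image_mono (Iic_subset_Iic.2 hst.le)) ?_
        rintro _ ⟨u, hu, rfl⟩
        rcases le_total u s with h' | h'
        · exact ⟨u, h', rfl⟩
        · exact ⟨s, le_refl s, (hg s u t h' hu h).symm⟩
    intro s t
    rw [hw]
    rcases lt_trichotomy s t with h | rfl | h
    · exact this s t h
    · simp
    · rw [eq_comm, this t s h, eq_comm]
  have hq : IsQuotientMap H := (H.continuous.isClosedMap).isQuotientMap H.continuous hsurj
  obtain ⟨α, hα⟩ : ∃ α : Pth M, ∀ t, α (H t) = g t :=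
    ⟨hq.lift g (fun s t h => (hHg s t).1 h), fun t =>
      congrArg (fun f : Pth M => f t) (hq.lift_comp g (fun s t h => (hHg s t).1 h))⟩
  have hwα : ∀ t, wt α (H t) = wt g t := by
    intro t
    unfold wt
    congr 1
    ext x
    constructor
    · rintro ⟨s, hs, rfl⟩
      obtain ⟨u, rfl⟩ := hsurj s
      rcases le_total u t with h' | h'
      · exact ⟨u, h', (hα u).symm⟩
      · refine ⟨t, le_refl t, ?_⟩
        rw [hα, (hHg t u).1 (le_antisymm (hHm h') hs)]
    · rintro ⟨u, hu, rfl⟩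
      exact ⟨H u, hHm hu, hα u⟩
  refine ⟨α, ⟨?_, ?_⟩, ?_, ?_, ?_⟩
  · intro s t hst
    obtain ⟨u, rfl⟩ := hsurj s
    obtain ⟨v, rfl⟩ := hsurj t
    rw [hα, hα] at hst
    exact (hHg u v).2 hst
  · intro t
    obtain ⟨u, rfl⟩ := hsurj t
    have e0 := hwα 0
    have e1 := hwα 1
    rw [hH0] at e0
    rw [hH1] at e1
    rw [hwα, e0, e1, hHv]
    field_simp [show wt g 0 - wt g 1 ≠ 0 by linarith]
    ring
  · rw [← hg0, ← hα 0, hH0]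
  · rw [← hg1, ← hα 1, hH1]
  · rintro _ ⟨t, rfl⟩
    obtain ⟨u, rfl⟩ := hsurj t
    rw [hα]; exact hr ⟨u, rfl⟩

end Canonical

end

section

/-- The affine reparametrization of the unit interval from `a` to `b`. -/
def lin (a b : I) : C(I, I) :=
  ⟨fun s => ⟨(1 - s) * a + s * b, by
    have h1 := s.2.1
    have h2 := s.2.2
    have h3 := a.2.1
    have h4 := a.2.2
    have h5 := b.2.1
    have h6 := b.2.2
    constructor <;> nlinarith⟩, by fun_prop⟩

theorem lin_val (a b s : I) : (lin a b s : ℝ) = (1 - s) * a + s * b := rfl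

@[simp] theorem lin_zero (a b : I) : lin a b 0 = a := by ext; simp [lin_val]

@[simp] theorem lin_one (a b : I) : lin a b 1 = b := by ext; simp [lin_val]

theorem lin_injective {a b : I} (h : a ≠ b) : Function.Injective (lin a b) := by
  intro s t hst
  have h1 := congrArg Subtype.val hst
  simp only [lin_val] at h1
  have h2 : (b : ℝ) - a ≠ 0 := sub_ne_zero.2 fun e => h (Subtype.ext e.symm)
  ext
  exact mul_right_cancel₀ h2 (by linarith)

theorem lin_mem (a b s : I) : lin a b s ∈ uIcc a b := by
  rcases le_total a b with h | h
  · rw [uIcc_of_le h]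
    have h' : (a : ℝ) ≤ b := h
    have := s.2.1
    have := s.2.2
    constructor <;> rw [← Subtype.coe_le_coe, lin_val] <;> nlinarith
  · rw [uIcc_of_ge h]
    have h' : (b : ℝ) ≤ a := h
    have := s.2.1
    have := s.2.2
    constructor <;> rw [← Subtype.coe_le_coe, lin_val] <;> nlinarith

theorem exists_lin {a b x : I} (h : x ∈ uIcc a b) : ∃ s, lin a b s = x := by
  have key : ∀ {a b x : I}, x ∈ Icc a b → ∃ s, lin a b s = x := by
    intro a b x hx
    obtain ⟨s, -, hs⟩ := isPreconnected_univ.intermediate_value (mem_univ (0 : I)) (mem_univ 1)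
      (lin a b).continuous.continuousOn (show x ∈ Icc (lin a b 0) (lin a b 1) by simpa using hx)
    exact ⟨s, hs⟩
  rcases le_total a b with hab | hab
  · exact key (by rwa [uIcc_of_le hab] at h)
  · rw [uIcc_of_ge hab] at h
    obtain ⟨s, -, hs⟩ := isPreconnected_univ.intermediate_value (mem_univ (1 : I)) (mem_univ 0)
      (lin a b).continuous.continuousOn (show x ∈ Icc (lin a b 1) (lin a b 0) by simpa using h)
    exact ⟨s, hs⟩

theorem lin_lt_lin {a b s t : I} (h : a < b) (hst : s < t) : lin a b s < lin a b t := by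
  have h' : (a : ℝ) < b := h
  have hst' : (s : ℝ) < t := hst
  change (lin a b s : ℝ) < lin a b t
  rw [lin_val, lin_val]
  nlinarith

theorem lin_gt_lin {a b s t : I} (h : b < a) (hst : s < t) : lin a b t < lin a b s := by
  have h' : (b : ℝ) < a := h
  have hst' : (s : ℝ) < t := hst
  change (lin a b t : ℝ) < lin a b s
  rw [lin_val, lin_val]
  nlinarith

section Seg

variable {M : Type*} [TopologicalSpace M]

/-- The subpath of `γ` between the parameters `a` and `b`. -/
def seg (γ : Pth M) (a b : I) : Pth M := γ.comp (lin a b)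

theorem seg_apply (γ : Pth M) (a b s : I) : seg γ a b s = γ (lin a b s) := rfl

@[simp] theorem seg_zero (γ : Pth M) (a b : I) : seg γ a b 0 = γ a := by simp [seg_apply]

@[simp] theorem seg_one (γ : Pth M) (a b : I) : seg γ a b 1 = γ b := by simp [seg_apply]

theorem seg_injective {γ : Pth M} (hγ : Function.Injective γ) {a b : I} (h : a ≠ b) :
    Function.Injective (seg γ a b) := hγ.comp (lin_injective h)

theorem range_seg (γ : Pth M) (a b : I) : range (seg γ a b) = γ '' uIcc a b := by
  ext x
  constructor
  · rintro ⟨s, rfl⟩; exact ⟨_, lin_mem a b s, rfl⟩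
  · rintro ⟨t, ht, rfl⟩
    obtain ⟨s, rfl⟩ := exists_lin ht
    exact ⟨s, rfl⟩

theorem joinedIn_range (γ : Pth M) {O : Set M} (h : ∀ s, γ s ∈ O) : JoinedIn O (γ 0) (γ 1) :=
  ⟨⟨γ, rfl, rfl⟩, h⟩

theorem joinedIn_pth (γ : Pth M) {O : Set M} {a b : I} (h : ∀ s ∈ uIcc a b, γ s ∈ O) :
    JoinedIn O (γ a) (γ b) := by
  have := joinedIn_range (seg γ a b) (O := O) fun s => h _ (lin_mem a b s)
  simpa using this

theorem _root_.JoinedIn.exists_pth {O : Set M} {x y : M} (h : JoinedIn O x y) :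
    ∃ γ : Pth M, γ 0 = x ∧ γ 1 = y ∧ ∀ s, γ s ∈ O := by
  obtain ⟨p, hp⟩ := h
  exact ⟨p.toContinuousMap, p.source, p.target, hp⟩

/-- Three arcs with a common origin and no other common points. -/
def IsTriod (a : Fin 3 → Pth M) : Prop :=
  (∀ i, Function.Injective (a i)) ∧ (∀ i j, a i 0 = a j 0) ∧
    ∀ i j, i ≠ j → ∀ s u, a i s = a j u → s = 0

/-- The set `S` meets one of the first two legs of every triod. -/
def TriodHit (S : Set M) : Prop :=
  ∀ a : Fin 3 → Pth M, IsTriod a → (∃ s, a 0 s ∈ S) ∨ ∃ s, a 1 s ∈ S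

theorem isTriod_vec {a b c : Pth M} (ha : Function.Injective a) (hb : Function.Injective b)
    (hc : Function.Injective c) (hab : a 0 = b 0) (hac : a 0 = c 0)
    (h1 : ∀ s u, a s = b u → s = 0) (h2 : ∀ s u, a s = c u → s = 0)
    (h3 : ∀ s u, b s = c u → s = 0) : IsTriod ![a, b, c] := by
  have hbc : b 0 = c 0 := hab.symm.trans hac
  have h1' : ∀ s u, b s = a u → s = 0 := fun s u h => hb (by
    rw [h, h1 u s h.symm, hab])
  have h2' : ∀ s u, c s = a u → s = 0 := fun s u h => hc (by
    rw [h, h2 u s h.symm, hac])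
  have h3' : ∀ s u, c s = b u → s = 0 := fun s u h => hc (by
    rw [h, h3 u s h.symm, ← hab, hac])
  refine ⟨fun i => ?_, fun i j => ?_, fun i j hij => ?_⟩
  · fin_cases i <;> assumption
  · fin_cases i <;> fin_cases j
    all_goals first | rfl | exact hab | exact hac | exact hbc | exact hab.symm | exact hac.symm | exact hbc.symm
  · fin_cases i <;> fin_cases j
    all_goals first | exact absurd rfl hij | assumption

theorem TriodHit.mono {S T : Set M} (h : TriodHit S) (hST : S ⊆ T) : TriodHit T := fun a ha =>
  (h a ha).imp (fun ⟨s, hs⟩ => ⟨s, hST hs⟩) (fun ⟨s, hs⟩ => ⟨s, hST hs⟩)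

variable {S : Set M}

/-- No arc branches off an interior point of an arc whose interior avoids `S`. -/
theorem TriodHit.no_branch (hS : TriodHit S) {α β : Pth M} (hα : Function.Injective α)
    (hβ : Function.Injective β) (hfree : ∀ s, 0 < s → s < 1 → β s ∉ S) {u : I} (h0 : 0 < u)
    (h1 : u < 1) (hu : α 0 = β u) (hd : ∀ s, 0 < s → α s ∉ range β) : False := by
  obtain ⟨v, hv0, hv⟩ := exists_between h0
  obtain ⟨w, hw, hw1⟩ := exists_between h1
  have hαβ : ∀ s x, α s = β x → s = 0 := fun s x h => by
    by_contra hne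
    exact hd s (unitInterval.pos_iff_ne_zero.2 hne) ⟨x, h.symm⟩
  have hαβ' : ∀ s x, β x = α s → x = u := fun s x h => by
    have := hαβ s x h.symm
    rw [this, hu] at h
    exact hβ h
  have ht : IsTriod ![seg β u v, seg β u w, α] := by
    refine isTriod_vec (seg_injective hβ hv.ne') (seg_injective hβ hw.ne) hα (by simp)
      (by simp [hu]) ?_ ?_ ?_
    · intro s x h
      have h' := hβ h
      have a1 := lin_mem u v s
      have a2 := lin_mem u w x
      rw [uIcc_of_ge hv.le] at a1
      rw [uIcc_of_le hw.le] at a2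
      refine lin_injective hv.ne' ?_
      rw [lin_zero]
      exact le_antisymm a1.2 (h' ▸ a2.1)
    · intro s x h
      exact lin_injective hv.ne' ((hαβ' x _ h).trans (lin_zero _ _).symm)
    · intro s x h
      exact lin_injective hw.ne ((hαβ' x _ h).trans (lin_zero _ _).symm)
  rcases hS _ ht with ⟨s, hs⟩ | ⟨s, hs⟩
  · have a1 := lin_mem u v s
    rw [uIcc_of_ge hv.le] at a1
    exact hfree _ (hv0.trans_le a1.1) (a1.2.trans_lt h1) hs
  · have a1 := lin_mem u w s
    rw [uIcc_of_le hw.le] at a1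
    exact hfree _ (h0.trans_le a1.1) (a1.2.trans_lt hw1) hs

variable [T2Space M]

omit [T2Space M] in
theorem exists_last_mem (α : Pth M) {C : Set M} (hC : IsClosed C) (h0 : α 0 ∈ C) {s : I} (hs : α s ∉ C) :
    ∃ t < s, α t ∈ C ∧ ∀ u, t < u → u ≤ s → α u ∉ C := by
  obtain ⟨t, ht, ht'⟩ := ((hC.preimage α.continuous).inter (isClosed_Iic (a := s))).isCompact.exists_isGreatest
    ⟨0, h0, unitInterval.nonneg s⟩
  refine ⟨t, lt_of_le_of_ne ht.2 ?_, ht.1, fun u hu hus hm => ?_⟩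
  · rintro rfl; exact hs ht.1
  · exact absurd (ht' ⟨hm, hus⟩) (not_le.2 hu)

omit [T2Space M] in
theorem exists_first_mem (α : Pth M) {C : Set M} (hC : IsClosed C) (h1 : α 1 ∈ C) {s : I} (hs : α s ∉ C) :
    ∃ t, s < t ∧ α t ∈ C ∧ ∀ u, s ≤ u → u < t → α u ∉ C := by
  obtain ⟨t, ht, ht'⟩ := ((hC.preimage α.continuous).inter (isClosed_Ici (a := s))).isCompact.exists_isLeast
    ⟨1, h1, unitInterval.le_one s⟩
  refine ⟨t, lt_of_le_of_ne ht.2 ?_, ht.1, fun u hu hus hm => ?_⟩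
  · rintro rfl; exact hs ht.1
  · exact absurd (ht' ⟨hm, hu⟩) (not_le.2 hus)

theorem isClosed_range_pth (γ : Pth M) : IsClosed (range γ) :=
  (isCompact_range γ.continuous).isClosed

/-- Two arcs from a common point with `S`-free interiors are nested or have disjoint germs. -/
theorem TriodHit.nested_or_disjoint (hS : TriodHit S) {α β : Pth M} (hα : Function.Injective α)
    (hβ : Function.Injective β) (h0 : α 0 = β 0) (hfα : ∀ s, 0 < s → s < 1 → α s ∉ S)
    (hfβ : ∀ s, 0 < s → s < 1 → β s ∉ S) :
    range α ⊆ range β ∨ range β ⊆ range α ∨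
      ∃ s₁ : I, 0 < s₁ ∧ ∀ s, 0 < s → s ≤ s₁ → α s ∉ range β := by
  by_cases hsub : range α ⊆ range β
  · exact Or.inl hsub
  by_cases hsub' : range β ⊆ range α
  · exact Or.inr (Or.inl hsub')
  refine Or.inr (Or.inr ?_)
  obtain ⟨_, ⟨s, rfl⟩, hs⟩ := not_subset.1 hsub
  obtain ⟨_, ⟨u₁, rfl⟩, hu₁⟩ := not_subset.1 hsub'
  have branch : ∀ {α β : Pth M}, Function.Injective α → Function.Injective β →
      (∀ s, 0 < s → s < 1 → β s ∉ S) → ∀ (a b u : I), a ≠ b → α a = β u → 0 < u → u < 1 →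
      (∀ x ∈ uIcc a b, x ≠ a → α x ∉ range β) → False := by
    intro α β hα hβ hf a b u hab hau hu0 hu1 hd
    refine hS.no_branch (seg_injective hα hab) hβ hf hu0 hu1 (by simpa using hau) fun s hs => ?_
    refine hd _ (lin_mem a b s) fun h => hs.ne' ?_
    exact lin_injective hab (h.trans (lin_zero _ _).symm)
  obtain ⟨s₀, hs₀, ⟨u₀, hu₀⟩, hlast⟩ := exists_last_mem α (isClosed_range_pth β) (h0 ▸ ⟨0, rfl⟩) hs
  by_cases hu00 : u₀ = 0
  · have : s₀ = 0 := hα (by rw [← hu₀, hu00, h0])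
    subst this
    exact ⟨s, hs₀, hlast⟩
  by_cases hu01 : u₀ < 1
  · refine (branch hα hβ hfβ s₀ s u₀ hs₀.ne hu₀.symm (unitInterval.pos_iff_ne_zero.2 hu00) hu01 ?_).elim
    intro x hx hxa
    rw [uIcc_of_le hs₀.le] at hx
    exact hlast x (lt_of_le_of_ne hx.1 (Ne.symm hxa)) hx.2
  have hu1 : u₀ = 1 := le_antisymm (unitInterval.le_one _) (not_lt.1 hu01)
  subst hu1
  obtain ⟨v₀, hv₀, ⟨w₀, hw₀⟩, hlast'⟩ := exists_last_mem β (isClosed_range_pth α) (h0 ▸ ⟨0, rfl⟩) hu₁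
  by_cases hw00 : w₀ = 0
  · have : v₀ = 0 := hβ (by rw [← hw₀, hw00, h0])
    subst this
    have hcl : IsClosed (β '' Icc u₁ 1) := (isClosed_Icc.isCompact.image β.continuous).isClosed
    have hn : α 0 ∉ β '' Icc u₁ 1 := by
      rintro ⟨x, hx, he⟩
      rw [h0] at he
      exact absurd (hβ he ▸ hx.1) (not_le.2 hv₀)
    have hev : ∀ᶠ s in 𝓝 (0 : I), α s ∉ β '' Icc u₁ 1 :=
      α.continuous.continuousAt.preimage_mem_nhds (hcl.isOpen_compl.mem_nhds hn)
    obtain ⟨b, hb, hb'⟩ := exists_Ico_subset_of_mem_nhds hev ⟨1, zero_lt_one⟩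
    obtain ⟨s₁, h1, h2⟩ := exists_between hb
    refine ⟨s₁, h1, fun x hx hx1 => ?_⟩
    rintro ⟨y, hy⟩
    rcases eq_or_ne y 0 with rfl | hy0
    · exact hx.ne' (hα (by rw [← hy, h0]))
    rcases le_total y u₁ with h | h
    · exact hlast' y (unitInterval.pos_iff_ne_zero.2 hy0) h ⟨x, hy.symm⟩
    · exact hb' ⟨hx.le, hx1.trans_lt h2⟩ ⟨y, ⟨h, unitInterval.le_one _⟩, hy⟩
  by_cases hw01 : w₀ < 1
  · refine (branch hβ hα hfα v₀ u₁ w₀ hv₀.ne hw₀.symm (unitInterval.pos_iff_ne_zero.2 hw00) hw01 ?_).elim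
    intro x hx hxa
    rw [uIcc_of_le hv₀.le] at hx
    exact hlast' x (lt_of_le_of_ne hx.1 (Ne.symm hxa)) hx.2
  have hw1 : w₀ = 1 := le_antisymm (unitInterval.le_one _) (not_lt.1 hw01)
  subst hw1
  obtain ⟨u₂, hu₂, ⟨s₂, hs₂⟩, hfirst⟩ := exists_first_mem β (isClosed_range_pth α) ⟨s₀, hu₀.symm⟩ hu₁
  refine (branch hβ hα hfα u₂ u₁ s₂ hu₂.ne' hs₂.symm ?_ ?_ ?_).elim
  · refine unitInterval.pos_iff_ne_zero.2 ?_
    rintro rfl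
    rw [h0] at hs₂
    exact absurd (hβ hs₂ ▸ hu₂) (not_lt.2 (unitInterval.nonneg _))
  · refine lt_of_le_of_ne (unitInterval.le_one _) ?_
    rintro rfl
    have := hβ (hs₂.symm.trans hw₀)
    exact absurd (this ▸ hv₀) (not_lt.2 hu₂.le)
  · intro x hx hxa
    rw [uIcc_of_ge hu₂.le] at hx
    exact hfirst x hx.1 (lt_of_le_of_ne hx.2 hxa)

/-- Among three `S`-free arcs from a point two are nested. -/
theorem TriodHit.exists_nested (hS : TriodHit S) (a : Fin 3 → Pth M)
    (ha : ∀ i, Function.Injective (a i)) (h0 : ∀ i j, a i 0 = a j 0)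
    (hf : ∀ i s, s < 1 → a i s ∉ S) : ∃ i j, i ≠ j ∧ range (a i) ⊆ range (a j) := by
  by_contra! hcon
  have h1 : ∀ i j, ∃ s₁ : I, 0 < s₁ ∧ (i ≠ j → ∀ s, 0 < s → s ≤ s₁ → a i s ∉ range (a j)) := by
    intro i j
    by_cases hij : i = j
    · exact ⟨1, zero_lt_one, fun h => absurd hij h⟩
    rcases hS.nested_or_disjoint (ha i) (ha j) (h0 i j) (fun s _ h => hf i s h)
      (fun s _ h => hf j s h) with h | h | ⟨s, hs, h⟩
    · exact (hcon i j hij h).elim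
    · exact (hcon j i (Ne.symm hij) h).elim
    · exact ⟨s, hs, fun _ => h⟩
  choose τ hτ hτ' using h1
  let m := Finset.univ.inf' Finset.univ_nonempty (fun p : Fin 3 × Fin 3 => τ p.1 p.2)
  have hm : 0 < m := by
    rw [Finset.lt_inf'_iff]; exact fun p _ => hτ _ _
  have hm' : ∀ i j, m ≤ τ i j := fun i j => Finset.inf'_le _ (Finset.mem_univ (i, j))
  obtain ⟨w, hw0, hw⟩ := exists_between hm
  have hw1 : w < 1 := hw.trans_le (unitInterval.le_one _)
  have hle : ∀ s, lin 0 w s ≤ w := fun s => by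
    have := lin_mem 0 w s
    rw [uIcc_of_le hw0.le] at this
    exact this.2
  have ht : IsTriod (fun i => seg (a i) 0 w) := by
    refine ⟨fun i => seg_injective (ha i) hw0.ne, fun i j => by simpa using h0 i j, ?_⟩
    intro i j hij s u h
    by_contra hne
    refine hτ' i j hij (lin 0 w s) ?_ ((hle s).trans (hw.le.trans (hm' i j))) ⟨_, h.symm⟩
    have := lin_lt_lin hw0 (unitInterval.pos_iff_ne_zero.2 hne)
    rwa [lin_zero] at this
  rcases hS _ ht with ⟨s, hs⟩ | ⟨s, hs⟩ <;> exact hf _ _ ((hle s).trans_lt hw1) hs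

end Seg

end

section

section Sections

variable {X Z : Type*} [MeasurableSpace X] [StandardBorelSpace X] [MeasurableSpace Z]
  [StandardBorelSpace Z]

theorem exists_selector_of_injOn [Nonempty Z] {L : Set (X × Z)} (hL : MeasurableSet L)
    (hinj : InjOn Prod.fst L) : ∃ g : X → Z, Measurable g ∧ ∀ x ∈ Prod.fst '' L, (x, g x) ∈ L := by
  classical
  obtain ⟨z₀⟩ := ‹Nonempty Z›
  have hex : ∀ x, ∃ z, (x ∈ Prod.fst '' L → (x, z) ∈ L) ∧ (x ∉ Prod.fst '' L → z = z₀) := by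
    intro x
    by_cases hx : x ∈ Prod.fst '' L
    · obtain ⟨⟨x', z⟩, h, rfl⟩ := hx
      exact ⟨z, fun _ => h, fun h' => absurd ⟨_, h, rfl⟩ h'⟩
    · exact ⟨z₀, fun h => absurd h hx, fun _ => rfl⟩
  choose g hg hg' using hex
  refine ⟨g, fun B hB => ?_, hg⟩
  have h1 : MeasurableSet (Prod.fst '' L) := hL.image_of_measurable_injOn measurable_fst hinj
  have h2 : MeasurableSet (Prod.fst '' (L ∩ Prod.snd ⁻¹' B)) :=
    (hL.inter (measurable_snd hB)).image_of_measurable_injOn measurable_fst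
      (hinj.mono inter_subset_left)
  have : g ⁻¹' B = Prod.fst '' (L ∩ Prod.snd ⁻¹' B) ∪ ((Prod.fst '' L)ᶜ ∩ {_x | z₀ ∈ B}) := by
    ext x
    by_cases hx : x ∈ Prod.fst '' L
    · constructor
      · intro h
        exact Or.inl ⟨(x, g x), ⟨hg x hx, h⟩, rfl⟩
      · rintro (⟨⟨x', z⟩, ⟨h, hz⟩, rfl⟩ | h)
        · have := hinj h (hg _ hx) rfl
          have h3 : z = g x' := congrArg Prod.snd this
          show g x' ∈ B
          rw [← h3]
          exact hz
        · exact absurd hx h.1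
    · constructor
      · intro h
        have h' : g x ∈ B := h
        rw [hg' x hx] at h'
        exact Or.inr ⟨hx, h'⟩
      · rintro (⟨p, ⟨h, hz⟩, rfl⟩ | h)
        · exact absurd ⟨p, h, rfl⟩ hx
        · show g x ∈ B
          rw [hg' x hx]
          exact h.2
  rw [this]
  exact h2.union (h1.compl.inter (MeasurableSet.const _))

/-- Projections of Borel sets whose sections have at most two points. -/
theorem image_fst_of_sections_le_two [Nonempty Z] {P : Set (X × Z)} (hP : MeasurableSet P)
    (h2 : ∀ x a b c, (x, a) ∈ P → (x, b) ∈ P → (x, c) ∈ P → a = b ∨ a = c ∨ b = c) :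
    MeasurableSet (Prod.fst '' P) ∧
      ∃ g : X → Z, Measurable g ∧ ∀ x ∈ Prod.fst '' P, (x, g x) ∈ P := by
  obtain ⟨e, he⟩ := MeasureTheory.exists_measurableEmbedding_real Z
  let Q : Set (X × Z × Z) := {q | (q.1, q.2.1) ∈ P ∧ (q.1, q.2.2) ∈ P ∧ e q.2.1 < e q.2.2}
  have hQ : MeasurableSet Q := by
    refine (measurableSet_preimage (by fun_prop) hP).inter
      ((measurableSet_preimage (by fun_prop) hP).inter ?_)
    have h1 : Measurable fun q : X × Z × Z => e q.2.1 := he.measurable.comp (by fun_prop)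
    have h2 : Measurable fun q : X × Z × Z => e q.2.2 := he.measurable.comp (by fun_prop)
    exact measurableSet_lt h1 h2
  let f : X × Z × Z → X × Z := fun q => (q.1, q.2.2)
  have hf : Measurable f := by fun_prop
  have hfi : InjOn f Q := by
    rintro ⟨x, a, b⟩ ⟨ha, hb, hab⟩ ⟨x', a', b'⟩ ⟨ha', hb', hab'⟩ h
    simp only [f, Prod.mk.injEq] at h
    obtain ⟨rfl, rfl⟩ := h
    rcases h2 x a a' b ha ha' hb with h | h | h
    · rw [h]
    · exact absurd hab (by simp only [h]; exact lt_irrefl _)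
    · exact absurd hab' (by simp only [h]; exact lt_irrefl _)
  let L := P \ f '' Q
  have hL : MeasurableSet L := hP.diff (hQ.image_of_measurable_injOn hf hfi)
  have hinj : InjOn Prod.fst L := by
    rintro ⟨x, a⟩ ha ⟨x', b⟩ hb h
    have h' : x = x' := h
    subst h'
    rcases lt_trichotomy (e a) (e b) with h | h | h
    · exact absurd ⟨(x, a, b), ⟨ha.1, hb.1, h⟩, rfl⟩ hb.2
    · rw [he.injective h]
    · exact absurd ⟨(x, b, a), ⟨hb.1, ha.1, h⟩, rfl⟩ ha.2
  have himg : Prod.fst '' L = Prod.fst '' P := by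
    refine (image_mono sdiff_subset).antisymm ?_
    rintro _ ⟨⟨x, a⟩, ha, rfl⟩
    by_cases h : (x, a) ∈ f '' Q
    · obtain ⟨⟨x', b, c⟩, ⟨hb, hc, hbc⟩, h⟩ := h
      simp only [f, Prod.mk.injEq] at h
      obtain ⟨rfl, rfl⟩ := h
      refine ⟨(x', b), ⟨hb, ?_⟩, rfl⟩
      rintro ⟨⟨x'', d, b'⟩, ⟨hd, -, hdb⟩, h⟩
      simp only [f, Prod.mk.injEq] at h
      obtain ⟨rfl, rfl⟩ := h
      simp only at hbc hdb hd hc hb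
      rcases h2 _ _ _ _ hd hb hc with h | h | h
      · rw [h] at hdb
        exact lt_irrefl _ hdb
      · rw [h] at hdb
        exact lt_asymm hdb hbc
      · rw [h] at hbc
        exact lt_irrefl _ hbc
    · exact ⟨(x, a), ⟨ha, h⟩, rfl⟩
  obtain ⟨g, hg, hg'⟩ := exists_selector_of_injOn hL hinj
  refine ⟨?_, g, hg, fun x hx => (hg' x (himg ▸ hx)).1⟩
  rw [← himg]
  exact hL.image_of_measurable_injOn measurable_fst hinj

end Sections

section Measurability

variable {M : Type*} [TopologicalSpace M]

instance : MeasurableSpace (Pth M) := borel _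

instance : BorelSpace (Pth M) := ⟨rfl⟩

instance [PolishSpace M] : PolishSpace (Pth M) := by
  let _ := TopologicalSpace.upgradeIsCompletelyMetrizable M
  infer_instance

theorem measurable_eval [MeasurableSpace M] [BorelSpace M] (s : I) :
    Measurable fun α : Pth M => α s :=
  (continuous_eval_const s).measurable

theorem isOpen_forall_mem {K : Set I} (hK : IsCompact K) {O : Set M} (hO : IsOpen O) :
    IsOpen {α : Pth M | ∀ s ∈ K, α s ∈ O} :=
  ContinuousMap.isOpen_setOfPred_mapsTo hK hO

theorem measurableSet_forall_lt {O : Set M} (hO : IsOpen O) :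
    MeasurableSet {α : Pth M | ∀ s, s < 1 → α s ∈ O} := by
  obtain ⟨u, hu, hu0, hlim⟩ := exists_seq_strictMono_tendsto' (show (0 : I) < 1 from zero_lt_one)
  have : {α : Pth M | ∀ s, s < 1 → α s ∈ O} = ⋂ n, {α : Pth M | ∀ s ∈ Iic (u n), α s ∈ O} := by
    ext α
    simp only [mem_iInter, Set.mem_ofPred_eq]
    refine ⟨fun h n s hs => h s (lt_of_le_of_lt hs (hu0 n).2), fun h s hs => ?_⟩
    obtain ⟨n, hn⟩ := (hlim.eventually_const_lt hs).exists
    exact h n s hn.le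
  rw [this]
  exact MeasurableSet.iInter fun n => (isOpen_forall_mem isClosed_Iic.isCompact hO).measurableSet

theorem measurableSet_forall_Ioo {O : Set M} (hO : IsOpen O) :
    MeasurableSet {α : Pth M | ∀ s, 0 < s → s < 1 → α s ∈ O} := by
  obtain ⟨u, hu, hu0, hlim⟩ := exists_seq_strictMono_tendsto' (show (0 : I) < 1 from zero_lt_one)
  obtain ⟨v, hv, hv0, hlimv⟩ := exists_seq_strictAnti_tendsto' (show (0 : I) < 1 from zero_lt_one)
  have : {α : Pth M | ∀ s, 0 < s → s < 1 → α s ∈ O} =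
      ⋂ n, ⋂ m, {α : Pth M | ∀ s ∈ Icc (v m) (u n), α s ∈ O} := by
    ext α
    simp only [mem_iInter, Set.mem_ofPred_eq]
    refine ⟨fun h n m s hs => h s ((hv0 m).1.trans_le hs.1) (hs.2.trans_lt (hu0 n).2),
      fun h s hs0 hs => ?_⟩
    obtain ⟨n, hn⟩ := (hlim.eventually_const_lt hs).exists
    obtain ⟨m, hm⟩ := (hlimv.eventually_lt_const hs0).exists
    exact h n m s ⟨hm.le, hn.le⟩
  rw [this]
  exact MeasurableSet.iInter fun n => MeasurableSet.iInter fun m =>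
    (isOpen_forall_mem isClosed_Icc.isCompact hO).measurableSet

end Measurability

variable {M : Type*} [MetricSpace M]

theorem measurableSet_injective : MeasurableSet {α : Pth M | Function.Injective α} := by
  have : {α : Pth M | Function.Injective α} =
      ⋂ n : ℕ, {α : Pth M | ∀ p ∈ {p : I × I | 1 / ((n : ℝ) + 1) ≤ dist p.1 p.2}, α p.1 ≠ α p.2} := by
    ext α
    simp only [mem_iInter, Set.mem_ofPred_eq]
    refine ⟨fun h n p hp he => ?_, fun h s t hst => ?_⟩
    · have hp' : 1 / ((n : ℝ) + 1) ≤ dist p.1 p.2 := hp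
      rw [h he, dist_self] at hp'
      have : (0 : ℝ) < 1 / ((n : ℝ) + 1) := by positivity
      linarith
    · by_contra hne
      obtain ⟨n, hn⟩ := exists_nat_one_div_lt (dist_pos.2 hne)
      exact h n (s, t) hn.le hst
  rw [this]
  refine MeasurableSet.iInter fun n => IsOpen.measurableSet ?_
  have hK : IsCompact {p : I × I | 1 / ((n : ℝ) + 1) ≤ dist p.1 p.2} :=
    (isClosed_le continuous_const continuous_dist).isCompact
  have hcl : IsClosed {q : Pth M × (I × I) | 1 / ((n : ℝ) + 1) ≤ dist q.2.1 q.2.2 ∧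
      q.1 q.2.1 = q.1 q.2.2} := by
    have h1 : Continuous fun q : Pth M × (I × I) => dist q.2.1 q.2.2 :=
      continuous_dist.comp continuous_snd
    refine (isClosed_le continuous_const h1).inter (isClosed_eq ?_ ?_)
    · exact Continuous.eval continuous_fst (continuous_fst.comp continuous_snd)
    · exact Continuous.eval continuous_fst (continuous_snd.comp continuous_snd)
  have := (isClosedMap_fst_of_compactSpace (X := Pth M) (Y := I × I)) _ hcl
  convert this.isOpen_compl using 1
  ext α
  simp only [mem_compl_iff, mem_image, Prod.exists, Set.mem_ofPred_eq]
  constructor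
  · rintro h ⟨a, s, t, ⟨h1, h2⟩, rfl⟩
    exact h (s, t) h1 h2
  · rintro h ⟨s, t⟩ h1 h2
    exact h ⟨α, s, t, ⟨h1, h2⟩, rfl⟩

theorem measurableSet_can [SecondCountableTopology M] [Nonempty M] :
    MeasurableSet {α : Pth M | Can α} := by
  have hc : ∀ t : I, Continuous fun α : Pth M => wt α t := fun t => by
    have h : Continuous fun α : Pth M => ((α, t) : Pth M × I) := Continuous.prodMk_left t
    have := wt_continuous.comp h
    exact this
  have : {α : Pth M | Can α} = {α : Pth M | Function.Injective α} ∩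
      ⋂ t : I, {α : Pth M | wt α t = wt α 0 + t * (wt α 1 - wt α 0)} := by
    ext α
    simp only [mem_inter_iff, mem_iInter, Set.mem_ofPred_eq]
    rfl
  rw [this]
  refine measurableSet_injective.inter (IsClosed.measurableSet (isClosed_iInter fun t => ?_))
  exact isClosed_eq (hc t) ((hc 0).add (continuous_const.mul ((hc 1).sub (hc 0))))

end

section

variable {M : Type*} [MetricSpace M]

theorem exists_param_lt (p q : Pth M) (h : ∀ s r, p s = q r → s = 0) {θ : ℝ} (hθ : 0 < θ) :
    ∃ η > 0, ∀ s r, dist (p s) (q r) < η → (s : ℝ) < θ := by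
  have hK : IsCompact {x : I × I | θ ≤ x.1} :=
    (isClosed_le continuous_const (by fun_prop)).isCompact
  have hc : Continuous fun x : I × I => dist (p x.1) (q x.2) := by fun_prop
  rcases {x : I × I | θ ≤ x.1}.eq_empty_or_nonempty with he | hne
  · refine ⟨1, one_pos, fun s r _ => ?_⟩
    by_contra hs
    have : (s, r) ∈ {x : I × I | θ ≤ x.1} := not_lt.1 hs
    rw [he] at this
    exact this
  · obtain ⟨x, hx, hmin⟩ := hK.exists_isMinOn hne hc.continuousOn
    refine ⟨dist (p x.1) (q x.2), dist_pos.2 fun he => ?_, fun s r hsr => ?_⟩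
    · have hx' : θ ≤ x.1 := hx
      rw [h _ _ he] at hx'
      have : ((0 : I) : ℝ) = 0 := rfl
      linarith
    · by_contra hs
      exact absurd hsr (not_lt.2 (hmin (a := (s, r)) (not_lt.1 hs)))

theorem exists_unif (p : Pth M) {ε : ℝ} (hε : 0 < ε) :
    ∃ θ > 0, ∀ x y : I, dist x y < θ → dist (p x) (p y) < ε := by
  have := Metric.uniformContinuous_iff.1 (CompactSpace.uniformContinuous_of_continuous p.continuous)
  obtain ⟨θ, hθ, h⟩ := this ε hε
  exact ⟨θ, hθ, fun x y hxy => h hxy⟩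

theorem dist_lin_one_le (τ s : I) : dist (lin τ 1 s) s ≤ τ := by
  rw [Subtype.dist_eq, lin_val, Real.dist_eq]
  have h1 := s.2.1
  have h2 := s.2.2
  have h3 := τ.2.1
  have h4 : ((1 : I) : ℝ) = 1 := rfl
  rw [h4, abs_le]
  constructor <;> nlinarith

theorem dist_seg_lt {p p' : Pth M} {ε θ ρ : ℝ} (h : ∀ x y : I, dist x y < θ → dist (p x) (p y) < ε)
    (hp : dist p' p < ρ) {τ : I} (hτ : (τ : ℝ) < θ) : dist (seg p' τ 1) p < ρ + ε := by
  rw [ContinuousMap.dist_lt_iff_of_nonempty]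
  intro s
  rw [seg_apply]
  have h1 := h (lin τ 1 s) s ((dist_lin_one_le τ s).trans_lt hτ)
  have h2 := ContinuousMap.dist_apply_le_dist (f := p') (g := p) (lin τ 1 s)
  have h3 := dist_triangle (p' (lin τ 1 s)) (p (lin τ 1 s)) (p s)
  linarith

/-- The path running back along `p` from `p τ` and then along `q`. -/
noncomputable def turn (p q : Pth M) (h0 : p 0 = q 0) (τ : I) : Pth M where
  toFun s := if (0 : ℝ) ≤ s - τ * (1 - s) then q (projIcc 0 1 zero_le_one (s - τ * (1 - s)))
    else p (projIcc 0 1 zero_le_one (-((s : ℝ) - τ * (1 - s))))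
  continuous_toFun := by
    refine Continuous.if_le ?_ ?_ continuous_const (by fun_prop) fun s hs => ?_
    · exact q.continuous.comp (continuous_projIcc.comp (by fun_prop))
    · exact p.continuous.comp (continuous_projIcc.comp (by fun_prop))
    · rw [← hs, neg_zero]
      have : projIcc (0 : ℝ) 1 zero_le_one 0 = (0 : I) := by simp
      rw [this]
      exact h0.symm

theorem turn_apply (p q : Pth M) (h0 : p 0 = q 0) (τ s : I) : turn p q h0 τ s =
    if (0 : ℝ) ≤ s - τ * (1 - s) then q (projIcc 0 1 zero_le_one (s - τ * (1 - s)))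
    else p (projIcc 0 1 zero_le_one (-((s : ℝ) - τ * (1 - s)))) := rfl

theorem turn_zero (p q : Pth M) (h0 : p 0 = q 0) (τ : I) : turn p q h0 τ 0 = p τ := by
  rw [turn_apply]
  have h : ((0 : I) : ℝ) - τ * (1 - ((0 : I) : ℝ)) = -τ := by simp
  rw [h, neg_neg]
  split_ifs with h1
  · have h2 : (τ : ℝ) = 0 := le_antisymm (by linarith) τ.2.1
    have h3 : τ = 0 := Subtype.ext h2
    subst h3
    simp [h0]
  · rw [projIcc_val]

theorem range_turn_subset (p q : Pth M) (h0 : p 0 = q 0) (τ : I) :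
    range (turn p q h0 τ) ⊆ range p ∪ range q := by
  rintro _ ⟨s, rfl⟩
  rw [turn_apply]
  split_ifs
  · exact Or.inr ⟨_, rfl⟩
  · exact Or.inl ⟨_, rfl⟩

theorem dist_turn_lt {p q p' q' : Pth M} (h0' : p' 0 = q' 0) (h0 : p 0 = q 0) {ε θ ρ : ℝ}
    (hp : ∀ x y : I, dist x y < θ → dist (p x) (p y) < ε)
    (hq : ∀ x y : I, dist x y < θ → dist (q x) (q y) < ε)
    (hpp : dist p' p < ρ) (hqq : dist q' q < ρ) {τ : I} (hτ : (τ : ℝ) < θ) :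
    dist (turn p' q' h0' τ) q < ρ + (ε + ε) := by
  rw [ContinuousMap.dist_lt_iff_of_nonempty]
  intro s
  have hs0 := s.2.1
  have hs1 := s.2.2
  have ht0 := τ.2.1
  have ht1 := τ.2.2
  have hε : 0 < ε := (dist_nonneg).trans_lt (hp 0 0 (by rw [dist_self]; linarith))
  have hz : ((0 : I) : ℝ) = 0 := rfl
  rw [turn_apply]
  split_ifs with h
  · set x : I := projIcc 0 1 zero_le_one ((s : ℝ) - τ * (1 - s)) with hx
    have hxv : (x : ℝ) = s - τ * (1 - s) := by
      rw [hx, projIcc_of_mem (h := zero_le_one) (x := (s : ℝ) - τ * (1 - s)) ⟨h, by nlinarith⟩]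
    have h1 := hq x s (by
      rw [Subtype.dist_eq, Real.dist_eq, hxv, abs_lt]
      constructor <;> nlinarith)
    have h2 := ContinuousMap.dist_apply_le_dist (f := q') (g := q) x
    have h3 := dist_triangle (q' x) (q x) (q s)
    linarith
  · rw [not_le] at h
    set x : I := projIcc 0 1 zero_le_one (-((s : ℝ) - τ * (1 - s))) with hx
    have hxv : (x : ℝ) = -(s - τ * (1 - s)) := by
      rw [hx, projIcc_of_mem (h := zero_le_one) (x := -((s : ℝ) - τ * (1 - s)))
        ⟨by linarith, by nlinarith⟩]
    have h1 := hp x 0 (by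
      rw [Subtype.dist_eq, Real.dist_eq, hxv, hz, abs_lt]
      constructor <;> nlinarith)
    have h1' := hq 0 s (by
      rw [Subtype.dist_eq, Real.dist_eq, hz, abs_lt]
      constructor <;> nlinarith)
    have h2 := ContinuousMap.dist_apply_le_dist (f := p') (g := p) x
    have h3 := dist_triangle (p' x) (p x) (q s)
    have h4 := dist_triangle (p x) (p 0) (q s)
    rw [h0] at h4 h1
    linarith

theorem exists_recenter_pair (p q : Pth M) (hp : Function.Injective p) (h0 : p 0 = q 0) {ε : ℝ}
    (hε : 0 < ε) : ∃ ρ > 0, ∀ p' q' : Pth M, p' 0 = q' 0 → dist p' p < ρ → dist q' q < ρ →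
      ∀ τ, dist (p' τ) (p 0) < ρ → ∃ b c : Pth M, b 0 = p' τ ∧ c 0 = p' τ ∧
        range b ⊆ range p' ∪ range q' ∧ range c ⊆ range p' ∪ range q' ∧ dist b p < ε ∧
        dist c q < ε := by
  obtain ⟨θ₁, hθ₁, h1⟩ := exists_unif p (show 0 < ε / 4 by linarith)
  obtain ⟨θ₂, hθ₂, h2⟩ := exists_unif q (show 0 < ε / 4 by linarith)
  have hθ := lt_min hθ₁ hθ₂
  obtain ⟨η, hη, h3⟩ := exists_param_lt p (ContinuousMap.const I (p 0)) (fun s r h => hp h) hθ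
  refine ⟨min (ε / 4) (η / 2), by positivity, fun p' q' h0' hpp hqq τ hτ => ?_⟩
  have hτ' : (τ : ℝ) < min θ₁ θ₂ := by
    refine h3 τ 0 ?_
    have := ContinuousMap.dist_apply_le_dist (f := p') (g := p) τ
    have h4 := dist_triangle_left (p τ) (p 0) (p' τ)
    have h5 := min_le_right (ε / 4) (η / 2)
    show dist (p τ) (p 0) < η
    linarith
  have h4 := min_le_left (ε / 4) (η / 2)
  refine ⟨seg p' τ 1, turn p' q' h0' τ, by simp, turn_zero _ _ _ _, ?_,
    range_turn_subset _ _ _ _, ?_, ?_⟩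
  · rintro _ ⟨s, rfl⟩
    exact Or.inl ⟨_, rfl⟩
  · have := dist_seg_lt h1 hpp (hτ'.trans_le (min_le_left _ _))
    linarith
  · have := dist_turn_lt h0' h0 (fun x y h => h1 x y (h.trans_le (min_le_left _ _)))
      (fun x y h => h2 x y (h.trans_le (min_le_right _ _))) hpp hqq hτ'
    linarith

end

section

variable {M : Type*} [MetricSpace M]

theorem isClosed_exists_eq (p : Pth M) (j : Fin 3) :
    IsClosed {v : Fin 3 → Pth M | ∃ s r, p s = v j r} := by
  have hcl : IsClosed {q : (Fin 3 → Pth M) × (I × I) | p q.2.1 = q.1 j q.2.2} := by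
    refine isClosed_eq ?_ ?_
    · exact p.continuous.comp (continuous_fst.comp continuous_snd)
    · exact Continuous.eval ((continuous_apply j).comp continuous_fst)
        (continuous_snd.comp continuous_snd)
  have := (isClosedMap_fst_of_compactSpace (X := Fin 3 → Pth M) (Y := I × I)) _ hcl
  convert this using 1
  ext v
  simp only [mem_image, Prod.exists, Set.mem_ofPred_eq]
  constructor
  · rintro ⟨s, r, h⟩
    exact ⟨v, s, r, h, rfl⟩
  · rintro ⟨v, s, r, h, rfl⟩
    exact ⟨s, r, h⟩

theorem third_leg_meets {B D U : Set (Fin 3 → Pth M)} (hU : IsOpen U)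
    (hmoore : ∀ t' ∈ U, ∀ t'' ∈ U, (∀ i j, t' i 0 = t' j 0) → (∀ i j, t'' i 0 = t'' j 0) →
      Meets t' t'')
    (hB : ∀ t ∈ B, IsTriod t) (hD : B ⊆ closure D) (hDt : ∀ d ∈ D, ∀ i j, d i 0 = d j 0)
    (hBD : ∀ t ∈ B, ∀ d ∈ D, ∀ i j s r, i ≠ 2 → t i s ≠ d j r) {u v : Fin 3 → Pth M}
    (hu : u ∈ B) (hv : v ∈ B) (huU : u ∈ U) (hvU : v ∈ U) :
    ∃ j, j ≠ 2 ∧ ∃ s r, u 2 s = v j r := by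
  have hcl : IsClosed ({v : Fin 3 → Pth M | ∃ s r, u 2 s = v 0 r} ∪
      {v : Fin 3 → Pth M | ∃ s r, u 2 s = v 1 r}) :=
    (isClosed_exists_eq _ _).union (isClosed_exists_eq _ _)
  have hsub : U ∩ D ⊆ ({v : Fin 3 → Pth M | ∃ s r, u 2 s = v 0 r} ∪
      {v : Fin 3 → Pth M | ∃ s r, u 2 s = v 1 r}) := by
    rintro d ⟨hdU, hdD⟩
    obtain ⟨i, j, hij, s, r, h⟩ := hmoore u huU d hdU (hB u hu).2.1 (hDt d hdD)
    by_cases hi : i = 2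
    · subst hi
      fin_cases j
      · exact Or.inl ⟨s, r, h⟩
      · exact Or.inr ⟨s, r, h⟩
      · exact absurd rfl hij
    · exact absurd h (hBD u hu d hdD i j s r hi)
  have hv' : v ∈ closure (U ∩ D) := hU.inter_closure ⟨hvU, hD hv⟩
  rcases closure_minimal hsub hcl hv' with h | h
  · exact ⟨0, by decide, h⟩
  · exact ⟨1, by decide, h⟩

theorem IsTriod.exists_recenter {t : Fin 3 → Pth M} (ht : IsTriod t) {ε : ℝ} (hε : 0 < ε) :
    ∃ ρ > 0, ∀ u : Fin 3 → Pth M, IsTriod u → dist u t < ρ → ∀ i τ, i ≠ 2 →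
      dist (u i τ) (t 0 0) < ρ → ∃ b c : Pth M, b 0 = u i τ ∧ c 0 = u i τ ∧
        range b ⊆ range (u 0) ∪ range (u 1) ∧ range c ⊆ range (u 0) ∪ range (u 1) ∧
        dist b (t 0) < ε ∧ dist c (t 1) < ε := by
  obtain ⟨ρ₁, hρ₁, h1⟩ := exists_recenter_pair (t 0) (t 1) (ht.1 0) (ht.2.1 0 1) hε
  obtain ⟨ρ₂, hρ₂, h2⟩ := exists_recenter_pair (t 1) (t 0) (ht.1 1) (ht.2.1 1 0) hε
  refine ⟨min ρ₁ ρ₂, lt_min hρ₁ hρ₂, fun u hu hut i τ hi hτ => ?_⟩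
  have hd : ∀ j, dist (u j) (t j) < min ρ₁ ρ₂ := fun j => (dist_le_pi_dist u t j).trans_lt hut
  fin_cases i
  · exact h1 (u 0) (u 1) (hu.2.1 0 1) ((hd 0).trans_le (min_le_left _ _))
      ((hd 1).trans_le (min_le_left _ _)) τ (hτ.trans_le (min_le_left _ _))
  · obtain ⟨b, c, hb, hc, hbr, hcr, hbd, hcd⟩ := h2 (u 1) (u 0) (hu.2.1 1 0)
      ((hd 1).trans_le (min_le_right _ _)) ((hd 0).trans_le (min_le_right _ _)) τ
      ((ht.2.1 0 1 ▸ hτ).trans_le (min_le_right _ _))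
    exact ⟨c, b, hc, hb, union_comm _ _ ▸ hcr, union_comm _ _ ▸ hbr, hcd, hbd⟩
  · exact absurd rfl hi

theorem IsTriod.eq_two {u : Fin 3 → Pth M} {x : M} (h : x ∈ range (u 0) ∪ range (u 1)) :
    ∃ j, j ≠ 2 ∧ ∃ r, u j r = x := by
  rcases h with ⟨r, h⟩ | ⟨r, h⟩
  · exact ⟨0, by decide, r, h⟩
  · exact ⟨1, by decide, r, h⟩

theorem eventually_arms_meet (hM : MooreProp M) {B D : Set (Fin 3 → Pth M)}
    (hB : ∀ t ∈ B, IsTriod t) (hD : B ⊆ closure D) (hDt : ∀ d ∈ D, ∀ i j, d i 0 = d j 0)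
    (hBD : ∀ t ∈ B, ∀ d ∈ D, ∀ i j s r, i ≠ 2 → t i s ≠ d j r) {t : Fin 3 → Pth M} (ht : t ∈ B) :
    ∀ᶠ u in 𝓝[B] t, ∃ i j, i ≠ 2 ∧ j ≠ 2 ∧ ∃ s r, t i s = u j r := by
  have htt := hB t ht
  have hone : (1 : I) ≠ 0 := one_ne_zero
  obtain ⟨U, hU, hmoore⟩ := hM t fun i j hij s h => hone (htt.2.2 i j hij _ _ h)
  obtain ⟨ε, hε, hεU⟩ := Metric.mem_nhds_iff.1 hU
  have hmoore' : ∀ t' ∈ Metric.ball t ε, ∀ t'' ∈ Metric.ball t ε, (∀ i j, t' i 0 = t' j 0) →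
      (∀ i j, t'' i 0 = t'' j 0) → Meets t' t'' :=
    fun t' h' t'' h'' => hmoore t' (hεU h') t'' (hεU h'')
  obtain ⟨ρ, hρ, hrec⟩ := htt.exists_recenter hε
  obtain ⟨θ₁, hθ₁, hu1⟩ := exists_unif (t 2) (show 0 < ε / 2 by linarith)
  obtain ⟨θ₂, hθ₂, hu2⟩ := exists_unif (t 2) (show 0 < ρ / 2 by linarith)
  have hθ := lt_min hθ₁ hθ₂
  obtain ⟨η₀, hη₀, hp0⟩ := exists_param_lt (t 2) (t 0) (htt.2.2 2 0 (by decide)) hθ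
  obtain ⟨η₁, hη₁, hp1⟩ := exists_param_lt (t 2) (t 1) (htt.2.2 2 1 (by decide)) hθ
  have hp : ∀ j, j ≠ 2 → ∀ s r, dist (t 2 s) (t j r) < min η₀ η₁ → (s : ℝ) < min θ₁ θ₂ := by
    intro j hj s r h
    fin_cases j
    · exact hp0 s r (h.trans_le (min_le_left _ _))
    · exact hp1 s r (h.trans_le (min_le_right _ _))
    · exact absurd rfl hj
  have hη := lt_min hη₀ hη₁
  have hm : 0 < min (min (ε / 2) (ρ / 2)) (min η₀ η₁) := by positivity
  filter_upwards [self_mem_nhdsWithin, mem_nhdsWithin_of_mem_nhds (Metric.ball_mem_nhds t hm)]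
    with u hu hut
  have hut' : dist u t < min (min (ε / 2) (ρ / 2)) (min η₀ η₁) := hut
  have hue : dist u t < ε / 2 :=
    hut'.trans_le ((min_le_left _ _).trans (min_le_left _ _))
  have hur : dist u t < ρ / 2 :=
    hut'.trans_le ((min_le_left _ _).trans (min_le_right _ _))
  have huη : dist u t < min η₀ η₁ := hut'.trans_le (min_le_right _ _)
  have hd : ∀ j x, dist (u j x) (t j x) ≤ dist u t := fun j x =>
    (ContinuousMap.dist_apply_le_dist x).trans (dist_le_pi_dist u t j)
  have huu := hB u hu
  have htb : t ∈ Metric.ball t ε := Metric.mem_ball_self hε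
  have hub : u ∈ Metric.ball t ε := by
    rw [Metric.mem_ball]
    linarith
  by_contra! hcon
  obtain ⟨j, hj, σ', r, hσ⟩ :=
    third_leg_meets Metric.isOpen_ball hmoore' hB hD hDt hBD ht hu htb hub
  obtain ⟨i, hi, s, r', hs⟩ :=
    third_leg_meets Metric.isOpen_ball hmoore' hB hD hDt hBD hu ht hub htb
  have hσθ : (σ' : ℝ) < min θ₁ θ₂ := hp j hj σ' r (by
    rw [hσ]
    exact (hd j r).trans_lt huη)
  have hsθ : (s : ℝ) < min θ₁ θ₂ := hp i hi s r' (by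
    rw [← hs, dist_comm]
    exact (hd 2 s).trans_lt huη)
  have hz : ∀ x : I, dist x 0 = x := fun x => by
    rw [Subtype.dist_eq, Real.dist_eq]
    have : ((0 : I) : ℝ) = 0 := rfl
    rw [this, sub_zero, abs_of_nonneg x.2.1]
  have hσc : dist (t 2 σ') (t 0 0) < ρ / 2 := by
    rw [htt.2.1 0 2]
    exact hu2 σ' 0 (by rw [hz]; exact hσθ.trans_le (min_le_right _ _))
  have hsc : dist (u 2 s) (t 0 0) < ρ := by
    have h1 := hu2 s 0 (by rw [hz]; exact hsθ.trans_le (min_le_right _ _))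
    rw [htt.2.1 2 0] at h1
    have h2 := dist_triangle (u 2 s) (t 2 s) (t 0 0)
    have := hd 2 s
    linarith
  obtain ⟨b₁, b₂, hb1, hb2, hb1r, hb2r, hb1d, hb2d⟩ := hrec t htt (by rw [dist_self]; exact hρ)
    i r' hi (hs ▸ hsc)
  obtain ⟨c₁, c₂, hc1, hc2, hc1r, hc2r, hc1d, hc2d⟩ := hrec u huu (by linarith)
    j r hj (by rw [← hσ]; linarith)
  have hd1 : dist (seg (u 2) s 1) (t 2) < ε := by
    have := dist_seg_lt hu1 ((dist_le_pi_dist u t 2).trans_lt hue) (hsθ.trans_le (min_le_left _ _))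
    linarith
  have hd2 : dist (seg (t 2) σ' 1) (t 2) < ε := by
    have := dist_seg_lt hu1 (show dist (t 2) (t 2) < ε / 2 by rw [dist_self]; linarith)
      (hσθ.trans_le (min_le_left _ _))
    linarith
  have hmem : ∀ a b c : Pth M, dist a (t 0) < ε → dist b (t 1) < ε → dist c (t 2) < ε →
      ![a, b, c] ∈ Metric.ball t ε := by
    intro a b c ha hb hc
    rw [Metric.mem_ball, dist_pi_lt_iff hε]
    intro k
    fin_cases k <;> assumption
  have hstart : ∀ (a b c : Pth M) (x : M), a 0 = x → b 0 = x → c 0 = x →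
      ∀ i j, (![a, b, c] : Fin 3 → Pth M) i 0 = (![a, b, c] : Fin 3 → Pth M) j 0 := by
    intro a b c x ha hb hc i j
    have : ∀ i, (![a, b, c] : Fin 3 → Pth M) i 0 = x := by
      intro i
      fin_cases i <;> assumption
    rw [this, this]
  have hdisj : ∀ x, x ∈ range (t 0) ∪ range (t 1) → x ∈ range (u 0) ∪ range (u 1) → False := by
    intro x hx hx'
    obtain ⟨i, hi, y, rfl⟩ := IsTriod.eq_two hx
    obtain ⟨j, hj, z, hz⟩ := IsTriod.eq_two hx'
    exact hcon i j hi hj y z hz.symm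
  have harm : ∀ (w : Fin 3 → Pth M) j, j ≠ 2 → ∀ y, w j y ∈ range (w 0) ∪ range (w 1) := by
    intro w j hj y
    fin_cases j
    · exact Or.inl ⟨y, rfl⟩
    · exact Or.inr ⟨y, rfl⟩
    · exact absurd rfl hj
  have hthird : ∀ (v w : Fin 3 → Pth M), IsTriod w → ∀ (i' : Fin 3) (y s' : I),
      (∀ x, x ∈ range (v 0) ∪ range (v 1) → x ∈ range (w 0) ∪ range (w 1) → False) →
      i' ≠ 2 → w 2 s' = v i' y → ∀ x ∈ range (w 0) ∪ range (w 1), ∀ q, seg (w 2) s' 1 q ≠ x := by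
    intro v w hw i' y s' hdis hi' hs' x hx q hq
    obtain ⟨k, hk, z, rfl⟩ := IsTriod.eq_two hx
    have h0 := hw.2.2 2 k hk.symm _ _ hq
    have hs0 : s' = 0 := by
      have h1 := congrArg Subtype.val h0
      rw [lin_val] at h1
      have h2 : ((1 : I) : ℝ) = 1 := rfl
      have h3 : ((0 : I) : ℝ) = 0 := rfl
      have h4 := q.2.1
      have h5 := q.2.2
      have h6 := s'.2.1
      have h7 := s'.2.2
      refine Subtype.ext ?_
      change (s' : ℝ) = 0
      change (1 - (q : ℝ)) * s' + q * 1 = 0 at h1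
      nlinarith
    subst hs0
    rw [hw.2.1 2 0] at hs'
    exact hdis _ (hs' ▸ harm v i' hi' y) (Or.inl ⟨0, rfl⟩)
  obtain ⟨k, l, hkl, x, y, hxy⟩ := hmoore' ![b₁, b₂, seg (u 2) s 1] (hmem _ _ _ hb1d hb2d hd1)
    ![c₁, c₂, seg (t 2) σ' 1] (hmem _ _ _ hc1d hc2d hd2)
    (hstart _ _ _ (t i r') hb1 hb2 (by rw [seg_zero, hs]))
    (hstart _ _ _ (u j r) hc1 hc2 (by rw [seg_zero, hσ]))
  have hth1 := hthird t u huu i r' s hdisj hi hs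
  have hth2 := hthird u t htt j r σ' (fun x h h' => hdisj x h' h) hj hσ
  fin_cases k <;> fin_cases l
  · exact hkl rfl
  · exact hdisj _ (hb1r ⟨x, rfl⟩) (hc2r ⟨y, hxy.symm⟩)
  · exact hth2 _ (hb1r ⟨x, rfl⟩) y hxy.symm
  · exact hdisj _ (hb2r ⟨x, rfl⟩) (hc1r ⟨y, hxy.symm⟩)
  · exact hkl rfl
  · exact hth2 _ (hb2r ⟨x, rfl⟩) y hxy.symm
  · exact hth1 _ (hc1r ⟨y, rfl⟩) x hxy
  · exact hth1 _ (hc2r ⟨y, rfl⟩) x hxy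
  · exact hkl rfl

/-- Countably many paths meet the first two legs of every triod. -/
theorem exists_countable_triodHit [SecondCountableTopology M] (hM : MooreProp M) :
    ∃ C : Set (Pth M), C.Countable ∧ TriodHit (⋃ γ ∈ C, range γ) := by
  obtain ⟨D, hDT, hDc, hD⟩ := (TopologicalSpace.IsSeparable.of_separableSpace
    {t : Fin 3 → Pth M | IsTriod t}).exists_countable_dense_subset
  let B : Set (Fin 3 → Pth M) :=
    {t | IsTriod t ∧ ∀ d ∈ D, ∀ i j s r, i ≠ 2 → t i s ≠ d j r}
  obtain ⟨E, hEB, hEc, hE⟩ := TopologicalSpace.countable_cover_nhdsWithin (s := B)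
    (f := fun t => {u : Fin 3 → Pth M | ∃ i j, i ≠ 2 ∧ j ≠ 2 ∧ ∃ s r, t i s = u j r}) fun t ht =>
      eventually_arms_meet hM (fun t ht => ht.1) (fun t ht => hD ht.1)
        (fun d hd => (hDT hd).2.1) (fun t ht => ht.2) ht
  refine ⟨⋃ t ∈ D ∪ E, range t, (hDc.union hEc).biUnion fun t _ => countable_range _, ?_⟩
  intro a ha
  have key : ∃ i, i ≠ 2 ∧ ∃ s, a i s ∈ ⋃ γ ∈ ⋃ t ∈ D ∪ E, range t, range γ := by
    by_cases hB : a ∈ B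
    · obtain ⟨t, htE, i, j, hi, hj, s, r, h⟩ := mem_iUnion₂.1 (hE hB)
      exact ⟨j, hj, r, mem_iUnion₂.2 ⟨t i, mem_iUnion₂.2 ⟨t, Or.inr htE, i, rfl⟩, s, h⟩⟩
    · have : ∃ d ∈ D, ∃ i j s r, i ≠ 2 ∧ a i s = d j r := by
        by_contra! h
        exact hB ⟨ha, fun d hd i j s r hi => h d hd i j s r hi⟩
      obtain ⟨d, hd, i, j, s, r, hi, h⟩ := this
      exact ⟨i, hi, s, mem_iUnion₂.2 ⟨d j, mem_iUnion₂.2 ⟨d, Or.inl hd, j, rfl⟩, r, h.symm⟩⟩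
  obtain ⟨i, hi, s, h⟩ := key
  fin_cases i
  · exact Or.inl ⟨s, h⟩
  · exact Or.inr ⟨s, h⟩
  · exact absurd rfl hi

end

section

variable {M : Type*} [MetricSpace M]

/-- The punctured ball. -/
def pball (c : M) (δ : ℝ) : Set M := Metric.ball c δ \ {c}

theorem pball_mono {c : M} {δ δ' : ℝ} (h : δ ≤ δ') : pball c δ ⊆ pball c δ' :=
  sdiff_subset_sdiff_left (Metric.ball_subset_ball h)

/-- Three short paths from a common origin with ends in different path components of the punctured
ball of radius `δ` about the origin. -/
def Spider (δ : ℝ) (t : Fin 3 → Pth M) : Prop :=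
  (∀ i j, t i 0 = t j 0) ∧ (∀ i s, 0 < s → t i s ∈ pball (t 0 0) (δ / 2)) ∧
    ∀ i j, i ≠ j → ¬ JoinedIn (pball (t 0 0) δ) (t i 1) (t j 1)

namespace Spider

variable {δ : ℝ} {t u v : Fin 3 → Pth M}

theorem dist_lt (hδ : 0 < δ) (ht : Spider δ t) (i : Fin 3) (s : I) :
    dist (t i s) (t 0 0) < δ / 2 := by
  rcases eq_or_ne s 0 with rfl | hs
  · rw [ht.1 i 0, dist_self]
    linarith
  · exact (ht.2.1 i s (unitInterval.pos_iff_ne_zero.2 hs)).1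

theorem joinedIn_leg (hδ : 0 < δ) (ht : Spider δ t) (i : Fin 3) {s : I} (hs : t i s ≠ t 0 0) :
    JoinedIn (pball (t 0 0) δ) (t i s) (t i 1) := by
  have hs0 : 0 < s := unitInterval.pos_iff_ne_zero.2 fun h => hs (by rw [h, ht.1 i 0])
  refine joinedIn_pth (t i) fun x hx => pball_mono (by linarith) (ht.2.1 i x ?_)
  rw [uIcc_of_le (show s ≤ 1 from unitInterval.le_one s)] at hx
  exact hs0.trans_le hx.1

theorem ends_ne (hδ : 0 < δ) (ht : Spider δ t) (i j : Fin 3) (hij : i ≠ j) (s : I) :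
    t i 1 ≠ t j s := by
  intro h
  have h1 : t i 1 ≠ t 0 0 := (ht.2.1 i 1 zero_lt_one).2
  have := ht.joinedIn_leg hδ j (s := s) (h ▸ h1)
  rw [← h] at this
  exact ht.2.2 i j hij this

theorem leg_eq_leg (hδ : 0 < δ) (hu : Spider δ u) (ht : ∀ i s, t i s ∈ pball (u 0 0) δ)
    (hv : ∀ i s, v i s ∈ pball (u 0 0) δ) (ht0 : ∀ i j, t i 0 = t j 0)
    (hv0 : ∀ i j, v i 0 = v j 0) (htv : ∃ i j s r, t i s = v j r) {j k : Fin 3}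
    (hj : ∃ i s r, t i s = u j r) (hk : ∃ i s r, v i s = u k r) : j = k := by
  have hin : ∀ t : Fin 3 → Pth M, (∀ i s, t i s ∈ pball (u 0 0) δ) → (∀ i j, t i 0 = t j 0) →
      ∀ i j s r, JoinedIn (pball (u 0 0) δ) (t i s) (t j r) := by
    intro t ht ht0 i j s r
    have h1 := joinedIn_pth (t i) (a := s) (b := 0) fun x _ => ht i x
    have h2 := joinedIn_pth (t j) (a := 0) (b := r) fun x _ => ht j x
    rw [ht0 j i] at h2
    exact h1.trans h2
  obtain ⟨i, i', s, r, h⟩ := htv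
  obtain ⟨a, sa, ra, ha⟩ := hj
  obtain ⟨b, sb, rb, hb⟩ := hk
  by_contra hjk
  refine hu.2.2 j k hjk ?_
  have h1 := hu.joinedIn_leg hδ j (s := ra) (ha ▸ (ht a sa).2)
  have h2 := hu.joinedIn_leg hδ k (s := rb) (hb ▸ (hv b sb).2)
  have h3 := hin t ht ht0 a i sa s
  have h4 := hin v hv hv0 i' b r sb
  rw [ha, h] at h3
  rw [hb] at h4
  exact h1.symm.trans ((h3.trans h4).trans h2)

end Spider

theorem exists_countable_center_local [SecondCountableTopology M] {δ : ℝ} (hδ : 0 < δ)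
    {V : Set (Fin 3 → Pth M)}
    (hmoore : ∀ t' ∈ V, ∀ t'' ∈ V, (∀ i j, t' i 0 = t' j 0) → (∀ i j, t'' i 0 = t'' j 0) →
      Meets t' t'') (hV : ∀ t ∈ V, ∀ u ∈ V, dist t u < δ / 4) :
    ∃ C : Set (Pth M), C.Countable ∧ ∀ t ∈ V, Spider δ t → t 0 0 ∈ ⋃ γ ∈ C, range γ := by
  obtain ⟨D, hDT, hDc, hD⟩ := (TopologicalSpace.IsSeparable.of_separableSpace
    (V ∩ {t : Fin 3 → Pth M | Spider δ t})).exists_countable_dense_subset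
  have hmem : ∀ u ∈ V, Spider δ u → ∀ t ∈ V, Spider δ t → (∀ i s, t i s ≠ u 0 0) →
      ∀ i s, t i s ∈ pball (u 0 0) δ := by
    intro u hu hus t ht hts hne i s
    refine ⟨?_, hne i s⟩
    have h1 := hts.dist_lt hδ i s
    have h2 : dist (t 0 0) (u 0 0) ≤ dist t u :=
      (ContinuousMap.dist_apply_le_dist _).trans (dist_le_pi_dist t u 0)
    have h3 := hV t ht u hu
    have h4 := dist_triangle (t i s) (t 0 0) (u 0 0)
    rw [Metric.mem_ball]
    linarith
  have hmeet : ∀ t ∈ V, Spider δ t → ∀ u ∈ V, Spider δ u → Meets t u :=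
    fun t ht hts u hu hus => hmoore t ht u hu hts.1 hus.1
  let F : Fin 3 → Set (Fin 3 → Pth M) := fun j => {u | (u ∈ V ∧ Spider δ u) ∧
    (∀ t ∈ D, ∀ i s, t i s ≠ u 0 0) ∧ ∀ t ∈ D, ∀ i k s r, t i s = u k r → k = j}
  have hF : ∀ u ∈ V, Spider δ u → (∀ t ∈ D, ∀ i s, t i s ≠ u 0 0) → ∃ j, u ∈ F j := by
    intro u hu hus hne
    obtain ⟨t₀, ht₀⟩ : D.Nonempty := by
      by_contra h
      rw [not_nonempty_iff_eq_empty] at h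
      rw [h, closure_empty] at hD
      exact hD ⟨hu, hus⟩
    have hDV := fun t ht => hDT (a := t) ht
    obtain ⟨i, j, hij, s, r, h⟩ := hmeet t₀ (hDV t₀ ht₀).1 (hDV t₀ ht₀).2 u hu hus
    refine ⟨j, ⟨hu, hus⟩, hne, fun t ht i' k s' r' h' => ?_⟩
    obtain ⟨a, b, -, x, y, hxy⟩ := hmeet t (hDV t ht).1 (hDV t ht).2 t₀ (hDV t₀ ht₀).1 (hDV t₀ ht₀).2
    exact hus.leg_eq_leg hδ (hmem u hu hus t (hDV t ht).1 (hDV t ht).2 (hne t ht))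
      (hmem u hu hus t₀ (hDV t₀ ht₀).1 (hDV t₀ ht₀).2 (hne t₀ ht₀)) (hDV t ht).2.1 (hDV t₀ ht₀).2.1
      ⟨a, b, x, y, hxy⟩ ⟨i', s', r', h'⟩ ⟨i, s, r, h⟩
  have hcov : ∀ j, ∀ u ∈ F j, ∀ v ∈ F j, ∃ i s, v i s = u 0 0 := by
    rintro j u ⟨⟨huV, hus⟩, hu1, hu2⟩ v ⟨⟨hvV, hvs⟩, hv1, hv2⟩
    by_contra! hne
    have hA : ∃ i s r, u j s = v i r := by
      have hcl : IsClosed (⋃ i, {w : Fin 3 → Pth M | ∃ s r, u j s = w i r}) :=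
        isClosed_iUnion_of_finite fun i => isClosed_exists_eq _ _
      have hsub : D ⊆ ⋃ i, {w : Fin 3 → Pth M | ∃ s r, u j s = w i r} := by
        intro d hd
        obtain ⟨a, b, -, x, y, hxy⟩ := hmeet d (hDT hd).1 (hDT hd).2 u huV hus
        have := hu2 d hd a b x y hxy
        subst this
        exact mem_iUnion.2 ⟨a, y, x, hxy.symm⟩
      obtain ⟨i, s, r, h⟩ := mem_iUnion.1 (closure_minimal hsub hcl (hD ⟨hvV, hvs⟩))
      exact ⟨i, s, r, h⟩
    have hB : ∃ k, k ≠ j ∧ ∃ s r, v j s = u k r := by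
      have hcl : IsClosed (⋃ k : {k // k ≠ j}, {w : Fin 3 → Pth M | ∃ s r, v j s = w k r}) :=
        isClosed_iUnion_of_finite fun i => isClosed_exists_eq _ _
      have hsub : D ⊆ ⋃ k : {k // k ≠ j}, {w : Fin 3 → Pth M | ∃ s r, v j s = w k r} := by
        intro d hd
        obtain ⟨a, b, hab, x, y, hxy⟩ := hmeet d (hDT hd).1 (hDT hd).2 v hvV hvs
        have := hv2 d hd a b x y hxy
        subst this
        exact mem_iUnion.2 ⟨⟨a, hab⟩, y, x, hxy.symm⟩
      obtain ⟨k, s, r, h⟩ := mem_iUnion.1 (closure_minimal hsub hcl (hD ⟨huV, hus⟩))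
      exact ⟨k, k.2, s, r, h⟩
    obtain ⟨i, s, r, h⟩ := hA
    obtain ⟨k, hk, s', r', h'⟩ := hB
    have hm := hmem u huV hus v hvV hvs hne
    exact hk (hus.leg_eq_leg hδ hm hm hvs.1 hvs.1 ⟨0, 0, 0, 0, rfl⟩ ⟨j, s', r', h'⟩
      ⟨i, r, s, h.symm⟩)
  have hpick : ∀ j, ∃ W : Set (Fin 3 → Pth M), W.Countable ∧
      ∀ u ∈ F j, ∃ w ∈ W, ∃ i s, w i s = u 0 0 := fun j => by
    rcases (F j).eq_empty_or_nonempty with h | ⟨w, hw⟩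
    · exact ⟨∅, countable_empty, fun u hu => by rw [h] at hu; exact hu.elim⟩
    · exact ⟨{w}, countable_singleton w, fun u hu => ⟨w, rfl, hcov j u hu w hw⟩⟩
  choose W hWc hW using hpick
  refine ⟨⋃ t ∈ D ∪ ⋃ j, W j, range t,
    (hDc.union (countable_iUnion hWc)).biUnion fun t _ => countable_range _, fun u hu hus => ?_⟩
  have : ∃ t ∈ D ∪ ⋃ j, W j, ∃ i s, t i s = u 0 0 := by
    by_cases h : ∃ t ∈ D, ∃ i s, t i s = u 0 0
    · obtain ⟨t, ht, h⟩ := h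
      exact ⟨t, Or.inl ht, h⟩
    · push Not at h
      obtain ⟨j, hj⟩ := hF u hu hus h
      obtain ⟨w, hw, h⟩ := hW j u hj
      exact ⟨w, Or.inr (mem_iUnion.2 ⟨j, hw⟩), h⟩
  obtain ⟨t, ht, i, s, h⟩ := this
  exact mem_iUnion₂.2 ⟨t i, mem_iUnion₂.2 ⟨t, ht, i, rfl⟩, s, h⟩

/-- Countably many paths cover the centers of all spiders of a given size. -/
theorem exists_countable_center [SecondCountableTopology M] (hM : MooreProp M) {δ : ℝ}
    (hδ : 0 < δ) :
    ∃ C : Set (Pth M), C.Countable ∧ ∀ t, Spider δ t → t 0 0 ∈ ⋃ γ ∈ C, range γ := by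
  have hloc : ∀ t : Fin 3 → Pth M, Spider δ t → ∃ V ∈ 𝓝 t, ∃ C : Set (Pth M), C.Countable ∧
      ∀ t ∈ V, Spider δ t → t 0 0 ∈ ⋃ γ ∈ C, range γ := by
    intro t ht
    obtain ⟨U, hU, hmoore⟩ := hM t fun i j hij s h => ht.ends_ne hδ i j hij s h
    have hb : Metric.ball t (δ / 8) ∈ 𝓝 t := Metric.ball_mem_nhds t (by linarith)
    refine ⟨U ∩ Metric.ball t (δ / 8), inter_mem hU hb, exists_countable_center_local hδ
      (fun t' h' t'' h'' => hmoore t' h'.1 t'' h''.1) fun u hu v hv => ?_⟩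
    have h1 : dist u t < δ / 8 := hu.2
    have h2 : dist v t < δ / 8 := hv.2
    have := dist_triangle_right u v t
    linarith
  choose! V hV C hC hcov using hloc
  obtain ⟨E, hE, hEc, hEV⟩ := TopologicalSpace.countable_cover_nhdsWithin
    (s := {t : Fin 3 → Pth M | Spider δ t}) (f := V)
    fun t ht => mem_nhdsWithin_of_mem_nhds (hV t ht)
  refine ⟨⋃ t ∈ E, C t, hEc.biUnion fun t ht => hC t (hE ht), fun t ht => ?_⟩
  obtain ⟨u, hu, htu⟩ := mem_iUnion₂.1 (hEV ht)
  obtain ⟨γ, hγ, h⟩ := mem_iUnion₂.1 (hcov u (hE hu) t htu ht)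
  exact mem_iUnion₂.2 ⟨γ, mem_iUnion₂.2 ⟨u, hu, hγ⟩, h⟩

theorem exists_good_sequence [SecondCountableTopology M] [Nonempty M] (hM : MooreProp M) :
    ∃ κ : ℕ → Pth M, TriodHit (⋃ n, range (κ n)) ∧
      ∀ (n : ℕ) t, Spider ((1 / 2) ^ n) t → t 0 0 ∈ ⋃ n, range (κ n) := by
  obtain ⟨C, hC, hCt⟩ := exists_countable_triodHit hM
  choose D hD hDt using fun n : ℕ => exists_countable_center hM (δ := (1 / 2) ^ n) (by positivity)
  obtain ⟨x⟩ := ‹Nonempty M›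
  have hc : (insert (ContinuousMap.const I x) (C ∪ ⋃ n, D n)).Countable :=
    (hC.union (countable_iUnion hD)).insert _
  obtain ⟨κ, hκ⟩ := hc.exists_eq_range ⟨_, mem_insert _ _⟩
  have hsub : ∀ C' ⊆ C ∪ ⋃ n, D n, (⋃ γ ∈ C', range γ) ⊆ ⋃ n, range (κ n) := by
    intro C' h' y hy
    obtain ⟨γ, hγ, hy⟩ := mem_iUnion₂.1 hy
    have : γ ∈ range κ := hκ ▸ mem_insert_of_mem _ (h' hγ)
    obtain ⟨n, rfl⟩ := this
    exact mem_iUnion.2 ⟨n, hy⟩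
  exact ⟨κ, hCt.mono (hsub _ subset_union_left), fun n t ht =>
    hsub _ ((subset_iUnion D n).trans subset_union_right) (hDt n t ht)⟩

end

section

section Hyperfinite

variable {Y : Type} [MeasurableSpace Y]

/-- Hyperfiniteness of the restriction of `E` to `P`. -/
def HFOn (P : Set Y) (E : Y → Y → Prop) : Prop :=
  ∃ F : ℕ → Y → Y → Prop, (∀ n, MeasurableSet {p : Y × Y | F n p.1 p.2}) ∧
    (∀ n, ∀ y ∈ P, F n y y) ∧ (∀ n, ∀ y ∈ P, ∀ z ∈ P, F n y z → F n z y) ∧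
    (∀ n, ∀ x ∈ P, ∀ y ∈ P, ∀ z ∈ P, F n x y → F n y z → F n x z) ∧
    (∀ n, ∀ y ∈ P, {z | z ∈ P ∧ F n y z}.Finite) ∧
    (∀ n, ∀ y ∈ P, ∀ z ∈ P, F n y z → F (n + 1) y z) ∧
    ∀ y ∈ P, ∀ z ∈ P, E y z ↔ ∃ n, F n y z

theorem HFOn.union {P Q : Set Y} {E : Y → Y → Prop} (hP : MeasurableSet P)
    (hinv : ∀ y z, E y z → (y ∈ P ↔ z ∈ P)) (h1 : HFOn P E) (h2 : HFOn Q E) : HFOn (P ∪ Q) E := by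
  obtain ⟨F, hFm, hFr, hFs, hFt, hFf, hFi, hF⟩ := h1
  obtain ⟨G, hGm, hGr, hGs, hGt, hGf, hGi, hG⟩ := h2
  have hQ : ∀ {y}, y ∈ P ∪ Q → y ∉ P → y ∈ Q := fun h h' => h.resolve_left h'
  refine ⟨fun n y z => (y ∈ P ∧ z ∈ P ∧ F n y z) ∨ (y ∉ P ∧ z ∉ P ∧ G n y z), fun n => ?_,
    fun n y hy => ?_, ?_, ?_, fun n y hy => ?_, ?_, fun y hy z hz => ?_⟩
  · exact ((measurable_fst hP).inter ((measurable_snd hP).inter (hFm n))).union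
      ((measurable_fst hP).compl.inter ((measurable_snd hP).compl.inter (hGm n)))
  · by_cases h : y ∈ P
    · exact Or.inl ⟨h, h, hFr n y h⟩
    · exact Or.inr ⟨h, h, hGr n y (hQ hy h)⟩
  · rintro n y hy z hz (⟨h, h', h''⟩ | ⟨h, h', h''⟩)
    · exact Or.inl ⟨h', h, hFs n _ h _ h' h''⟩
    · exact Or.inr ⟨h', h, hGs n _ (hQ hy h) _ (hQ hz h') h''⟩
  · rintro n x hx y hy z hz (⟨h, h', h''⟩ | ⟨h, h', h''⟩) (⟨k, k', k''⟩ | ⟨k, k', k''⟩)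
    · exact Or.inl ⟨h, k', hFt n _ h _ k _ k' h'' k''⟩
    · exact absurd h' k
    · exact absurd k h'
    · exact Or.inr ⟨h, k', hGt n _ (hQ hx h) _ (hQ hy k) _ (hQ hz k') h'' k''⟩
  · by_cases h : y ∈ P
    · refine (hFf n y h).subset ?_
      rintro z ⟨-, ⟨-, h', h''⟩ | ⟨k, -⟩⟩
      · exact ⟨h', h''⟩
      · exact absurd h k
    · refine (hGf n y (hQ hy h)).subset ?_
      rintro z ⟨hz, ⟨h', -⟩ | ⟨-, k, h''⟩⟩
      · exact absurd h' h
      · exact ⟨hQ hz k, h''⟩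
  · rintro n y hy z hz (⟨h, h', h''⟩ | ⟨h, h', h''⟩)
    · exact Or.inl ⟨h, h', hFi n _ h _ h' h''⟩
    · exact Or.inr ⟨h, h', hGi n _ (hQ hy h) _ (hQ hz h') h''⟩
  · constructor
    · intro hE
      by_cases h : y ∈ P
      · have h' := (hinv y z hE).1 h
        obtain ⟨n, hn⟩ := (hF y h z h').1 hE
        exact ⟨n, Or.inl ⟨h, h', hn⟩⟩
      · have h' := fun hz => h ((hinv y z hE).2 hz)
        obtain ⟨n, hn⟩ := (hG y (hQ hy h) z (hQ hz h')).1 hE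
        exact ⟨n, Or.inr ⟨h, h', hn⟩⟩
    · rintro ⟨n, ⟨h, h', h''⟩ | ⟨h, h', h''⟩⟩
      · exact (hF y h z h').2 ⟨n, h''⟩
      · exact (hG y (hQ hy h) z (hQ hz h')).2 ⟨n, h''⟩

theorem HFOn.isHyperfinite {E : Y → Y → Prop} (h : HFOn univ E) : IsHyperfinite E := by
  obtain ⟨F, hFm, hFr, hFs, hFt, hFf, hFi, hF⟩ := h
  refine ⟨F, fun n => ⟨⟨⟨fun y => hFr n y trivial, fun {y z} => hFs n y trivial z trivial,
    fun {x y z} => hFt n x trivial y trivial z trivial⟩, hFm n⟩, fun y => ?_⟩,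
    fun n y z => hFi n y trivial z trivial, fun y z => hF y trivial z trivial⟩
  have := hFf n y trivial
  simpa using this

/-- Measurable parametrizations of the classes of an equivalence relation by the integers, unique
up to shifts and reflections. -/
structure DihedralWalk (p : ℤ → Y → Y) : Prop where
  measurable : ∀ k, Measurable (p k)
  zero : ∀ y, p 0 y = y
  shift : ∀ y k, (∀ j, p j (p k y) = p (k + j) y) ∨ ∀ j, p j (p k y) = p (k - j) y

namespace DihedralWalk

variable {p : ℤ → Y → Y}

theorem exists_eq (hp : DihedralWalk p) (y : Y) (k : ℤ) :
    ∃ ε : ℤ, (ε = 1 ∨ ε = -1) ∧ ∀ j, p j (p k y) = p (k + ε * j) y := by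
  rcases hp.shift y k with h | h
  · exact ⟨1, Or.inl rfl, fun j => by rw [h, one_mul]⟩
  · exact ⟨-1, Or.inr rfl, fun j => by rw [h]; congr 1; ring⟩

/-- A version of `shift` with a surjective change of index. -/
theorem exists_eq' (hp : DihedralWalk p) (y : Y) (k : ℤ) :
    ∃ ε : ℤ, (ε = 1 ∨ ε = -1) ∧ ∀ j, p j y = p (ε * (j - k)) (p k y) := by
  obtain ⟨ε, hε, h⟩ := hp.exists_eq y k
  refine ⟨ε, hε, fun j => ?_⟩
  rw [h]
  congr 1
  rcases hε with rfl | rfl <;> ring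

theorem back (hp : DihedralWalk p) (y : Y) (k : ℤ) : ∃ j, |j| = |k| ∧ p j (p k y) = y := by
  obtain ⟨ε, hε, h⟩ := hp.exists_eq' y k
  refine ⟨ε * (0 - k), ?_, by rw [← h, hp.zero]⟩
  rcases hε with rfl | rfl <;> simp

/-- The class of a point. -/
def cls (p : ℤ → Y → Y) (y : Y) : Set Y := range fun k => p k y

theorem cls_eq (hp : DihedralWalk p) {y z : Y} (h : z ∈ cls p y) : cls p z = cls p y := by
  obtain ⟨k, rfl⟩ := h
  obtain ⟨ε, hε, h⟩ := hp.exists_eq y k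
  obtain ⟨ε', hε', h'⟩ := hp.exists_eq' y k
  apply Subset.antisymm
  · rintro _ ⟨j, rfl⟩
    exact ⟨_, (h j).symm⟩
  · rintro _ ⟨j, rfl⟩
    exact ⟨_, (h' j).symm⟩

theorem self_mem (hp : DihedralWalk p) (y : Y) : y ∈ cls p y := ⟨0, hp.zero y⟩

theorem equivalence (hp : DihedralWalk p) : Equivalence fun y z => z ∈ cls p y where
  refl := hp.self_mem
  symm {y z} h := by rw [hp.cls_eq h]; exact hp.self_mem y
  trans {x y z} h h' := by rwa [hp.cls_eq h] at h'

variable [StandardBorelSpace Y]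

theorem measurableSet_rel (hp : DihedralWalk p) : MeasurableSet {q : Y × Y | q.2 ∈ cls p q.1} := by
  have : {q : Y × Y | q.2 ∈ cls p q.1} = ⋃ k, {q : Y × Y | p k q.1 = q.2} := by
    ext q
    simp [cls]
  rw [this]
  exact MeasurableSet.iUnion fun k =>
    measurableSet_eq_fun ((hp.measurable k).comp measurable_fst) measurable_snd

/-- Finiteness of the part of the class of `y` in `B` is a Borel condition on `y`. -/
theorem measurableSet_finite (hp : DihedralWalk p) {B : Set Y} (hB : MeasurableSet B) :
    MeasurableSet {y | (cls p y ∩ B).Finite} := by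
  have : {y | (cls p y ∩ B).Finite} = ⋃ N : ℕ, ⋂ k : ℤ, ((p k ⁻¹' B)ᶜ ∪
      ⋃ j ∈ Icc (-N : ℤ) N, {y | p k y = p j y}) := by
    ext y
    simp only [mem_iUnion, mem_iInter, mem_union, mem_compl_iff, mem_preimage, exists_prop]
    constructor
    · intro h
      have : ∃ N : ℕ, ∀ z ∈ cls p y ∩ B, ∃ j ∈ Icc (-N : ℤ) N, z = p j y := by
        refine Set.Finite.induction_on_subset (motive := fun s _ => ∃ N : ℕ, ∀ z ∈ s,
          ∃ j ∈ Icc (-N : ℤ) N, z = p j y) _ h ⟨0, fun z hz => hz.elim⟩ ?_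
        rintro z s ⟨⟨k, rfl⟩, hz⟩ hs hzs ⟨N, hN⟩
        refine ⟨N + k.natAbs, ?_⟩
        have hk1 := neg_abs_le k
        have hk2 := le_abs_self k
        have hk3 := abs_nonneg k
        rintro w (rfl | hw)
        · exact ⟨k, ⟨by push_cast; linarith, by push_cast; linarith⟩, rfl⟩
        · obtain ⟨j, hj, h⟩ := hN w hw
          exact ⟨j, ⟨by push_cast; linarith [hj.1], by push_cast; linarith [hj.2]⟩, h⟩
      obtain ⟨N, hN⟩ := this
      refine ⟨N, fun k => ?_⟩
      by_cases hk : p k y ∈ B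
      · obtain ⟨j, hj, h⟩ := hN _ ⟨⟨k, rfl⟩, hk⟩
        exact Or.inr ⟨j, hj, h⟩
      · exact Or.inl hk
    · rintro ⟨N, hN⟩
      refine ((finite_Icc (-N : ℤ) N).image fun j => p j y).subset ?_
      rintro _ ⟨⟨k, rfl⟩, hk⟩
      rcases hN k with h | ⟨j, hj, h⟩
      · exact absurd hk h
      · exact ⟨j, hj, h.symm⟩
  rw [this]
  exact MeasurableSet.iUnion fun N => MeasurableSet.iInter fun k =>
    ((hp.measurable k) hB).compl.union (MeasurableSet.biUnion (to_countable _) fun j _ =>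
      measurableSet_eq_fun (hp.measurable k) (hp.measurable j))

end DihedralWalk

end Hyperfinite

end

section

section Hyperfinite

variable {Y : Type} [MeasurableSpace Y]

theorem exists_bounded_embedding (Y : Type) [MeasurableSpace Y] [StandardBorelSpace Y] :
    ∃ e : Y → ℝ, Measurable e ∧ Function.Injective e ∧ ∀ y, -2 < e y ∧ e y < 2 := by
  obtain ⟨e, he⟩ := MeasureTheory.exists_measurableEmbedding_real Y
  refine ⟨fun y => Real.arctan (e y), Real.continuous_arctan.measurable.comp he.measurable,
    Real.arctan_injective.comp he.injective, fun y => ?_⟩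
  have h1 := Real.neg_pi_div_two_lt_arctan (e y)
  have h2 := Real.arctan_lt_pi_div_two (e y)
  have h3 := Real.pi_lt_four
  constructor <;> linarith

namespace DihedralWalk

variable {p : ℤ → Y → Y} [StandardBorelSpace Y]

/-- A vanishing sequence of markers. -/
theorem exists_markers (hp : DihedralWalk p) : ∃ A : ℕ → Set Y, (∀ n, MeasurableSet (A n)) ∧
    Antitone A ∧ (⋂ n, A n) = ∅ ∧ ∀ y, (cls p y).Infinite → ∀ n, (cls p y ∩ A n).Infinite := by
  obtain ⟨e, he, hinj, hb⟩ := exists_bounded_embedding Y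
  let L : Y → Set ℝ := fun y => {q | (cls p y ∩ {z | e z < q}).Infinite}
  let ℓ : Y → ℝ := fun y => sInf (L y)
  have hbdd : ∀ y, BddBelow (L y) := fun y => ⟨-2, fun q hq => by
    obtain ⟨z, -, hz⟩ := hq.nonempty
    have hz' : e z < q := hz
    linarith [(hb z).1]⟩
  have hup : ∀ y q r, q ≤ r → q ∈ L y → r ∈ L y := fun y q r hqr hq =>
    hq.mono (inter_subset_inter_right _ fun z (hz : e z < q) => hz.trans_le hqr)
  have hne : ∀ y, (cls p y).Infinite → (L y).Nonempty := fun y hy =>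
    ⟨2, hy.mono fun z hz => ⟨hz, (hb z).2⟩⟩
  have hLm : ∀ q : ℝ, MeasurableSet {y | q ∈ L y} := fun q =>
    (hp.measurableSet_finite (measurableSet_lt he measurable_const)).compl
  have hemp : ∀ y, (cls p y).Finite → L y = ∅ := fun y hy =>
    eq_empty_of_forall_notMem fun q hq => hq (hy.subset inter_subset_left)
  have hFm : MeasurableSet {y | (cls p y).Finite} := by
    have := hp.measurableSet_finite MeasurableSet.univ
    simpa using this
  have hℓm : Measurable ℓ := by
    refine measurable_of_Iio fun r => ?_
    have : ℓ ⁻¹' Iio r = ({y | (cls p y).Finite} ∩ {_y | 0 < r}) ∪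
        ({y | (cls p y).Finite}ᶜ ∩ ⋃ q ∈ {q : ℚ | (q : ℝ) < r}, {y | (q : ℝ) ∈ L y}) := by
      ext y
      by_cases hy : (cls p y).Finite
      · have h0 : ℓ y = 0 := by
          show sInf (L y) = 0
          rw [hemp y hy, Real.sInf_empty]
        constructor
        · intro h
          refine Or.inl ⟨hy, ?_⟩
          show 0 < r
          rw [← h0]
          exact h
        · rintro (h | h)
          · show ℓ y < r
            rw [h0]
            exact h.2
          · exact absurd hy h.1
      · constructor
        · intro h
          obtain ⟨q, hq, hqr⟩ := exists_lt_of_csInf_lt (hne y hy) h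
          obtain ⟨q', hq1, hq2⟩ := exists_rat_btwn hqr
          exact Or.inr ⟨hy, mem_iUnion₂.2 ⟨q', hq2, hup y q q' hq1.le hq⟩⟩
        · rintro (h | ⟨-, h⟩)
          · exact absurd h.1 hy
          · obtain ⟨q, hq, hqL⟩ := mem_iUnion₂.1 h
            exact (csInf_le (hbdd y) hqL).trans_lt hq
    rw [this]
    exact (hFm.inter (MeasurableSet.const _)).union
      (hFm.compl.inter (MeasurableSet.biUnion (to_countable _) fun q _ => hLm q))
  have hinv : ∀ y, ∀ z ∈ cls p y, ℓ z = ℓ y := fun y z hz => by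
    show sInf {q | (cls p z ∩ _).Infinite} = sInf {q | (cls p y ∩ _).Infinite}
    rw [hp.cls_eq hz]
  refine ⟨fun n => {y | e y ≠ ℓ y ∧ |e y - ℓ y| < 1 / ((n : ℝ) + 1)}, fun n => ?_,
    fun m n hmn y hy => ⟨hy.1, hy.2.trans_le (Nat.one_div_le_one_div hmn)⟩, ?_, fun y hy n => ?_⟩
  · exact (measurableSet_eq_fun he hℓm).compl.inter
      (measurableSet_lt ((he.sub hℓm).abs) measurable_const)
  · refine eq_empty_of_forall_notMem fun y hy => ?_
    rw [mem_iInter] at hy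
    obtain ⟨n, hn⟩ := exists_nat_one_div_lt (abs_pos.2 (sub_ne_zero.2 (hy 0).1))
    exact lt_asymm hn (hy n).2
  · have hε : (0 : ℝ) < 1 / ((n : ℝ) + 1) := by positivity
    have h1 : ℓ y + 1 / ((n : ℝ) + 1) ∈ L y := by
      obtain ⟨q, hq, hq'⟩ := exists_lt_of_csInf_lt (hne y hy)
        (show sInf (L y) < ℓ y + 1 / ((n : ℝ) + 1) from lt_add_of_pos_right _ hε)
      exact hup y q _ hq'.le hq
    have h2 : (cls p y ∩ {z | e z < ℓ y - 1 / ((n : ℝ) + 1) / 2}).Finite := by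
      by_contra h
      have := csInf_le (hbdd y) (show ℓ y - 1 / ((n : ℝ) + 1) / 2 ∈ L y from h)
      change ℓ y ≤ _ at this
      linarith
    have h3 : {z | e z = ℓ y}.Finite := Set.Subsingleton.finite fun a ha b hb => hinj (ha.trans hb.symm)
    refine ((h1.sdiff h2).sdiff h3).mono ?_
    rintro z ⟨⟨⟨hz, hz1⟩, hz2⟩, hz3⟩
    have hz2' : ¬ e z < ℓ y - 1 / ((n : ℝ) + 1) / 2 := fun h => hz2 ⟨hz, h⟩
    have hz1' : e z < ℓ y + 1 / ((n : ℝ) + 1) := hz1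
    refine ⟨hz, ?_, ?_⟩
    · rw [hinv y z hz]
      exact hz3
    · rw [hinv y z hz, abs_lt]
      constructor <;> linarith

end DihedralWalk

end Hyperfinite

end

section

section Hyperfinite

variable {Y : Type}

namespace DihedralWalk

variable {p : ℤ → Y → Y} [MeasurableSpace Y]

/-- The orbit of `y` meets `A` arbitrarily far in both directions. -/
def TwoSided (p : ℤ → Y → Y) (A : Set Y) (y : Y) : Prop :=
  ∀ K : ℕ, (∃ i, (K : ℤ) ≤ i ∧ p i y ∈ A) ∧ ∃ i, i ≤ -(K : ℤ) ∧ p i y ∈ A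

theorem TwoSided.of_mem (hp : DihedralWalk p) {A : Set Y} {y z : Y} (h : TwoSided p A y)
    (hz : z ∈ cls p y) : TwoSided p A z := by
  obtain ⟨k, rfl⟩ := hz
  obtain ⟨ε, hε, he⟩ := hp.exists_eq' y k
  intro K
  obtain ⟨⟨i, hi, hiA⟩, j, hj, hjA⟩ := h (K + k.natAbs)
  push_cast at hi hj
  have hk1 := neg_abs_le k
  have hk2 := le_abs_self k
  have hk3 := abs_nonneg k
  rw [he] at hiA hjA
  rcases hε with rfl | rfl
  · exact ⟨⟨_, by linarith, hiA⟩, _, by linarith, hjA⟩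
  · exact ⟨⟨_, by linarith, hjA⟩, _, by linarith, hiA⟩

theorem twoSided_iff (hp : DihedralWalk p) {A : Set Y} {y z : Y} (hz : z ∈ cls p y) :
    TwoSided p A y ↔ TwoSided p A z :=
  ⟨fun h => h.of_mem hp hz, fun h => h.of_mem hp (hp.equivalence.symm hz)⟩

theorem measurable_twoSided (hp : DihedralWalk p) {A : Set Y} (hA : MeasurableSet A) :
    Measurable (TwoSided p A) := by
  have h : ∀ i, Measurable fun y => p i y ∈ A := fun i =>
    measurableSet_setOfPred.1 ((hp.measurable i) hA)
  refine Measurable.forall fun K => (Measurable.exists fun i => ?_).and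
    (Measurable.exists fun i => ?_)
  · exact measurable_const.and (h i)
  · exact measurable_const.and (h i)

theorem hfOn_twoSided (hp : DihedralWalk p) [StandardBorelSpace Y] {A : ℕ → Set Y}
    (hA : ∀ n, MeasurableSet (A n))
    (hanti : Antitone A) (hemp : (⋂ n, A n) = ∅) :
    HFOn {y | ∀ n, TwoSided p (A n) y} fun y z => z ∈ cls p y := by
  refine ⟨fun n y z => y = z ∨ ∃ k, p k y = z ∧ ∀ i ∈ uIcc 0 k, p i y ∉ A n, fun n => ?_,
    fun n y _ => Or.inl rfl, fun n y _ z _ => ?_, fun n x _ y _ z _ => ?_, fun n y hy => ?_,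
    fun n y _ z _ => ?_, fun y _ z _ => ⟨?_, ?_⟩⟩
  · refine (measurableSet_eq_fun measurable_fst measurable_snd).union ?_
    refine measurableSet_setOfPred.2 (Measurable.exists fun k => Measurable.and ?_
      (Measurable.forall fun i => measurable_const.imp (Measurable.not ?_)))
    · exact measurableSet_setOfPred.1
        (measurableSet_eq_fun ((hp.measurable k).comp measurable_fst) measurable_snd)
    · exact measurableSet_setOfPred.1 (((hp.measurable i).comp measurable_fst) (hA n))
  · rintro (h | ⟨k, rfl, hk⟩)
    · exact Or.inl h.symm
    · refine Or.inr ?_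
      obtain ⟨ε, hε, he⟩ := hp.exists_eq y k
      refine ⟨-(ε * k), ?_, fun i hi => ?_⟩
      · rw [he]
        have : k + ε * -(ε * k) = 0 := by rcases hε with rfl | rfl <;> ring
        rw [this, hp.zero]
      · rw [he]
        refine hk _ ?_
        rw [mem_uIcc] at hi ⊢
        rcases hε with rfl | rfl <;> omega
  · rintro (rfl | ⟨k, rfl, hk⟩) (rfl | ⟨l, rfl, hl⟩)
    · exact Or.inl rfl
    · exact Or.inr ⟨l, rfl, hl⟩
    · exact Or.inr ⟨k, rfl, hk⟩
    · refine Or.inr ?_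
      obtain ⟨ε, hε, he⟩ := hp.exists_eq x k
      refine ⟨k + ε * l, (he l).symm, fun i hi => ?_⟩
      by_cases hik : i ∈ uIcc 0 k
      · exact hk i hik
      · have h1 : i = k + ε * (ε * (i - k)) := by rcases hε with rfl | rfl <;> ring
        rw [h1, ← he]
        refine hl _ ?_
        rw [mem_uIcc] at hi hik ⊢
        rcases hε with rfl | rfl <;> omega
  · obtain ⟨⟨i, hi, hiA⟩, j, hj, hjA⟩ := hy n 0
    refine (((finite_Icc j i).image fun k => p k y).insert y).subset ?_
    rintro z ⟨-, rfl | ⟨k, rfl, hk⟩⟩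
    · exact mem_insert _ _
    · refine mem_insert_of_mem _ ⟨k, ⟨?_, ?_⟩, rfl⟩
      · by_contra h
        refine hk j ?_ hjA
        rw [mem_uIcc]
        push_cast at hj
        omega
      · by_contra h
        refine hk i ?_ hiA
        rw [mem_uIcc]
        push_cast at hi
        omega
  · rintro (h | ⟨k, h, hk⟩)
    · exact Or.inl h
    · exact Or.inr ⟨k, h, fun i hi hm => hk i hi (hanti (Nat.le_succ n) hm)⟩
  · rintro ⟨k, rfl⟩
    have h1 : ∀ i ∈ uIcc 0 k, ∀ᶠ n in atTop, p i y ∉ A n := by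
      intro i _
      have : p i y ∉ ⋂ n, A n := by rw [hemp]; exact fun h => h
      rw [mem_iInter, not_forall] at this
      obtain ⟨n, hn⟩ := this
      filter_upwards [eventually_ge_atTop n] with m hm h
      exact hn (hanti hm h)
    obtain ⟨n, hn⟩ := ((eventually_all_finite (finite_Icc _ _)).2 h1).exists
    exact ⟨n, Or.inr ⟨k, rfl, hn⟩⟩
  · rintro ⟨n, rfl | ⟨k, rfl, -⟩⟩
    · exact hp.self_mem _
    · exact ⟨k, rfl⟩

/-- A point of `A` which is extremal in its orbit. -/
def Extremal (p : ℤ → Y → Y) (A : Set Y) (y : Y) : Prop :=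
  y ∈ A ∧ ((∀ i, 0 < i → p i y ∉ A) ∨ ∀ i, i < 0 → p i y ∉ A)

theorem Extremal.eq (hp : DihedralWalk p) {A : Set Y} {y z : Y} (hy : Extremal p A y)
    (hz : Extremal p A z) (h : z ∈ cls p y) (hinf : (cls p y ∩ A).Infinite) : z = y := by
  obtain ⟨k, rfl⟩ := h
  by_contra hne
  have hk : k ≠ 0 := fun h => hne (by show p k y = y; rw [h, hp.zero])
  have hz1 : (∀ i, k < i → p i y ∉ A) ∨ ∀ i, i < k → p i y ∉ A := by
    obtain ⟨ε, hε, he⟩ := hp.exists_eq' y k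
    rcases hε with rfl | rfl <;> rcases hz.2 with h | h
    · exact Or.inl fun i hi => by rw [he]; exact h _ (by linarith)
    · exact Or.inr fun i hi => by rw [he]; exact h _ (by linarith)
    · exact Or.inr fun i hi => by rw [he]; exact h _ (by linarith)
    · exact Or.inl fun i hi => by rw [he]; exact h _ (by linarith)
  have hfin : ∃ a b : ℤ, ∀ i, p i y ∈ A → i ∈ Icc a b := by
    rcases hy.2 with h | h <;> rcases hz1 with h' | h'
    · rcases lt_or_gt_of_ne hk with h0 | h0
      · exact absurd hy.1 (by rw [← hp.zero y]; exact h' 0 h0)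
      · exact absurd hz.1 (h k h0)
    · exact ⟨k, 0, fun i hi => ⟨not_lt.1 fun hl => h' i hl hi, not_lt.1 fun hl => h i hl hi⟩⟩
    · exact ⟨0, k, fun i hi => ⟨not_lt.1 fun hl => h i hl hi, not_lt.1 fun hl => h' i hl hi⟩⟩
    · rcases lt_or_gt_of_ne hk with h0 | h0
      · exact absurd hz.1 (h k h0)
      · exact absurd hy.1 (by rw [← hp.zero y]; exact h' 0 h0)
  obtain ⟨a, b, hab⟩ := hfin
  refine hinf (((finite_Icc a b).image fun i => p i y).subset ?_)
  rintro _ ⟨⟨i, rfl⟩, hi⟩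
  exact ⟨i, hab i hi, rfl⟩

theorem exists_extremal (hp : DihedralWalk p) {A : Set Y} {y : Y} (hne : (cls p y ∩ A).Nonempty)
    (h : ¬ TwoSided p A y) : ∃ k, Extremal p A (p k y) := by
  obtain ⟨_, ⟨i₀, rfl⟩, hi₀⟩ := hne
  simp only [TwoSided, not_forall, not_and_or, not_exists] at h
  obtain ⟨K, h | h⟩ := h
  · obtain ⟨k, hk, hmax⟩ := Int.exists_greatest_of_bdd (P := fun i => p i y ∈ A)
      ⟨K, fun i hi => not_lt.1 fun hl => (h i).elim (fun h' => h' hl.le) fun h' => h' hi⟩ ⟨i₀, hi₀⟩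
    refine ⟨k, hk, ?_⟩
    obtain ⟨ε, rfl | rfl, he⟩ := hp.exists_eq y k
    · refine Or.inl fun i hi hm => ?_
      rw [he] at hm
      have := hmax _ hm
      linarith
    · refine Or.inr fun i hi hm => ?_
      rw [he] at hm
      have := hmax _ hm
      linarith
  · obtain ⟨k, hk, hmin⟩ := Int.exists_least_of_bdd (P := fun i => p i y ∈ A)
      ⟨-K, fun i hi => not_lt.1 fun hl => (h i).elim (fun h' => h' hl.le) fun h' => h' hi⟩ ⟨i₀, hi₀⟩
    refine ⟨k, hk, ?_⟩
    obtain ⟨ε, rfl | rfl, he⟩ := hp.exists_eq y k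
    · refine Or.inr fun i hi hm => ?_
      rw [he] at hm
      have := hmin _ hm
      linarith
    · refine Or.inl fun i hi hm => ?_
      rw [he] at hm
      have := hmin _ hm
      linarith

theorem measurable_extremal (hp : DihedralWalk p) {A : Set Y} (hA : MeasurableSet A) :
    Measurable (Extremal p A) := by
  have h : ∀ i, Measurable fun y => p i y ∈ A := fun i =>
    measurableSet_setOfPred.1 ((hp.measurable i) hA)
  refine (measurableSet_setOfPred.1 hA).and (Measurable.or ?_ ?_)
  · exact Measurable.forall fun i => measurable_const.imp (h i).not
  · exact Measurable.forall fun i => measurable_const.imp (h i).not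

/-- The point `y` is within `n` steps of the chosen extremal point of its class. -/
def Near (p : ℤ → Y → Y) (A : ℕ → Set Y) (n : ℕ) (y : Y) : Prop :=
  ∃ m, ¬ TwoSided p (A m) y ∧ (∀ m' < m, TwoSided p (A m') y) ∧
    ∃ i : ℤ, |i| ≤ n ∧ Extremal p (A m) (p i y)

theorem measurable_near (hp : DihedralWalk p) {A : ℕ → Set Y} (hA : ∀ n, MeasurableSet (A n))
    (n : ℕ) : Measurable (Near p A n) := by
  refine Measurable.exists fun m => (hp.measurable_twoSided (hA m)).not.and (Measurable.and ?_ ?_)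
  · exact Measurable.forall fun m' => measurable_const.imp (hp.measurable_twoSided (hA m'))
  · exact Measurable.exists fun i => measurable_const.and
      ((hp.measurable_extremal (hA m)).comp (hp.measurable i))

theorem hfOn_not_twoSided (hp : DihedralWalk p) [StandardBorelSpace Y] {A : ℕ → Set Y}
    (hA : ∀ n, MeasurableSet (A n)) :
    HFOn {y | (∀ n, (cls p y ∩ A n).Infinite) ∧ ¬ ∀ n, TwoSided p (A n) y}
      fun y z => z ∈ cls p y := by
  refine ⟨fun n y z => y = z ∨ (z ∈ cls p y ∧ Near p A n y ∧ Near p A n z), fun n => ?_,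
    fun n y _ => Or.inl rfl, fun n y _ z _ => ?_, fun n x _ y _ z _ => ?_, fun n y hy => ?_,
    fun n y _ z _ => ?_, fun y hy z hz => ⟨?_, ?_⟩⟩
  · refine (measurableSet_eq_fun measurable_fst measurable_snd).union
      (hp.measurableSet_rel.inter (MeasurableSet.inter ?_ ?_))
    · exact measurable_fst (measurableSet_setOfPred.2 (hp.measurable_near hA n))
    · exact measurable_snd (measurableSet_setOfPred.2 (hp.measurable_near hA n))
  · rintro (h | ⟨h, h1, h2⟩)
    · exact Or.inl h.symm
    · exact Or.inr ⟨hp.equivalence.symm h, h2, h1⟩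
  · rintro (rfl | ⟨h, h1, h2⟩) (rfl | ⟨h', h1', h2'⟩)
    · exact Or.inl rfl
    · exact Or.inr ⟨h', h1', h2'⟩
    · exact Or.inr ⟨h, h1, h2⟩
    · exact Or.inr ⟨hp.equivalence.trans h h', h1, h2'⟩
  · by_cases hn : Near p A n y
    · obtain ⟨m, hm, hm', i, hi, hex⟩ := hn
      refine (((finite_Icc (-n : ℤ) n).image fun j => p j (p i y)).insert y).subset ?_
      rintro z ⟨-, rfl | ⟨hz, -, m₁, hm₁, hm₁', i₁, hi₁, hex₁⟩⟩
      · exact mem_insert _ _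
      · refine mem_insert_of_mem _ ?_
        have hmm : m₁ = m := by
          rcases lt_trichotomy m₁ m with h | h | h
          · exact absurd ((hp.twoSided_iff hz).1 (hm' _ h)) hm₁
          · exact h
          · exact absurd ((hp.twoSided_iff hz).2 (hm₁' _ h)) hm
        subst hmm
        have hc : p i₁ z ∈ cls p (p i y) := by
          rw [hp.cls_eq (⟨i, rfl⟩ : p i y ∈ cls p y), ← hp.cls_eq hz]
          exact ⟨i₁, rfl⟩
        have hinf : (cls p (p i y) ∩ A m₁).Infinite := by
          rw [hp.cls_eq (⟨i, rfl⟩ : p i y ∈ cls p y)]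
          exact hy.1 m₁
        have he := hex.eq hp hex₁ hc hinf
        obtain ⟨j, hj, hjz⟩ := hp.back z i₁
        rw [he] at hjz
        refine ⟨j, ?_, hjz⟩
        rw [← hj] at hi₁
        exact ⟨(abs_le.1 hi₁).1, (abs_le.1 hi₁).2⟩
    · refine (finite_singleton y).subset ?_
      rintro z ⟨-, rfl | ⟨-, h, -⟩⟩
      · rfl
      · exact absurd h hn
  · have hmono : ∀ x, Near p A n x → Near p A (n + 1) x := by
      rintro x ⟨m, h1, h2, i, hi, h⟩
      exact ⟨m, h1, h2, i, hi.trans (by push_cast; linarith), h⟩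
    rintro (h | ⟨h, h1, h2⟩)
    · exact Or.inl h
    · exact Or.inr ⟨h, hmono _ h1, hmono _ h2⟩
  · intro h
    have hnear : ∀ x ∈ {y | (∀ n, (cls p y ∩ A n).Infinite) ∧ ¬ ∀ n, TwoSided p (A n) y},
        ∃ N, ∀ n ≥ N, Near p A n x := by
      rintro x ⟨hinf, hx⟩
      rw [not_forall] at hx
      classical
      obtain ⟨k, hk⟩ := hp.exists_extremal (hinf (Nat.find hx)).nonempty (Nat.find_spec hx)
      refine ⟨k.natAbs, fun n hn => ⟨Nat.find hx, Nat.find_spec hx, fun m' hm' =>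
        not_not.1 (Nat.find_min hx hm'), k, ?_, hk⟩⟩
      rw [← Int.natCast_natAbs]
      exact_mod_cast hn
    obtain ⟨N, hN⟩ := hnear y hy
    obtain ⟨N', hN'⟩ := hnear z hz
    exact ⟨max N N', Or.inr ⟨h, hN _ (le_max_left _ _), hN' _ (le_max_right _ _)⟩⟩
  · rintro ⟨n, rfl | ⟨h, -⟩⟩
    · exact hp.self_mem _
    · exact h

theorem isHyperfinite (hp : DihedralWalk p) [StandardBorelSpace Y] :
    IsHyperfinite fun y z => z ∈ cls p y := by
  obtain ⟨A, hA, hanti, hemp, hinf⟩ := hp.exists_markers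
  have hFm : MeasurableSet {y | (cls p y).Finite} := by
    have := hp.measurableSet_finite MeasurableSet.univ
    simpa using this
  have h1 : HFOn {y | (cls p y).Finite} fun y z => z ∈ cls p y :=
    ⟨fun _ y z => z ∈ cls p y, fun _ => hp.measurableSet_rel, fun _ y _ => hp.self_mem y,
      fun _ y _ z _ h => hp.equivalence.symm h, fun _ x _ y _ z _ h h' => hp.equivalence.trans h h',
      fun _ y hy => hy.subset fun z hz => hz.2, fun _ y _ z _ h => h,
      fun y _ z _ => ⟨fun h => ⟨0, h⟩, fun ⟨_, h⟩ => h⟩⟩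
  have h2 := hp.hfOn_twoSided hA hanti hemp
  have h3 := hp.hfOn_not_twoSided hA
  have hm : MeasurableSet {y | ∀ n, TwoSided p (A n) y} :=
    measurableSet_setOfPred.2 (Measurable.forall fun n => hp.measurable_twoSided (hA n))
  have hU := h1.union hFm (fun y z h => by simp only [mem_ofPred_eq, hp.cls_eq h])
    (h2.union hm (fun y z h => forall_congr' fun n => hp.twoSided_iff h) h3)
  refine HFOn.isHyperfinite ?_
  convert hU
  symm
  rw [eq_univ_iff_forall]
  intro y
  by_cases hy : (cls p y).Finite
  · exact Or.inl hy
  · by_cases hy' : ∀ n, TwoSided p (A n) y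
    · exact Or.inr (Or.inl hy')
    · exact Or.inr (Or.inr ⟨fun n => hinf y hy n, hy'⟩)

end DihedralWalk

end Hyperfinite

end

section

section Hyperfinite

variable {Y : Type}

/-- Alternate application of two involutions. -/
def alternate (s : Bool → Y → Y) (hs : ∀ c y, s c (s c y) = y) : Equiv.Perm (Y × Bool) where
  toFun v := (s v.2 v.1, !v.2)
  invFun v := (s (!v.2) v.1, !v.2)
  left_inv v := by simp [hs]
  right_inv v := by simp [hs]

theorem alternate_reverse {s : Bool → Y → Y} {hs : ∀ c y, s c (s c y) = y} (k : ℤ) (y : Y)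
    (c : Bool) : ((alternate s hs ^ k) (y, !c)).1 = ((alternate s hs ^ (-k)) (y, c)).1 := by
  let ρ : Equiv.Perm (Y × Bool) :=
    ⟨fun v => (v.1, !v.2), fun v => (v.1, !v.2), fun v => by simp, fun v => by simp⟩
  have h : ρ * alternate s hs * ρ⁻¹ = (alternate s hs)⁻¹ := by
    ext v
    · rfl
    · simp [ρ, alternate, Equiv.Perm.mul_apply, Equiv.Perm.inv_def]
  have h' : ρ * alternate s hs ^ k * ρ⁻¹ = alternate s hs ^ (-k) := by
    rw [← conj_zpow, h, inv_zpow, zpow_neg]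
  rw [← h']
  rfl

variable [MeasurableSpace Y]

theorem measurable_alternate {s : Bool → Y → Y} {hs : ∀ c y, s c (s c y) = y}
    (hm : ∀ c, Measurable (s c)) (k : ℤ) : Measurable (alternate s hs ^ k) := by
  have h1 : Measurable (alternate s hs) := by
    have h : Measurable fun v : Y × Bool => s v.2 v.1 := measurable_from_prod_countable_left hm
    exact h.prodMk ((measurable_of_finite Bool.not).comp measurable_snd)
  have h2 : Measurable ⇑((alternate s hs)⁻¹) := by
    have h : Measurable fun v : Y × Bool => s (!v.2) v.1 :=
      measurable_from_prod_countable_left fun c => hm (!c)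
    exact h.prodMk ((measurable_of_finite Bool.not).comp measurable_snd)
  induction k with
  | zero => exact measurable_id
  | succ n ih => rw [zpow_add_one]; exact ih.comp h1
  | pred n ih => rw [zpow_sub_one]; exact ih.comp h2

theorem dihedralWalk_alternate {s : Bool → Y → Y} {hs : ∀ c y, s c (s c y) = y}
    (hm : ∀ c, Measurable (s c)) :
    DihedralWalk fun k y => ((alternate s hs ^ k) (y, true)).1 where
  measurable k := measurable_fst.comp ((measurable_alternate hm k).comp
    (measurable_id.prodMk measurable_const))
  zero y := rfl
  shift y k := by
    rcases hc : (alternate s hs ^ k) (y, true) with ⟨z, c⟩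
    cases c
    · refine Or.inr fun j => ?_
      have := alternate_reverse (hs := hs) j z false
      rw [← hc, ← Equiv.Perm.mul_apply, ← zpow_add] at this
      rw [sub_eq_neg_add]
      exact this
    · refine Or.inl fun j => ?_
      rw [add_comm, zpow_add, Equiv.Perm.mul_apply, hc]

variable [StandardBorelSpace Y]

/-- An equivalence relation with classes of size at most two is given by an involution. -/
theorem exists_involution [Nonempty Y] {R : Y → Y → Prop} (hR : Equivalence R)
    (hm : MeasurableSet {q : Y × Y | R q.1 q.2})
    (h2 : ∀ x y z, R x y → R x z → x = y ∨ x = z ∨ y = z) :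
    ∃ s : Y → Y, Measurable s ∧ (∀ y, s (s y) = y) ∧ ∀ x y, R x y ↔ y = x ∨ y = s x := by
  classical
  have hP : MeasurableSet {q : Y × Y | R q.1 q.2 ∧ q.1 ≠ q.2} :=
    hm.inter (measurableSet_eq_fun measurable_fst measurable_snd).compl
  obtain ⟨hI, g, hg, hgP⟩ := image_fst_of_sections_le_two hP
    fun x a b c ha hb _ => Or.inl (((h2 x a b ha.1 hb.1).resolve_left ha.2).resolve_left hb.2)
  set J := Prod.fst '' {q : Y × Y | R q.1 q.2 ∧ q.1 ≠ q.2} with hJ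
  have hs : ∀ x y, R x y ↔ y = x ∨ y = J.piecewise g id x := by
    intro x y
    by_cases hx : x ∈ J
    · rw [piecewise_eq_of_mem _ _ _ hx]
      obtain ⟨h, hne⟩ := hgP x hx
      constructor
      · intro hy
        rcases h2 x y (g x) hy h with e | e | e
        · exact Or.inl e.symm
        · exact absurd e hne
        · exact Or.inr e
      · rintro (rfl | rfl)
        · exact hR.refl _
        · exact h
    · rw [piecewise_eq_of_notMem _ _ _ hx]
      constructor
      · intro hy
        by_contra hne
        exact hx ⟨(x, y), ⟨hy, fun e => hne (Or.inl e.symm)⟩, rfl⟩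
      · rintro (rfl | rfl) <;> exact hR.refl _
  refine ⟨J.piecewise g id, hg.piecewise hI measurable_id, fun y => ?_, hs⟩
  by_cases hy : y ∈ J
  · have h := hR.symm ((hs y _).2 (Or.inr rfl))
    rcases (hs _ _).1 h with e | e
    · rw [← e, ← e]
    · exact e.symm
  · rw [piecewise_eq_of_notMem _ _ _ hy, id, piecewise_eq_of_notMem _ _ _ hy, id]

/-- The relation generated by two Borel equivalence relations with classes of size at most two
is hyperfinite. -/
theorem isHyperfinite_eqvGen [Nonempty Y] {R : Bool → Y → Y → Prop} (hR : ∀ c, Equivalence (R c))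
    (hm : ∀ c, MeasurableSet {q : Y × Y | R c q.1 q.2})
    (h2 : ∀ c x y z, R c x y → R c x z → x = y ∨ x = z ∨ y = z) :
    IsBorelEquivRel (Relation.EqvGen fun x y => ∃ c, R c x y) ∧
      IsHyperfinite (Relation.EqvGen fun x y => ∃ c, R c x y) := by
  choose s hsm hs hsR using fun c => exists_involution (hR c) (hm c) (h2 c)
  have hp := dihedralWalk_alternate (hs := hs) hsm
  have hstep : ∀ c y, s c y ∈
      DihedralWalk.cls (fun k y => ((alternate s hs ^ k) (y, true)).1) y := by
    rintro (_ | _) y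
    · exact ⟨-1, rfl⟩
    · exact ⟨1, rfl⟩
  have hE : (Relation.EqvGen fun x y => ∃ c, R c x y) =
      fun y z => z ∈ DihedralWalk.cls (fun k y => ((alternate s hs ^ k) (y, true)).1) y := by
    funext y z
    refine propext ⟨fun h => ?_, ?_⟩
    · induction h with
      | rel x y h =>
        obtain ⟨c, h⟩ := h
        rcases (hsR c x y).1 h with rfl | rfl
        · exact hp.self_mem _
        · exact hstep c x
      | refl x => exact hp.self_mem _
      | symm x y _ ih => exact hp.equivalence.symm ih
      | trans x y z _ _ ih ih' => exact hp.equivalence.trans ih ih'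
    · have key : ∀ v : Y × Bool, (Relation.EqvGen fun x y => ∃ c, R c x y) v.1
          (alternate s hs v).1 := fun v =>
        Relation.EqvGen.rel _ _ ⟨v.2, (hsR _ _ _).2 (Or.inr rfl)⟩
      rintro ⟨k, rfl⟩
      induction k with
      | zero => exact Relation.EqvGen.refl _
      | succ n ih =>
        refine Relation.EqvGen.trans _ _ _ ih ?_
        have := key ((alternate s hs ^ (n : ℤ)) (y, true))
        rw [← Equiv.Perm.mul_apply, ← zpow_one_add, add_comm] at this
        exact this
      | pred n ih =>
        refine Relation.EqvGen.trans _ _ _ ih (Relation.EqvGen.symm _ _ ?_)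
        have := key ((alternate s hs ^ (-(n : ℤ) - 1)) (y, true))
        rw [← Equiv.Perm.mul_apply, ← zpow_one_add] at this
        rw [show 1 + (-(n : ℤ) - 1) = -n by ring] at this
        exact this
  rw [hE]
  exact ⟨⟨hp.equivalence, hp.measurableSet_rel⟩, hp.isHyperfinite⟩

end Hyperfinite

end

section

section Concat

variable {M : Type*} [TopologicalSpace M]

/-- Concatenation of a two-sided infinite sequence of paths. -/
theorem exists_concat (Γ : ℤ → Pth M) (h : ∀ k, Γ k 1 = Γ (k + 1) 0) :
    ∃ c : C(ℝ, M), ∀ x, c x = Γ ⌊x⌋ ⟨Int.fract x, Int.fract_nonneg x, (Int.fract_lt_one x).le⟩ := by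
  refine ⟨⟨fun x => Γ ⌊x⌋ ⟨Int.fract x, Int.fract_nonneg x, (Int.fract_lt_one x).le⟩, ?_⟩,
    fun x => rfl⟩
  have hl : LocallyFinite fun k : ℤ => Icc (k : ℝ) (k + 1) :=
    locallyFinite_Icc_of_tendsto tendsto_intCast_atTop_atTop
      (tendsto_atBot_add_const_right _ _ (tendsto_intCast_atBot_iff.2 tendsto_id))
  refine hl.continuous (eq_univ_iff_forall.2 fun x => mem_iUnion.2
    ⟨⌊x⌋, Int.floor_le x, (Int.lt_floor_add_one x).le⟩) (fun k => isClosed_Icc) fun k => ?_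
  have hc : Continuous fun x : ℝ => Γ k (projIcc 0 1 zero_le_one (x - k)) :=
    (Γ k).continuous.comp (continuous_projIcc.comp (continuous_id.sub continuous_const))
  refine hc.continuousOn.congr fun x hx => ?_
  rcases hx.2.eq_or_lt with rfl | hlt
  · have h1 : ⌊(k : ℝ) + 1⌋ = k + 1 := by exact_mod_cast Int.floor_intCast (R := ℝ) (k + 1)
    have h2 : (⟨Int.fract ((k : ℝ) + 1), Int.fract_nonneg _, (Int.fract_lt_one _).le⟩ : I) = 0 := by
      ext
      simp
    have h3 : projIcc 0 1 zero_le_one ((k : ℝ) + 1 - k) = (1 : I) :=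
      projIcc_of_right_le _ (by linarith)
    show Γ ⌊(k : ℝ) + 1⌋ _ = Γ k _
    rw [h2, h3, h1, h]
  · have h1 : ⌊x⌋ = k := Int.floor_eq_iff.2 ⟨hx.1, hlt⟩
    have h2 : (⟨Int.fract x, Int.fract_nonneg _, (Int.fract_lt_one _).le⟩ : I) =
        projIcc 0 1 zero_le_one (x - k) := by
      rw [projIcc_of_mem zero_le_one (show x - k ∈ Icc (0 : ℝ) 1 from
        ⟨by linarith [hx.1], by linarith⟩)]
      ext
      show Int.fract x = x - (k : ℝ)
      rw [← h1]
      rfl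
    show Γ ⌊x⌋ _ = Γ k _
    rw [h2, h1]

/-- Infinite concatenation of paths converging to a point. -/
theorem exists_infinite_concat {y : M} {q : ℕ → M} {U : ℕ → Set M} (hU : Antitone U)
    (hy : ∀ V ∈ 𝓝 y, ∃ n, U n ⊆ V) (h : ∀ n, JoinedIn (U n) (q n) (q (n + 1))) :
    ∃ a : Pth M, a 0 = y ∧ a 1 = q 0 ∧ ∀ s, 0 < s → a s ∈ U 0 := by
  choose γ h0 h1 hγ using fun n => (h n).exists_pth
  let Γ : ℤ → Pth M := fun k => if 0 ≤ k then γ k.toNat else ContinuousMap.const I (q 0)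
  have hΓ : ∀ k : ℤ, 0 ≤ k → Γ k = γ k.toNat := fun k hk => if_pos hk
  have hΓ' : ∀ k : ℤ, k < 0 → Γ k = ContinuousMap.const I (q 0) := fun k hk => if_neg hk.not_ge
  obtain ⟨c, hc⟩ := exists_concat Γ fun k => by
    rcases lt_trichotomy k (-1) with hk | rfl | hk
    · rw [hΓ' k (by omega), hΓ' (k + 1) (by omega)]
      rfl
    · rw [hΓ' _ (by omega), hΓ _ (by omega)]
      exact (h0 0).symm
    · rw [hΓ k (by omega), hΓ (k + 1) (by omega), h1, h0]
      congr 1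
      omega
  have hcU : ∀ (n : ℕ) (x : ℝ), (n : ℝ) ≤ x → c x ∈ U n := by
    intro n x hx
    have hn : (n : ℤ) ≤ ⌊x⌋ := Int.le_floor.2 (by exact_mod_cast hx)
    rw [hc, hΓ _ (by omega)]
    exact hU (by omega) (hγ _ _)
  classical
  let a : I → M := fun s => if s = 0 then y else c ((s : ℝ)⁻¹ - 1)
  have ha : ∀ s, s ≠ 0 → a s = c ((s : ℝ)⁻¹ - 1) := fun s hs => if_neg hs
  have hpos : ∀ s : I, s ≠ 0 → (0 : ℝ) < s := fun s hs => unitInterval.pos_iff_ne_zero.2 hs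
  have hcont : Continuous a := by
    refine continuous_iff_continuousAt.2 fun s => ?_
    by_cases hs : s = 0
    · subst hs
      intro V hV
      rw [show a 0 = y from if_pos rfl] at hV
      obtain ⟨n, hn⟩ := hy V hV
      have hnhds : {s : I | (s : ℝ) < ((n : ℝ) + 1)⁻¹} ∈ 𝓝 (0 : I) :=
        (isOpen_lt continuous_subtype_val continuous_const).mem_nhds (by
          show (0 : ℝ) < ((n : ℝ) + 1)⁻¹
          positivity)
      show a ⁻¹' V ∈ 𝓝 0
      filter_upwards [hnhds] with s hs
      by_cases hs0 : s = 0
      · subst hs0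
        show a 0 ∈ V
        rw [show a 0 = y from if_pos rfl]
        exact mem_of_mem_nhds hV
      · show a s ∈ V
        rw [ha s hs0]
        refine hn (hcU n _ ?_)
        have := (lt_inv_comm₀ (hpos s hs0) (by positivity)).1 hs
        linarith
    · have h1 : ContinuousAt (fun s : I => c ((s : ℝ)⁻¹ - 1)) s :=
        c.continuous.continuousAt.comp
          ((continuous_subtype_val.continuousAt.inv₀ (hpos s hs).ne').sub continuousAt_const)
      refine h1.congr ?_
      filter_upwards [isOpen_ne.mem_nhds hs] with t ht
      exact (ha t ht).symm
  refine ⟨⟨a, hcont⟩, if_pos rfl, ?_, fun s hs => ?_⟩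
  · show a 1 = q 0
    rw [ha 1 one_ne_zero, hc]
    have h1 : (((1 : I) : ℝ)⁻¹ - 1) = 0 := by simp
    rw [h1, hΓ _ (by simp)]
    have h2 : (⟨Int.fract (0 : ℝ), Int.fract_nonneg _, (Int.fract_lt_one _).le⟩ : I) = 0 := by
      ext
      simp
    rw [h2, h0]
    simp
  · show a s ∈ U 0
    rw [ha s hs.ne']
    refine hcU 0 _ ?_
    have := one_le_inv_iff₀.2 ⟨hpos s hs.ne', s.2.2⟩
    push_cast
    linarith

end Concat

end

section

variable {M : Type*} [MetricSpace M]

/-- A countable union of paths containing all branching, together with a dense sequence of base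
points. -/
structure Skeleton (S : Set M) (p : ℕ → M) : Prop where
  triodHit : TriodHit S
  center : ∀ (n : ℕ) (t : Fin 3 → Pth M), Spider ((1 / 2) ^ n) t → t 0 0 ∈ S
  eq_iUnion : ∃ κ : ℕ → Pth M, S = ⋃ n, range (κ n)
  mem : ∀ k, p k ∈ S
  base : ∀ O, IsOpen O → ∀ x ∈ S, x ∈ O → ∃ k, JoinedIn O (p k) x

theorem exists_joinedIn_dense (γ : Pth M) {D : ℕ → I} (hD : DenseRange D) {O : Set M}
    (hO : IsOpen O) {s : I} (hs : γ s ∈ O) : ∃ n, JoinedIn O (γ (D n)) (γ s) := by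
  obtain ⟨ε, hε, hb⟩ := Metric.isOpen_iff.1 (hO.preimage γ.continuous) s hs
  obtain ⟨n, hn⟩ := hD.exists_mem_open Metric.isOpen_ball ⟨s, Metric.mem_ball_self hε⟩
  refine ⟨n, joinedIn_pth γ fun x hx => hb ?_⟩
  have h1 : dist (x : ℝ) s ≤ dist (D n : ℝ) s := by
    rw [Real.dist_eq, Real.dist_eq]
    have hx' : (D n : ℝ) ≤ x ∧ (x : ℝ) ≤ s ∨ (s : ℝ) ≤ x ∧ (x : ℝ) ≤ D n := mem_uIcc.1 hx
    rcases hx' with ⟨h, h'⟩ | ⟨h, h'⟩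
    · rw [abs_of_nonpos (by linarith), abs_of_nonpos (by linarith)]
      linarith
    · rw [abs_of_nonneg (by linarith), abs_of_nonneg (by linarith)]
      linarith
  exact lt_of_le_of_lt h1 hn

theorem exists_skeleton [SecondCountableTopology M] [Nonempty M] (hM : MooreProp M) :
    ∃ (S : Set M) (p : ℕ → M), Skeleton S p := by
  obtain ⟨κ, h1, h2⟩ := exists_good_sequence hM
  refine ⟨⋃ n, range (κ n), fun k => κ k.unpair.1 (TopologicalSpace.denseSeq I k.unpair.2), h1, h2,
    ⟨κ, rfl⟩, fun k => mem_iUnion.2 ⟨_, _, rfl⟩, fun O hO x hx hxO => ?_⟩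
  obtain ⟨i, s, rfl⟩ := mem_iUnion.1 hx
  obtain ⟨n, hn⟩ := exists_joinedIn_dense (κ i) (TopologicalSpace.denseRange_denseSeq I) hO hxO
  refine ⟨Nat.pair i n, ?_⟩
  rwa [Nat.unpair_pair]

/-- The punctured ball of radius `2⁻ⁿ`. -/
def dball (n : ℕ) (y : M) : Set M := pball y ((1 / 2) ^ n)

theorem dball_anti (y : M) : Antitone fun n => dball n y := fun _ _ h =>
  pball_mono (pow_le_pow_of_le_one (by norm_num) (by norm_num) h)

theorem isOpen_dball (n : ℕ) (y : M) : IsOpen (dball n y) :=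
  Metric.isOpen_ball.sdiff isClosed_singleton

theorem exists_dball_subset {y : M} {V : Set M} (hV : V ∈ 𝓝 y) :
    ∃ n, Metric.ball y ((1 / 2) ^ n) ⊆ V := by
  obtain ⟨ε, hε, h⟩ := Metric.mem_nhds_iff.1 hV
  obtain ⟨n, hn⟩ := exists_pow_lt_of_lt_one hε (show (1 / 2 : ℝ) < 1 by norm_num)
  exact ⟨n, (Metric.ball_subset_ball hn.le).trans h⟩

theorem isOpen_joinedIn_dball (n : ℕ) (x z : M) : IsOpen {y | JoinedIn (dball n y) x z} := by
  refine isOpen_iff_eventually.2 fun y hy => ?_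
  obtain ⟨γ, rfl, rfl, hγ⟩ := JoinedIn.exists_pth hy
  have hopen : IsOpen {q : M × I | dist (γ q.2) q.1 < (1 / 2) ^ n ∧ γ q.2 ≠ q.1} := by
    have h1 : Continuous fun q : M × I => γ q.2 := γ.continuous.comp continuous_snd
    exact (isOpen_lt (h1.dist continuous_fst) continuous_const).inter
      (isOpen_ne_fun h1 continuous_fst)
  have := isCompact_univ.eventually_forall_of_forall_eventually (x₀ := y) (K := (univ : Set I))
    (P := fun y s => dist (γ s) y < (1 / 2) ^ n ∧ γ s ≠ y) fun s _ =>
      hopen.mem_nhds (show _ ∧ _ from hγ s)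
  filter_upwards [this] with y' hy'
  exact joinedIn_range γ fun s => hy' s trivial

/-- The sequence `b` describes a path ending at `y`: `p (b n)` is the first base point in a
component of the punctured ball of radius `2⁻ⁿ`, and these components are nested. -/
def Addr (p : ℕ → M) (y : M) (b : ℕ → ℕ) : Prop :=
  ∀ n, JoinedIn (dball n y) (p (b n)) (p (b (n + 1))) ∧
    ∀ j < b n, ¬ JoinedIn (dball n y) (p j) (p (b n))

namespace Addr

variable {p : ℕ → M} {y : M} {b c : ℕ → ℕ}

theorem joinedIn (hb : Addr p y b) {n m : ℕ} (h : n ≤ m) :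
    JoinedIn (dball n y) (p (b n)) (p (b m)) := by
  induction m, h using Nat.le_induction with
  | base => exact JoinedIn.refl (hb n).1.source_mem
  | succ m hm ih => exact ih.trans ((hb m).1.mono (dball_anti y hm))

theorem eq_of_joinedIn (hb : Addr p y b) (hc : Addr p y c) {n : ℕ}
    (h : JoinedIn (dball n y) (p (b n)) (p (c n))) : b n = c n := by
  apply le_antisymm
  · exact not_lt.1 fun hl => (hb n).2 _ hl h.symm
  · exact not_lt.1 fun hl => (hc n).2 _ hl h

theorem not_joinedIn (hb : Addr p y b) (hc : Addr p y c) {n m k l : ℕ} (hne : b n ≠ c n)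
    (hm : n ≤ m) (hk : m ≤ k) (hl : m ≤ l) : ¬ JoinedIn (dball m y) (p (b k)) (p (c l)) := fun h =>
  hne (hb.eq_of_joinedIn hc ((hb.joinedIn (hm.trans hk)).trans ((h.mono (dball_anti y hm)).trans
    (hc.joinedIn (hm.trans hl)).symm)))

theorem exists_path (hb : Addr p y b) (n : ℕ) :
    ∃ a : Pth M, a 0 = y ∧ a 1 = p (b n) ∧ ∀ s, 0 < s → a s ∈ dball n y := by
  have hV : ∀ V ∈ 𝓝 y, ∃ k, dball (n + k) y ⊆ V := fun V hV => by
    obtain ⟨k, hk⟩ := exists_dball_subset hV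
    exact ⟨k, ((dball_anti y (Nat.le_add_left k n)).trans sdiff_subset).trans hk⟩
  exact exists_infinite_concat (q := fun k => p (b (n + k))) (U := fun k => dball (n + k) y)
    (fun i j h => dball_anti y (by omega)) hV fun k => (hb (n + k)).1

theorem le_two {S : Set M} (hS : Skeleton S p) (hy : y ∉ S) {b : Fin 3 → ℕ → ℕ}
    (hb : ∀ i, Addr p y (b i)) : ∃ i j, i ≠ j ∧ b i = b j := by
  by_contra! hcon
  have h1 : ∀ i j, ∃ n, i ≠ j → b i n ≠ b j n := fun i j => by
    by_cases hij : i = j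
    · exact ⟨0, fun h => absurd hij h⟩
    · obtain ⟨n, hn⟩ := Function.ne_iff.1 (hcon i j hij)
      exact ⟨n, fun _ => hn⟩
  choose N hN using h1
  obtain ⟨m, hm⟩ := (finite_range fun q : Fin 3 × Fin 3 => N q.1 q.2).bddAbove
  choose a h0 h1 ha using fun i => (hb i).exists_path (m + 1)
  refine hy ?_
  have := hS.center m a ⟨fun i j => by rw [h0, h0], fun i s hs => ?_, fun i j hij => ?_⟩
  · rwa [h0] at this
  · rw [h0]
    have h2 := ha i s hs
    have e : ((1 / 2 : ℝ) ^ m) / 2 = (1 / 2) ^ (m + 1) := by ring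
    rw [e]
    exact h2
  · rw [h0, h1, h1]
    exact (hb i).not_joinedIn (hb j) (hN i j hij) (hm ⟨(i, j), rfl⟩) (Nat.le_succ m)
      (Nat.le_succ m)

end Addr

/-- A path hitting `S` at arbitrarily small positive times determines an address. -/
theorem Skeleton.exists_addr {S : Set M} {p : ℕ → M} (hS : Skeleton S p) {α : Pth M}
    (hα : Function.Injective α) (h : ∀ ε : I, 0 < ε → ∃ s, 0 < s ∧ s < ε ∧ α s ∈ S) :
    ∃ b, Addr p (α 0) b := by
  classical
  have h1 : ∀ n, ∃ τ : I, 0 < τ ∧ ∀ s, 0 < s → s ≤ τ → α s ∈ dball n (α 0) := by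
    intro n
    have hn : α ⁻¹' Metric.ball (α 0) ((1 / 2) ^ n) ∈ 𝓝 (0 : I) :=
      (Metric.isOpen_ball.preimage α.continuous).mem_nhds (Metric.mem_ball_self (by positivity))
    obtain ⟨u, hu0, hu⟩ := (nhds_bot_basis (α := I)).mem_iff.1 hn
    obtain ⟨τ, hτ0, hτ⟩ := exists_between hu0
    exact ⟨τ, hτ0, fun s hs hsτ => ⟨hu (hsτ.trans_lt hτ),
      fun e => hs.ne' (hα e)⟩⟩
  choose τ hτ0 hτ using h1
  let A : ℕ → ℕ → Prop := fun n j =>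
    ∃ ε : I, 0 < ε ∧ ∀ s, 0 < s → s ≤ ε → JoinedIn (dball n (α 0)) (p j) (α s)
  have hA : ∀ n, ∃ j, A n j := by
    intro n
    obtain ⟨s, hs0, hs, hsS⟩ := h (τ n) (hτ0 n)
    obtain ⟨k, hk⟩ := hS.base _ (isOpen_dball n (α 0)) _ hsS (hτ n s hs0 hs.le)
    refine ⟨k, s, hs0, fun u hu hus => hk.trans (joinedIn_pth α fun x hx => hτ n x ?_ ?_)⟩
    · rw [uIcc_of_ge hus] at hx
      exact hu.trans_le hx.1
    · rw [uIcc_of_ge hus] at hx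
      exact hx.2.trans hs.le
  refine ⟨fun n => Nat.find (hA n), fun n => ⟨?_, fun j hj hjoin => ?_⟩⟩
  · obtain ⟨ε, hε, h1⟩ := Nat.find_spec (hA n)
    obtain ⟨ε', hε', h2⟩ := Nat.find_spec (hA (n + 1))
    have h3 := h1 (min ε ε') (lt_min hε hε') (min_le_left _ _)
    have h4 := h2 (min ε ε') (lt_min hε hε') (min_le_right _ _)
    exact h3.trans (h4.mono (dball_anti _ (Nat.le_succ n))).symm
  · obtain ⟨ε, hε, h1⟩ := Nat.find_spec (hA n)
    exact Nat.find_min (hA n) hj ⟨ε, hε, fun s hs hsε => hjoin.trans (h1 s hs hsε)⟩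

end

section

theorem exists_eq_vec {A : Type*} {a b c : A} (h : ∃ i j, i ≠ j ∧ ![a, b, c] i = ![a, b, c] j) :
    a = b ∨ a = c ∨ b = c := by
  obtain ⟨i, j, hij, h⟩ := h
  fin_cases i <;> fin_cases j <;> simp_all

variable {M : Type*} [MetricSpace M]

theorem range_eq_of_ends_eq {α β : Pth M} (hα : Function.Injective α) (hβ : Function.Injective β)
    (h0 : α 0 = β 0) (h1 : α 1 = β 1) (h : range α ⊆ range β) : range α = range β := by
  obtain ⟨φ, hφ, -, hφ0⟩ := exists_strictMono_factor hα hβ h0 h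
  have hφ1 : φ 1 = 1 := hβ (by rw [← hφ, h1])
  refine h.antisymm ?_
  rintro _ ⟨t, rfl⟩
  obtain ⟨s, -, hs⟩ := isPreconnected_univ.intermediate_value (mem_univ (0 : I)) (mem_univ 1)
    φ.continuous.continuousOn (show t ∈ Icc (φ 0) (φ 1) by
      rw [hφ0, hφ1]; exact ⟨unitInterval.nonneg t, unitInterval.le_one t⟩)
  exact ⟨s, by rw [hφ, hs]⟩

/-- The limits of addresses. -/
def Lim (p : ℕ → M) : Set M := {y | ∃ b, Addr p y b}

/-- The points which can be joined to a base point. -/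
def hull (p : ℕ → M) : Set M := {x | ∃ k, Joined (p k) x}

theorem Addr.joined {p : ℕ → M} {y : M} {b : ℕ → ℕ} (hb : Addr p y b) (n : ℕ) :
    Joined (p (b n)) y := by
  obtain ⟨a, h0, h1, -⟩ := hb.exists_path n
  rw [← h0, ← h1]
  exact Joined.symm (joinedIn_range a (O := univ) fun _ => trivial).joined

namespace Skeleton

variable {S : Set M} {p : ℕ → M}

theorem subset_hull (hS : Skeleton S p) : S ⊆ hull p := fun x hx => by
  obtain ⟨k, hk⟩ := hS.base univ isOpen_univ x hx trivial
  exact ⟨k, hk.joined⟩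

/-- The points of `Lim p` outside `S` are not interior to arcs with interior avoiding `S`. -/
theorem notMem_lim [SecondCountableTopology M] [Nonempty M] (hS : Skeleton S p) {β : Pth M}
    (hβ : Function.Injective β)
    (hf : ∀ s, 0 < s → s < 1 → β s ∉ S) {u : I} (hu0 : 0 < u) (hu1 : u < 1) : β u ∉ Lim p := by
  rintro ⟨b, hb⟩
  have hV : {β 0, β 1}ᶜ ∈ 𝓝 (β u) := (toFinite ({β 0, β 1} : Set M)).isClosed.isOpen_compl.mem_nhds
    (by
      rintro (h | h)
      · exact hu0.ne' (hβ h)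
      · exact hu1.ne (hβ h))
  obtain ⟨n, hn⟩ := exists_dball_subset hV
  obtain ⟨a, h0, h1, ha⟩ := hb.exists_path n
  have haV : ∀ s, a s ∉ ({β 0, β 1} : Set M) := fun s => by
    rcases (show (0 : I) ≤ s from unitInterval.nonneg s).eq_or_lt with rfl | hs
    · rw [h0]
      exact mem_of_mem_nhds hV
    · exact hn (ha s hs).1
  have hpS : a 1 ∈ S := h1 ▸ hS.mem _
  have hne : a 0 ≠ a 1 := fun h => hf u hu0 hu1 (by rw [← h0, h]; exact hpS)
  obtain ⟨α, hα, hα0, hα1, hr⟩ := exists_can a hne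
  have hαV : ∀ s, α s ∉ ({β 0, β 1} : Set M) := fun s => by
    obtain ⟨t, ht⟩ := hr ⟨s, rfl⟩
    rw [← ht]
    exact haV t
  have hout : α 1 ∉ range β := by
    rintro ⟨v, hv⟩
    have hv0 : 0 < v := unitInterval.pos_iff_ne_zero.2 fun h => hαV 1 (Or.inl (by rw [← hv, h]))
    have hv1 : v < 1 := unitInterval.lt_one_iff_ne_one.2 fun h => hαV 1 (Or.inr (by rw [← hv, h]; rfl))
    exact hf v hv0 hv1 (by rw [hv, hα1]; exact hpS)
  obtain ⟨t, ht1, ⟨v, hv⟩, ht⟩ := exists_last_mem α (isClosed_range_pth β)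
    ⟨u, by rw [hα0, h0]⟩ hout
  have hv0 : 0 < v := unitInterval.pos_iff_ne_zero.2 fun h => hαV t (Or.inl (by rw [← hv, h]))
  have hv1 : v < 1 := unitInterval.lt_one_iff_ne_one.2 fun h => hαV t (Or.inr (by rw [← hv, h]; rfl))
  refine hS.triodHit.no_branch (seg_injective hα.1 ht1.ne) hβ hf hv0 hv1
    (by rw [seg_zero, hv]) fun s hs => ?_
  rw [seg_apply]
  have h2 := lin_lt_lin ht1 hs
  rw [lin_zero] at h2
  exact ht _ h2 (unitInterval.le_one _)

/-- The canonical arcs leading from `y` to the limit set. -/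
def Leads (S : Set M) (p : ℕ → M) (α : Pth M) : Prop :=
  Function.Injective α ∧ (∀ s, s < 1 → α s ∉ S) ∧ α 1 ∈ S ∪ Lim p

theorem hull_eq [SecondCountableTopology M] [Nonempty M] (hS : Skeleton S p) :
    hull p = S ∪ Lim p ∪ {y | ∃ α : Pth M, Can α ∧ α 0 = y ∧ Leads S p α} := by
  have hlim : S ∪ Lim p ⊆ hull p := union_subset hS.subset_hull fun y ⟨b, hb⟩ => ⟨_, hb.joined 0⟩
  apply Subset.antisymm
  · rintro y ⟨k, hk⟩
    by_cases hy : y ∈ S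
    · exact Or.inl (Or.inl hy)
    obtain ⟨γ, h0, h1, -⟩ := (joinedIn_univ.2 hk.symm).exists_pth
    obtain ⟨α, hα, hα0, hα1, -⟩ := exists_can γ fun h =>
      hy (by rw [← h0, h, h1]; exact hS.mem k)
    rw [h0] at hα0
    rw [h1] at hα1
    have hne : (α ⁻¹' S).Nonempty := ⟨1, by rw [mem_preimage, hα1]; exact hS.mem k⟩
    set τ : I := sInf (α ⁻¹' S)
    have hlt : ∀ s, s < τ → α s ∉ S := fun s hs hm => (not_lt.2 (sInf_le (show s ∈ α ⁻¹' S from hm))) hs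
    have hτQ : α τ ∈ S ∪ Lim p := by
      by_cases hτS : α τ ∈ S
      · exact Or.inl hτS
      · have hτ1 : τ < 1 := unitInterval.lt_one_iff_ne_one.2 fun h => hτS (by
          rw [h, hα1]; exact hS.mem k)
        have := hS.exists_addr (seg_injective hα.1 hτ1.ne) fun ε hε => by
          have h2 := lin_lt_lin hτ1 hε
          rw [lin_zero] at h2
          obtain ⟨t, ht, htε⟩ := (sInf_lt_iff).1 h2
          have htτ : τ < t := lt_of_le_of_ne (sInf_le ht) fun h => hτS (by rw [h]; exact ht)
          obtain ⟨s, rfl⟩ := exists_lin (a := τ) (b := 1) (x := t) (by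
            rw [uIcc_of_le hτ1.le]; exact ⟨htτ.le, unitInterval.le_one t⟩)
          refine ⟨s, unitInterval.pos_iff_ne_zero.2 fun h => ?_, not_le.1 fun h => ?_, ht⟩
          · rw [h, lin_zero] at htτ
            exact lt_irrefl _ htτ
          · rcases h.eq_or_lt with h | h
            · rw [h] at htε
              exact lt_irrefl _ htε
            · exact lt_asymm htε (lin_lt_lin hτ1 h)
        rw [seg_zero] at this
        exact Or.inr this
    rcases (show (0 : I) ≤ τ from unitInterval.nonneg τ).eq_or_lt with h | h
    · left
      rw [← h, hα0] at hτQ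
      exact hτQ
    · right
      obtain ⟨δ, hδ, hδ0, hδ1, hr⟩ := exists_can (seg α 0 τ) (fun e => by
        rw [seg_zero, seg_one] at e
        exact h.ne (hα.1 e))
      rw [seg_zero, hα0] at hδ0
      rw [seg_one] at hδ1
      refine ⟨δ, hδ, hδ0, hδ.1, fun s hs hm => ?_, by rw [hδ1]; exact hτQ⟩
      obtain ⟨t, ht⟩ := hr ⟨s, rfl⟩
      have h3 : lin 0 τ t = τ := by
        rw [← ht, seg_apply] at hm
        have := lin_mem 0 τ t
        rw [uIcc_of_le h.le] at this
        exact le_antisymm this.2 (not_lt.1 fun hl => hlt _ hl hm)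
      rw [seg_apply, h3, ← hδ1] at ht
      exact hs.ne (hδ.1 ht.symm)
  · rintro y (hy | ⟨α, hα, rfl, -, -, hα1⟩)
    · exact hlim hy
    · obtain ⟨k, hk⟩ := hlim hα1
      exact ⟨k, hk.trans (joinedIn_range α (O := univ) fun _ => trivial).joined.symm⟩

theorem leads_le_two [SecondCountableTopology M] [Nonempty M] (hS : Skeleton S p)
    {a : Fin 3 → Pth M} (ha : ∀ i, Can (a i))
    (h0 : ∀ i j, a i 0 = a j 0) (hl : ∀ i, Leads S p (a i)) : ∃ i j, i ≠ j ∧ a i = a j := by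
  obtain ⟨i, j, hij, h⟩ := hS.triodHit.exists_nested a (fun i => (ha i).1) h0 fun i => (hl i).2.1
  refine ⟨i, j, hij, (ha i).ext (ha j) (h0 i j) ?_⟩
  refine range_eq_of_ends_eq (ha i).1 (ha j).1 (h0 i j) ?_ h
  obtain ⟨u, hu⟩ := h ⟨1, rfl⟩
  by_contra hne
  have hu1 : u < 1 := unitInterval.lt_one_iff_ne_one.2 fun e => hne (by rw [← hu, e])
  have hu0 : 0 < u := unitInterval.pos_iff_ne_zero.2 fun e => zero_ne_one (α := I)
    ((ha i).1 (by rw [← hu, e, h0 i j]))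
  have hm := (hl i).2.2
  rw [← hu] at hm
  rcases hm with hm | hm
  · exact (hl j).2.1 u hu1 hm
  · exact hS.notMem_lim (ha j).1 (fun s _ hs => (hl j).2.1 s hs) hu0 hu1 hm

variable [MeasurableSpace M] [BorelSpace M]

theorem measurableSet (hS : Skeleton S p) : MeasurableSet S := by
  obtain ⟨κ, rfl⟩ := hS.eq_iUnion
  exact MeasurableSet.iUnion fun n => (isClosed_range_pth (κ n)).measurableSet

end Skeleton

variable [MeasurableSpace M] [BorelSpace M]

theorem measurableSet_addr (p : ℕ → M) : MeasurableSet {q : M × (ℕ → ℕ) | Addr p q.1 q.2} := by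
  have h1 : ∀ n i j, Measurable fun q : M × (ℕ → ℕ) => JoinedIn (dball n q.1) (p i) (p j) :=
    fun n i j => measurableSet_setOfPred.1
      (measurable_fst (isOpen_joinedIn_dball n (p i) (p j)).measurableSet)
  have h2 : ∀ n i, Measurable fun q : M × (ℕ → ℕ) => q.2 n = i := fun n i => by
    have h : Measurable fun q : M × (ℕ → ℕ) => q.2 n :=
      (measurable_pi_apply n).comp measurable_snd
    exact measurableSet_setOfPred.1 (h (measurableSet_singleton i))
  have : {q : M × (ℕ → ℕ) | Addr p q.1 q.2} = {q : M × (ℕ → ℕ) | ∀ n i k, q.2 n = i →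
      q.2 (n + 1) = k → JoinedIn (dball n q.1) (p i) (p k) ∧
        ∀ j, j < i → ¬ JoinedIn (dball n q.1) (p j) (p i)} := by
    ext q
    constructor
    · rintro h n _ _ rfl rfl
      exact h n
    · exact fun h n => h n _ _ rfl rfl
  rw [this]
  refine measurableSet_setOfPred.2 (Measurable.forall fun n => Measurable.forall fun i =>
    Measurable.forall fun k => (h2 n i).imp ((h2 (n + 1) k).imp ((h1 n i k).and
      (Measurable.forall fun j => measurable_const.imp (h1 n j i).not))))

namespace Skeleton

variable {S : Set M} {p : ℕ → M} [PolishSpace M]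

theorem measurableSet_lim (hS : Skeleton S p) : MeasurableSet (S ∪ Lim p) := by
  have hP : MeasurableSet {q : M × (ℕ → ℕ) | Addr p q.1 q.2 ∧ q.1 ∉ S} :=
    (measurableSet_addr p).inter (measurable_fst hS.measurableSet.compl)
  have h := (image_fst_of_sections_le_two hP fun x a b c ha hb hc => exists_eq_vec
    (Addr.le_two hS ha.2 (b := ![a, b, c]) fun i => by
      fin_cases i
      · exact ha.1
      · exact hb.1
      · exact hc.1)).1
  convert hS.measurableSet.union h using 1
  ext y
  constructor
  · rintro (hy | ⟨b, hb⟩)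
    · exact Or.inl hy
    · by_cases hy : y ∈ S
      · exact Or.inl hy
      · exact Or.inr ⟨(y, b), ⟨hb, hy⟩, rfl⟩
  · rintro (hy | ⟨⟨y, b⟩, ⟨hb, -⟩, rfl⟩)
    · exact Or.inl hy
    · exact Or.inr ⟨b, hb⟩

theorem measurableSet_hull [Nonempty M] (hS : Skeleton S p) : MeasurableSet (hull p) := by
  have hl : MeasurableSet {α : Pth M | ∀ s, s < 1 → α s ∉ S} := by
    obtain ⟨κ, hκ⟩ := hS.eq_iUnion
    have : {α : Pth M | ∀ s, s < 1 → α s ∉ S} =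
        ⋂ n, {α : Pth M | ∀ s, s < 1 → α s ∈ (range (κ n))ᶜ} := by
      ext α
      simp only [hκ, mem_iInter, Set.mem_ofPred_eq, mem_iUnion, not_exists, mem_compl_iff]
      exact ⟨fun h n s hs => h s hs n, fun h s hs n => h n s hs⟩
    rw [this]
    exact MeasurableSet.iInter fun n =>
      measurableSet_forall_lt (isClosed_range_pth (κ n)).isOpen_compl
  have hP : MeasurableSet {q : M × Pth M | Can q.2 ∧ q.2 0 = q.1 ∧ Leads S p q.2} := by
    refine (measurable_snd measurableSet_can).inter (MeasurableSet.inter ?_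
      (measurable_snd (measurableSet_injective.inter (hl.inter
        (measurable_eval 1 hS.measurableSet_lim)))))
    exact measurableSet_eq_fun ((measurable_eval 0).comp measurable_snd) measurable_fst
  have : Nonempty (Pth M) := ‹Nonempty M›.map (ContinuousMap.const I)
  have h := (image_fst_of_sections_le_two hP fun x a b c ha hb hc => exists_eq_vec
    (hS.leads_le_two (a := ![a, b, c]) (fun i => by
      fin_cases i
      · exact ha.1
      · exact hb.1
      · exact hc.1) (fun i j => by
      have : ∀ i, ![a, b, c] i 0 = x := fun i => by
        fin_cases i
        · exact ha.2.1
        · exact hb.2.1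
        · exact hc.2.1
      rw [this, this]) (fun i => by
      fin_cases i
      · exact ha.2.2
      · exact hb.2.2
      · exact hc.2.2))).1
  rw [hS.hull_eq]
  convert hS.measurableSet_lim.union h using 2
  ext y
  constructor
  · rintro ⟨α, h⟩
    exact ⟨(y, α), h, rfl⟩
  · rintro ⟨⟨y, α⟩, h, rfl⟩
    exact ⟨α, h⟩

end Skeleton

theorem measurableSet_joined_of_hull [PolishSpace M] {p : ℕ → M} (h : MeasurableSet (hull p))
    (k : ℕ) : MeasurableSet {x | Joined (p k) x} := by
  have han : ∀ k, MeasureTheory.AnalyticSet {x | Joined (p k) x} := fun k => by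
    have hc : IsClosed {γ : Pth M | γ 0 = p k} :=
      isClosed_eq (continuous_eval_const 0) continuous_const
    have := hc.analyticSet.image_of_continuous (continuous_eval_const (1 : I))
    convert this using 1
    ext x
    constructor
    · intro hx
      obtain ⟨γ, h0, h1, -⟩ := (joinedIn_univ.2 hx).exists_pth
      exact ⟨γ, h0, h1⟩
    · rintro ⟨γ, h0, rfl⟩
      show Joined (p k) (γ 1)
      rw [← show γ 0 = p k from h0]
      exact (joinedIn_range γ (O := univ) fun _ => trivial).joined
  refine (han k).measurableSet_of_compl ?_
  have : {x | Joined (p k) x}ᶜ = ⋃ j : Option {j // ¬ Joined (p k) (p j)},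
      j.elim (hull p)ᶜ fun j => {x | Joined (p j) x} := by
    ext x
    simp only [mem_iUnion]
    constructor
    · intro hx
      by_cases hxp : x ∈ hull p
      · obtain ⟨j, hj⟩ := hxp
        exact ⟨some ⟨j, fun hkj => hx (hkj.trans hj)⟩, hj⟩
      · exact ⟨none, hxp⟩
    · rintro ⟨_ | ⟨j, hj⟩, hx⟩ hx'
      · exact hx ⟨k, hx'⟩
      · exact hj (Joined.trans hx' (Joined.symm hx))
  rw [this]
  refine MeasureTheory.AnalyticSet.iUnion fun j => ?_
  cases j with
  | none => exact h.compl.analyticSet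
  | some j => exact han j

end

section

section Crossings

variable {M : Type*} [MetricSpace M]

/-- A set hitting all triods which is a union of path components. -/
structure Core (T : Set M) : Prop where
  triodHit : TriodHit T
  mem : ∀ x y, Joined x y → x ∈ T → y ∈ T

theorem joined_pth (γ : Pth M) (s t : I) : Joined (γ s) (γ t) :=
  (joinedIn_pth γ (O := univ) fun _ _ => trivial).joined

theorem Core.notMem {T : Set M} (hT : Core T) (γ : Pth M) {s : I} (h : γ s ∉ T) (t : I) :
    γ t ∉ T := fun ht => h (hT.mem _ _ (joined_pth γ t s) ht)

/-- Injective paths outside `T` on which `f` increases from `0` to `1`, in the sense that the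
values at interior points are strictly between. -/
structure Crossing (T : Set M) (f : C(M, ℝ)) (α : Pth M) : Prop where
  injective : Function.Injective α
  zero : f (α 0) = 0
  one : f (α 1) = 1
  pos : ∀ s, 0 < s → s < 1 → 0 < f (α s)
  lt : ∀ s, 0 < s → s < 1 → f (α s) < 1
  notMem : α 0 ∉ T

namespace Crossing

variable {T : Set M} {f : C(M, ℝ)} {α β : Pth M}

theorem pos' (hα : Crossing T f α) {s : I} (hs : 0 < s) : 0 < f (α s) := by
  rcases (show s ≤ 1 from unitInterval.le_one s).eq_or_lt with rfl | h
  · rw [hα.one]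
    exact zero_lt_one
  · exact hα.pos s hs h

theorem lt' (hα : Crossing T f α) {s : I} (hs : s < 1) : f (α s) < 1 := by
  rcases (show (0 : I) ≤ s from unitInterval.nonneg s).eq_or_lt with rfl | h
  · rw [hα.zero]
    exact zero_lt_one
  · exact hα.lt s h hs

theorem eq_one (hα : Crossing T f α) {s : I} (hs : f (α s) = 1) : s = 1 := by
  by_contra h
  exact (hα.lt' (unitInterval.lt_one_iff_ne_one.2 h)).ne hs

theorem eq_zero (hα : Crossing T f α) {s : I} (hs : f (α s) = 0) : s = 0 := by
  by_contra h
  exact (hα.pos' (unitInterval.pos_iff_ne_zero.2 h)).ne' hs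

theorem reverse (hT : Core T) (hα : Crossing T f α) :
    Crossing T (1 - f) (seg α 1 0) where
  injective := seg_injective hα.injective one_ne_zero
  zero := by simp [hα.one]
  one := by simp [hα.zero]
  pos s h0 h1 := by
    have h2 := lin_gt_lin (zero_lt_one (α := I)) h0
    rw [lin_zero] at h2
    simpa [seg_apply] using hα.lt' h2
  lt s h0 h1 := by
    have h2 := lin_gt_lin (zero_lt_one (α := I)) h1
    rw [lin_one] at h2
    simpa [seg_apply] using hα.pos' h2
  notMem := by
    rw [seg_zero]
    exact hT.notMem α hα.notMem 1

theorem exists_can [SecondCountableTopology M] [Nonempty M] (hα : Crossing T f α) :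
    ∃ β, Can β ∧ Crossing T f β ∧ β 0 = α 0 ∧ β 1 = α 1 := by
  obtain ⟨β, hβ, h0, h1, hr⟩ := PlanarPaths.exists_can α
    (fun h => zero_ne_one (hα.injective h))
  have key : ∀ s, 0 < s → s < 1 → ∃ t, 0 < t ∧ t < 1 ∧ α t = β s := fun s hs0 hs1 => by
    obtain ⟨t, ht⟩ := hr ⟨s, rfl⟩
    refine ⟨t, unitInterval.pos_iff_ne_zero.2 fun e => ?_,
      unitInterval.lt_one_iff_ne_one.2 fun e => ?_, ht⟩
    · rw [e, ← h0] at ht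
      exact hs0.ne (hβ.1 ht)
    · rw [e, ← h1] at ht
      exact hs1.ne' (hβ.1 ht)
  refine ⟨β, hβ, ⟨hβ.1, by rw [h0, hα.zero], by rw [h1, hα.one], fun s hs0 hs1 => ?_,
    fun s hs0 hs1 => ?_, by rw [h0]; exact hα.notMem⟩, h0, h1⟩
  · obtain ⟨t, ht0, ht1, ht⟩ := key s hs0 hs1
    rw [← ht]
    exact hα.pos t ht0 ht1
  · obtain ⟨t, ht0, ht1, ht⟩ := key s hs0 hs1
    rw [← ht]
    exact hα.lt t ht0 ht1

theorem upper_eq (hT : Core T) (hα : Crossing T f α) (hβ : Crossing T f β) {u v : I}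
    (hu0 : 0 < u) (hu1 : u < 1) (hv0 : 0 < v) (hv1 : v < 1) (h : α u = β v) :
    α '' Icc u 1 = β '' Icc v 1 := by
  have hz : ∀ i j, ![seg β v 1, seg α u 1, seg α u 0] i 0 =
      ![seg β v 1, seg α u 1, seg α u 0] j 0 := fun i j => by
    fin_cases i <;> fin_cases j <;> simp [h]
  have hi : ∀ i, Function.Injective (![seg β v 1, seg α u 1, seg α u 0] i) := fun i => by
    fin_cases i
    · exact seg_injective hβ.injective hv1.ne
    · exact seg_injective hα.injective hu1.ne
    · exact seg_injective hα.injective hu0.ne'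
  have hm : ∀ i s, s < 1 → ![seg β v 1, seg α u 1, seg α u 0] i s ∉ T := fun i s _ => by
    fin_cases i
    · exact hT.notMem β hβ.notMem _
    · exact hT.notMem α hα.notMem _
    · exact hT.notMem α hα.notMem _
  have e1 : range (seg β v 1) = β '' Icc v 1 := by rw [range_seg, uIcc_of_le hv1.le]
  have e2 : range (seg α u 1) = α '' Icc u 1 := by rw [range_seg, uIcc_of_le hu1.le]
  have e3 : range (seg α u 0) = α '' Icc 0 u := by rw [range_seg, uIcc_of_ge hu0.le]
  have hv1' : v ≤ 1 := hv1.le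
  have hu1' : u ≤ 1 := hu1.le
  have n12 : ¬ α '' Icc u 1 ⊆ α '' Icc 0 u := fun hs => by
    obtain ⟨t, ht, e⟩ := hs ⟨1, ⟨hu1', le_rfl⟩, rfl⟩
    rw [hα.injective e] at ht
    exact not_le.2 hu1 ht.2
  have n21 : ¬ α '' Icc 0 u ⊆ α '' Icc u 1 := fun hs => by
    obtain ⟨t, ht, e⟩ := hs ⟨0, ⟨le_rfl, hu0.le⟩, rfl⟩
    rw [hα.injective e] at ht
    exact not_le.2 hu0 ht.1
  have n02 : ¬ β '' Icc v 1 ⊆ α '' Icc 0 u := fun hs => by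
    obtain ⟨t, ht, e⟩ := hs ⟨1, ⟨hv1', le_rfl⟩, rfl⟩
    have := hα.eq_one (by rw [e, hβ.one])
    rw [this] at ht
    exact not_le.2 hu1 ht.2
  have n20 : ¬ α '' Icc 0 u ⊆ β '' Icc v 1 := fun hs => by
    obtain ⟨t, ht, e⟩ := hs ⟨0, ⟨le_rfl, hu0.le⟩, rfl⟩
    have := hβ.eq_zero (by rw [e, hα.zero])
    rw [this] at ht
    exact not_le.2 hv0 ht.1
  have ends : α '' Icc u 1 ⊆ β '' Icc v 1 ∨ β '' Icc v 1 ⊆ α '' Icc u 1 → α 1 = β 1 := by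
    rintro (hs | hs)
    · obtain ⟨t, ht, e⟩ := hs ⟨1, ⟨hu1', le_rfl⟩, rfl⟩
      have ht1 : t = 1 := hβ.eq_one (by rw [e, hα.one])
      rw [← e, ht1]
    · obtain ⟨t, ht, e⟩ := hs ⟨1, ⟨hv1', le_rfl⟩, rfl⟩
      have ht1 : t = 1 := hα.eq_one (by rw [e, hβ.one])
      rw [← e, ht1]
  have fin : α '' Icc u 1 ⊆ β '' Icc v 1 ∨ β '' Icc v 1 ⊆ α '' Icc u 1 →
      α '' Icc u 1 = β '' Icc v 1 := fun hs => by
    have hends := ends hs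
    rw [← e1, ← e2] at hs ⊢
    rcases hs with hs | hs
    · exact range_eq_of_ends_eq (hi 1) (hi 0) (hz 1 0) (by simpa using hends) hs
    · exact (range_eq_of_ends_eq (hi 0) (hi 1) (hz 0 1) (by simpa using hends.symm) hs).symm
  obtain ⟨i, j, hij, hs⟩ := hT.triodHit.exists_nested _ hi hz hm
  fin_cases i <;> fin_cases j <;> simp [e1, e2, e3] at hij hs
  · exact fin (Or.inr (image_subset_iff.2 hs))
  · exact (n02 (image_subset_iff.2 hs)).elim
  · exact fin (Or.inl (image_subset_iff.2 hs))
  · exact (n12 (image_subset_iff.2 hs)).elim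
  · exact (n20 (image_subset_iff.2 hs)).elim
  · exact (n21 (image_subset_iff.2 hs)).elim

/-- Crossings which meet at an interior point have the same range. -/
theorem range_eq (hT : Core T) (hα : Crossing T f α) (hβ : Crossing T f β) {u v : I}
    (hu0 : 0 < u) (hu1 : u < 1) (hv0 : 0 < v) (hv1 : v < 1) (h : α u = β v) :
    range α = range β := by
  have h1 := hα.upper_eq hT hβ hu0 hu1 hv0 hv1 h
  obtain ⟨u', hu'⟩ := exists_lin (a := 1) (b := 0) (x := u) (by
    rw [uIcc_of_ge zero_le_one]; exact ⟨hu0.le, hu1.le⟩)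
  obtain ⟨v', hv'⟩ := exists_lin (a := 1) (b := 0) (x := v) (by
    rw [uIcc_of_ge zero_le_one]; exact ⟨hv0.le, hv1.le⟩)
  have h2 := (hα.reverse hT).upper_eq hT (hβ.reverse hT) (u := u') (v := v')
    (unitInterval.pos_iff_ne_zero.2 fun e => hu1.ne (by rw [← hu', e, lin_zero]))
    (unitInterval.lt_one_iff_ne_one.2 fun e => hu0.ne' (by rw [← hu', e, lin_one]))
    (unitInterval.pos_iff_ne_zero.2 fun e => hv1.ne (by rw [← hv', e, lin_zero]))
    (unitInterval.lt_one_iff_ne_one.2 fun e => hv0.ne' (by rw [← hv', e, lin_one]))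
    (by rw [seg_apply, seg_apply, hu', hv', h])
  have key : ∀ (γ : Pth M) (w w' : I), w' < 1 → lin 1 0 w' = w →
      seg γ 1 0 '' Icc w' 1 = γ '' Icc 0 w := by
    intro γ w w' hlt hw
    have : (seg γ 1 0 : I → M) = γ ∘ lin 1 0 := rfl
    rw [this, image_comp]
    congr 1
    apply Subset.antisymm
    · rintro _ ⟨s, hs, rfl⟩
      refine ⟨unitInterval.nonneg _, ?_⟩
      rcases hs.1.eq_or_lt with e | e
      · rw [← e, hw]
      · rw [← hw]
        exact (lin_gt_lin zero_lt_one e).le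
    · intro x hx
      obtain ⟨s, hs⟩ := exists_lin (a := 1) (b := 0) (x := x) (by
        rw [uIcc_of_ge zero_le_one]; exact ⟨hx.1, unitInterval.le_one _⟩)
      refine ⟨s, ⟨not_lt.1 fun e => ?_, unitInterval.le_one _⟩, hs⟩
      have := lin_gt_lin (zero_lt_one (α := I)) e
      rw [hs, hw] at this
      exact not_le.2 this hx.2
  rw [key α u u' (unitInterval.lt_one_iff_ne_one.2 fun e => hu0.ne' (by rw [← hu', e, lin_one])) hu',
    key β v v' (unitInterval.lt_one_iff_ne_one.2 fun e => hv0.ne' (by rw [← hv', e, lin_one])) hv']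
    at h2
  have cover : ∀ (γ : Pth M) (w : I), range γ = γ '' Icc 0 w ∪ γ '' Icc w 1 := fun γ w => by
    rw [← image_union, Icc_union_Icc_eq_Icc (show (0 : I) ≤ w from unitInterval.nonneg w)
      (show w ≤ 1 from unitInterval.le_one w),
      show Icc (0 : I) 1 = univ from
        eq_univ_of_forall fun s => ⟨unitInterval.nonneg s, unitInterval.le_one s⟩, image_univ]
  rw [cover α u, cover β v, h1, h2]

/-- Among three crossings with the upper ends joined above level `0`, two have the same range. -/
theorem exists_range_eq [SecondCountableTopology M] [Nonempty M] (hT : Core T) {a : Fin 3 → Pth M}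
    (ha : ∀ i, Crossing T f (a i)) (h : ∀ i j, JoinedIn {y | 0 < f y} (a i 1) (a j 1)) :
    ∃ i j, i ≠ j ∧ range (a i) = range (a j) := by
  choose γ hγ0 hγ1 hγ using fun i => (h 0 i).exists_pth
  have hmin : ∀ i, ∃ s, ∀ t, f (γ i s) ≤ f (γ i t) := fun i => by
    obtain ⟨s, -, hs⟩ := isCompact_univ.exists_isMinOn (univ_nonempty (α := I))
      (f := fun s => f (γ i s)) (f.continuous.comp (γ i).continuous).continuousOn
    exact ⟨s, fun t => hs (mem_univ t)⟩
  choose σ' hσ using hmin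
  obtain ⟨i₀, hi₀⟩ := Finite.exists_min fun i => f (γ i (σ' i))
  set m := f (γ i₀ (σ' i₀)) with hm
  have hm0 : 0 < m := hγ i₀ _
  have hmle : ∀ i s, m ≤ f (γ i s) := fun i s => (hi₀ i).trans (hσ i s)
  have hm1 : m ≤ 1 := by
    have := hmle 0 1
    rwa [hγ1, (ha 0).one] at this
  have hτ : ∀ i, ∃ t, f (a i t) = m / 2 := fun i => by
    obtain ⟨t, -, ht⟩ := isPreconnected_univ.intermediate_value (mem_univ (0 : I)) (mem_univ 1)
      (f := fun s => f (a i s)) (f.continuous.comp (a i).continuous).continuousOn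
      (show m / 2 ∈ Icc (f (a i 0)) (f (a i 1)) by
        rw [(ha i).zero, (ha i).one]; constructor <;> linarith)
    exact ⟨t, ht⟩
  choose τ hτ using hτ
  have hτ0 : ∀ i, 0 < τ i := fun i => unitInterval.pos_iff_ne_zero.2 fun e => by
    have := hτ i
    rw [e, (ha i).zero] at this
    linarith
  have hτ1 : ∀ i, τ i < 1 := fun i => unitInterval.lt_one_iff_ne_one.2 fun e => by
    have := hτ i
    rw [e, (ha i).one] at this
    linarith
  have hj : ∀ i, JoinedIn (range (γ i) ∪ a i '' Icc (τ i) 1) (a 0 1) (a i (τ i)) := fun i => by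
    have h1 := joinedIn_range (γ i) (O := range (γ i) ∪ a i '' Icc (τ i) 1) fun s => Or.inl ⟨s, rfl⟩
    rw [hγ0, hγ1] at h1
    refine h1.trans (joinedIn_pth (a i) fun s hs => Or.inr ⟨s, ?_, rfl⟩)
    rwa [uIcc_of_ge (hτ1 i).le] at hs
  have hA : ∀ i, ∃ δ : Pth M, Can δ ∧ δ 0 = a 0 1 ∧ δ 1 = a i (τ i) ∧
      range δ ⊆ range (γ i) ∪ a i '' Icc (τ i) 1 := fun i => by
    obtain ⟨δ, h0, h1, hδ⟩ := (hj i).exists_pth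
    obtain ⟨ε, hε, hε0, hε1, hr⟩ := PlanarPaths.exists_can δ fun e => by
      rw [h0, h1] at e
      have h3 := hτ i
      rw [← e, (ha 0).one] at h3
      linarith
    exact ⟨ε, hε, by rw [hε0, h0], by rw [hε1, h1], hr.trans (range_subset_iff.2 hδ)⟩
  choose δ hδ hδ0 hδ1 hδr using hA
  obtain ⟨i, j, hij, hs⟩ := hT.triodHit.exists_nested δ (fun i => (hδ i).1)
    (fun i j => by rw [hδ0, hδ0]) fun i s _ => hT.notMem (δ i) (s := 0) (by
      rw [hδ0]; exact hT.notMem (a 0) (ha 0).notMem 1) s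
  refine ⟨i, j, hij, ?_⟩
  rcases hδr j (hs ⟨1, rfl⟩) with ⟨s, e⟩ | ⟨v, hv, e⟩
  · have h3 := hmle j s
    rw [e, hδ1, hτ] at h3
    linarith
  · rw [hδ1] at e
    refine (ha i).range_eq hT (ha j) (hτ0 i) (hτ1 i) ((hτ0 j).trans_le hv.1)
      (unitInterval.lt_one_iff_ne_one.2 fun e' => ?_) e.symm
    have h3 := hτ i
    rw [← e, e', (ha j).one] at h3
    linarith

theorem eq_of_joinedIn_one [SecondCountableTopology M] [Nonempty M] (hT : Core T)
    {a : Fin 3 → Pth M} (hc : ∀ i, Can (a i)) (ha : ∀ i, Crossing T f (a i))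
    (h : ∀ i j, JoinedIn {y | 0 < f y} (a i 1) (a j 1)) : ∃ i j, i ≠ j ∧ a i = a j := by
  obtain ⟨i, j, hij, hr⟩ := exists_range_eq hT ha h
  refine ⟨i, j, hij, (hc i).ext (hc j) ?_ hr⟩
  obtain ⟨s, hs⟩ : a i 0 ∈ range (a j) := hr ▸ ⟨0, rfl⟩
  have h0 : s = 0 := (ha j).eq_zero (by rw [hs, (ha i).zero])
  rw [← hs, h0]

theorem eq_of_joinedIn_zero [SecondCountableTopology M] [Nonempty M] (hT : Core T)
    {a : Fin 3 → Pth M} (hc : ∀ i, Can (a i)) (ha : ∀ i, Crossing T f (a i))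
    (h : ∀ i j, JoinedIn {y | f y < 1} (a i 0) (a j 0)) : ∃ i j, i ≠ j ∧ a i = a j := by
  obtain ⟨i, j, hij, hr⟩ := exists_range_eq hT (fun i => (ha i).reverse hT) fun i j => by
    simpa using h i j
  have e : ∀ i, range (seg (a i) 1 0) = range (a i) := fun i => by
    rw [range_seg, uIcc_of_ge zero_le_one, ← image_univ]
    congr 1
    exact eq_univ_of_forall fun s => ⟨unitInterval.nonneg s, unitInterval.le_one s⟩
  rw [e, e] at hr
  refine ⟨i, j, hij, (hc i).ext (hc j) ?_ hr⟩
  obtain ⟨s, hs⟩ : a i 0 ∈ range (a j) := hr ▸ ⟨0, rfl⟩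
  have h0 : s = 0 := (ha j).eq_zero (by rw [hs, (ha i).zero])
  rw [← hs, h0]

end Crossing

end Crossings

end

section

section Near

variable {M : Type*} [MetricSpace M]

/-- `x` is joined to the lower end of `α` below level `1` or to its upper end above level `0`. -/
def Near (f : C(M, ℝ)) (x : M) (α : Pth M) : Prop :=
  JoinedIn {y | f y < 1} x (α 0) ∨ JoinedIn {y | 0 < f y} x (α 1)

theorem Near.joined {f : C(M, ℝ)} {x : M} {α : Pth M} (h : Near f x α) : Joined x (α 0) := by
  rcases h with h | h
  · exact h.joined
  · exact h.joined.trans (joined_pth α 1 0)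

variable {T : Set M} {f : C(M, ℝ)}

theorem exists_first_eq_one {x z : M} {O : Set M} (h : JoinedIn O x z) (hx : f x < 1)
    (hz : 1 ≤ f z) : ∃ w ∈ O, f w = 1 ∧ JoinedIn ({x | f x < 1} ∪ {w}) x w ∧ JoinedIn O w z := by
  obtain ⟨γ, hγ0, hγ1, hγ⟩ := h.exists_pth
  obtain ⟨t, ht, ht1, hlt⟩ := exists_first_mem γ (C := {x | 1 ≤ f x})
    (isClosed_le continuous_const f.continuous) (by rw [hγ1]; exact hz) (s := 0) (by
      rw [hγ0]; exact not_le.2 hx)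
  have hlt' : ∀ u, u < t → f (γ u) < 1 := fun u hu => not_le.1 (hlt u (unitInterval.nonneg u) hu)
  have hone : f (γ t) = 1 := by
    refine le_antisymm (not_lt.1 fun hneg => ?_) ht1
    obtain ⟨u, hu, e⟩ := isPreconnected_Icc.intermediate_value
      (left_mem_Icc.2 ht.le) (right_mem_Icc.2 ht.le) (f := fun s => f (γ s))
      (f.continuous.comp γ.continuous).continuousOn
      (show (1 : ℝ) ∈ Icc (f (γ 0)) (f (γ t)) by rw [hγ0]; exact ⟨hx.le, ht1⟩)
    rcases hu.2.eq_or_lt with h | h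
    · rw [h] at e
      exact hneg.ne' e
    · exact (hlt' u h).ne e
  refine ⟨γ t, hγ t, hone, ?_, ?_⟩
  · rw [← hγ0]
    refine joinedIn_pth γ fun u hu => ?_
    rw [uIcc_of_le ht.le] at hu
    rcases hu.2.eq_or_lt with h | h
    · exact Or.inr (by rw [h]; rfl)
    · exact Or.inl (hlt' u h)
  · rw [← hγ1]
    exact joinedIn_pth γ fun u _ => hγ u

variable [SecondCountableTopology M] [Nonempty M]

/-- The canonical crossings. -/
def CanCrossing (T : Set M) (f : C(M, ℝ)) : Set (Pth M) := {α | Can α ∧ Crossing T f α}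

theorem exists_crossing_of_joinedIn_union (hT : Core T) {y w : M} (hy : y ∉ T) (hy0 : f y ≤ 0)
    (hw : f w = 1) (h : JoinedIn ({x | f x < 1} ∪ {w}) y w) :
    ∃ α ∈ CanCrossing T f, JoinedIn {x | f x < 1} y (α 0) ∧ α 1 = w := by
  obtain ⟨γ, hγ0, hγ1, hγ⟩ := h.exists_pth
  obtain ⟨κ, hκ, h0, h1, hr⟩ := exists_can γ fun e => by
    rw [hγ0, hγ1] at e
    rw [e, hw] at hy0
    linarith
  rw [hγ0] at h0
  rw [hγ1] at h1
  have hlt : ∀ s, s < 1 → f (κ s) < 1 := fun s hs => by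
    obtain ⟨t, ht⟩ := hr ⟨s, rfl⟩
    have := hγ t
    rw [ht] at this
    rcases this with h | h
    · exact h
    · exact (hs.ne (hκ.1 ((show κ s = w from h).trans h1.symm))).elim
  obtain ⟨s, hs1, hs0, hs⟩ := exists_last_mem κ (C := {x | f x ≤ 0})
    (isClosed_le f.continuous continuous_const) (by rw [h0]; exact hy0) (s := 1) (by
      rw [h1]; simp [hw])
  have hpos : ∀ u, s < u → 0 < f (κ u) := fun u hu => not_le.1 (hs u hu (unitInterval.le_one u))
  have hκs : f (κ s) = 0 := by
    refine le_antisymm hs0 (not_lt.1 fun hneg => ?_)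
    obtain ⟨t, ht, e⟩ := isPreconnected_Icc.intermediate_value
      (left_mem_Icc.2 hs1.le) (right_mem_Icc.2 hs1.le) (f := fun s => f (κ s))
      (f.continuous.comp κ.continuous).continuousOn
      (show (0 : ℝ) ∈ Icc (f (κ s)) (f (κ 1)) by rw [h1, hw]; exact ⟨hneg.le, zero_le_one⟩)
    rcases ht.1.eq_or_lt with h | h
    · rw [← h] at e
      exact hneg.ne e
    · exact (hpos t h).ne' e
  have hc : Crossing T f (seg κ s 1) := by
    refine ⟨seg_injective hκ.1 hs1.ne, by simp [hκs], by simp [h1, hw], fun t h0 _ => ?_,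
      fun t _ h1 => ?_, ?_⟩
    · have := lin_lt_lin hs1 h0
      rw [lin_zero] at this
      exact hpos _ this
    · have := lin_lt_lin hs1 h1
      rw [lin_one] at this
      exact hlt _ this
    · rw [seg_zero]
      exact hT.notMem κ (s := 0) (by rw [h0]; exact hy) s
  obtain ⟨α, hα, hα', e0, e1⟩ := hc.exists_can
  rw [seg_zero] at e0
  rw [seg_one, h1] at e1
  refine ⟨α, ⟨hα, hα'⟩, ?_, e1⟩
  rw [e0, ← h0]
  refine joinedIn_pth κ fun u hu => hlt u ?_
  rw [uIcc_of_le (show (0 : I) ≤ s from unitInterval.nonneg s)] at hu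
  exact hu.2.trans_lt hs1

theorem exists_crossing (hT : Core T) {y x z : M} (hy : y ∉ T) (hy0 : f y ≤ 0) (hz : 1 ≤ f z)
    (hyx : JoinedIn {x | f x < 1} y x) (hxz : JoinedIn {x | 0 < f x} x z) :
    ∃ α ∈ CanCrossing T f, JoinedIn {x | f x < 1} y (α 0) ∧ JoinedIn {x | 0 < f x} (α 1) z := by
  obtain ⟨w, -, hw, h1, h2⟩ := exists_first_eq_one hxz hyx.target_mem hz
  obtain ⟨α, hα, h3, h4⟩ := exists_crossing_of_joinedIn_union hT hy hy0 hw
    ((hyx.mono subset_union_left).trans h1)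
  exact ⟨α, hα, h3, h4 ▸ h2⟩

theorem exists_near_of_joined (hT : Core T) {x z : M} (hx : x ∉ T) (h : Joined x z) (hx0 : f x ≤ 0)
    (hz : 1 ≤ f z) : ∃ α ∈ CanCrossing T f, Near f x α := by
  obtain ⟨w, -, hw, h1, -⟩ := exists_first_eq_one (joinedIn_univ.2 h)
    (hx0.trans_lt zero_lt_one) hz
  obtain ⟨α, hα, h3, -⟩ := exists_crossing_of_joinedIn_union hT hx hx0 hw h1
  exact ⟨α, hα, Or.inl h3⟩

/-- Equivalence relations containing the elementary adjacency of crossings. -/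
structure Compatible (T : Set M) (f : C(M, ℝ)) (r : Pth M → Pth M → Prop) : Prop where
  equivalence : Equivalence r
  zero : ∀ α ∈ CanCrossing T f, ∀ β ∈ CanCrossing T f, JoinedIn {y | f y < 1} (α 0) (β 0) → r α β
  one : ∀ α ∈ CanCrossing T f, ∀ β ∈ CanCrossing T f, JoinedIn {y | 0 < f y} (α 1) (β 1) → r α β

namespace Compatible

variable {r : Pth M → Pth M → Prop}

theorem exists_of_joinedIn_lt (hr : Compatible T f r) (hT : Core T) {x x' : M} (hx : x ∉ T)
    (h : JoinedIn {y | f y < 1} x x') {α : Pth M} (hα : α ∈ CanCrossing T f) (hn : Near f x α) :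
    ∃ β ∈ CanCrossing T f, r α β ∧ Near f x' β := by
  rcases hn with hn | hn
  · exact ⟨α, hα, hr.equivalence.refl α, Or.inl (h.symm.trans hn)⟩
  · obtain ⟨γ, h0, h1, hγ⟩ := h.exists_pth
    by_cases hp : ∀ s, 0 < f (γ s)
    · refine ⟨α, hα, hr.equivalence.refl α, Or.inr (JoinedIn.trans ?_ hn)⟩
      rw [← h0, ← h1]
      exact (joinedIn_range γ hp).symm
    · push Not at hp
      obtain ⟨s, hs⟩ := hp
      obtain ⟨β, hβ, h2, h3⟩ := exists_crossing hT (hT.notMem γ (s := 0) (by rwa [h0]) s) hs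
        hα.2.one.ge (h0 ▸ joinedIn_pth γ (b := 0) fun u _ => hγ u) hn
      refine ⟨β, hβ, hr.one _ hα _ hβ h3.symm, Or.inl (JoinedIn.trans ?_ h2)⟩
      rw [← h1]
      exact joinedIn_pth γ fun u _ => hγ u

theorem exists_of_joinedIn_pos (hr : Compatible T f r) (hT : Core T) {x x' : M}
    (h : JoinedIn {y | 0 < f y} x x') {α : Pth M} (hα : α ∈ CanCrossing T f) (hn : Near f x α) :
    ∃ β ∈ CanCrossing T f, r α β ∧ Near f x' β := by
  rcases hn with hn | hn
  · obtain ⟨γ, h0, h1, hγ⟩ := h.exists_pth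
    by_cases hp : ∀ s, f (γ s) < 1
    · refine ⟨α, hα, hr.equivalence.refl α, Or.inl (JoinedIn.trans ?_ hn)⟩
      rw [← h0, ← h1]
      exact (joinedIn_range γ hp).symm
    · push Not at hp
      obtain ⟨s, hs⟩ := hp
      obtain ⟨β, hβ, h2, h3⟩ := exists_crossing hT hα.2.notMem hα.2.zero.le hs hn.symm
        (h0 ▸ joinedIn_pth γ (a := 0) fun u _ => hγ u)
      refine ⟨β, hβ, hr.zero _ hα _ hβ h2, Or.inr (JoinedIn.trans ?_ h3.symm)⟩
      rw [← h1]
      exact joinedIn_pth γ fun u _ => hγ u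
  · exact ⟨α, hα, hr.equivalence.refl α, Or.inr (h.symm.trans hn)⟩

theorem exists_of_joined (hr : Compatible T f r) (hT : Core T) {x x' : M} (hx : x ∉ T)
    (h : Joined x x') {α : Pth M} (hα : α ∈ CanCrossing T f) (hn : Near f x α) :
    ∃ β ∈ CanCrossing T f, r α β ∧ Near f x' β := by
  obtain ⟨γ, h0, h1, -⟩ := (joinedIn_univ.2 h).exists_pth
  have hγT : ∀ s, γ s ∉ T := hT.notMem γ (s := 0) (by rwa [h0])
  let P : I → I → Prop := fun s t => ∀ α ∈ CanCrossing T f, Near f (γ s) α →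
    ∃ β ∈ CanCrossing T f, r α β ∧ Near f (γ t) β
  have htrans : ∀ s t u, P s t → P t u → P s u := fun s t u h1 h2 α hα hn => by
    obtain ⟨β, hβ, hαβ, hn'⟩ := h1 α hα hn
    obtain ⟨δ, hδ, hβδ, hn''⟩ := h2 β hβ hn'
    exact ⟨δ, hδ, hr.equivalence.trans hαβ hβδ, hn''⟩
  have hloc : ∀ s, ∀ᶠ t in 𝓝 s, P s t ∧ P t s := fun s => by
    have hu : ∀ O : Set M, IsOpen O → γ s ∈ O → ∀ᶠ t in 𝓝 s, JoinedIn O (γ s) (γ t) := by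
      intro O hO hs
      have hn : ∀ᶠ V in (𝓝 s).smallSets, V ⊆ γ ⁻¹' O :=
        eventually_smallSets_subset.2 (γ.continuous.continuousAt (hO.mem_nhds hs))
      have ht : Tendsto (fun t => uIcc s t) (𝓝 s) (𝓝 s).smallSets :=
        tendsto_const_nhds.uIcc tendsto_id
      filter_upwards [ht.eventually hn] with t ht
      exact joinedIn_pth γ ht
    rcases lt_or_ge (f (γ s)) 1 with hs | hs
    · filter_upwards [hu {y | f y < 1} (isOpen_lt f.continuous continuous_const) hs] with t ht
      exact ⟨fun α hα hn => hr.exists_of_joinedIn_lt hT (hγT s) ht hα hn,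
        fun α hα hn => hr.exists_of_joinedIn_lt hT (hγT t) ht.symm hα hn⟩
    · filter_upwards [hu {y | 0 < f y} (isOpen_lt continuous_const f.continuous)
        (zero_lt_one.trans_le hs)] with t ht
      exact ⟨fun α hα hn => hr.exists_of_joinedIn_pos hT ht hα hn,
        fun α hα hn => hr.exists_of_joinedIn_pos hT ht.symm hα hn⟩
  have : IsTrans I P := ⟨htrans⟩
  have hP : P 0 1 := PreconnectedSpace.induction₂' P hloc inferInstance 0 1
  have := hP α hα (by rwa [h0])
  rwa [h1] at this

theorem of_joined (hr : Compatible T f r) (hT : Core T) {α β : Pth M} (hα : α ∈ CanCrossing T f)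
    (hβ : β ∈ CanCrossing T f) (h : Joined (α 0) (β 0)) : r α β := by
  obtain ⟨δ, hδ, hαδ, hn⟩ := hr.exists_of_joined hT hα.2.notMem h hα
    (Or.inl (JoinedIn.refl (by simp [hα.2.zero])))
  refine hr.equivalence.trans hαδ (hr.equivalence.symm ?_)
  rcases hn with hn | hn
  · exact hr.zero _ hβ _ hδ hn
  · have := hn.source_mem
    simp [hβ.2.zero] at this

end Compatible

theorem exists_near_of_near (hT : Core T) {x x' : M} (hx : x ∉ T) (h : Joined x x')
    (hn : ∃ α ∈ CanCrossing T f, Near f x α) : ∃ α ∈ CanCrossing T f, Near f x' α := by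
  obtain ⟨α, hα, hn⟩ := hn
  have hr : Compatible T f fun _ _ => True :=
    ⟨⟨fun _ => trivial, fun _ => trivial, fun _ _ => trivial⟩, fun _ _ _ _ _ => trivial,
      fun _ _ _ _ _ => trivial⟩
  obtain ⟨β, hβ, -, hn'⟩ := hr.exists_of_joined hT hx h hα hn
  exact ⟨β, hβ, hn'⟩

end Near

end

section

section Linking

theorem exists_separating_sequence (M : Type*) [MetricSpace M] [SecondCountableTopology M]
    [Nonempty M] : ∃ F : ℕ → C(M, ℝ), ∀ x y, x ≠ y → ∃ n, F n x ≤ 0 ∧ 1 ≤ F n y := by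
  let G : ℕ × ℕ → C(M, ℝ) := fun q => ⟨fun y => q.1 * dist y (TopologicalSpace.denseSeq M q.2) - 1,
    by fun_prop⟩
  refine ⟨fun n => G n.unpair, fun x y hxy => ?_⟩
  obtain ⟨k, hk⟩ := exists_nat_gt (3 / dist x y)
  have hd : 0 < dist x y := dist_pos.2 hxy
  have hk0 : (0 : ℝ) < k := (div_pos three_pos hd).trans hk
  obtain ⟨n, hn⟩ := (TopologicalSpace.denseRange_denseSeq M).exists_dist_lt x (inv_pos.2 hk0)
  have h1 : k * dist x (TopologicalSpace.denseSeq M n) ≤ 1 := by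
    have := mul_le_mul_of_nonneg_left hn.le hk0.le
    rwa [mul_inv_cancel₀ hk0.ne'] at this
  have h2 : 3 < k * dist x y := (div_lt_iff₀ hd).1 hk
  have h3 := mul_le_mul_of_nonneg_left
    (dist_triangle_right x y (TopologicalSpace.denseSeq M n)) hk0.le
  refine ⟨Nat.pair k n, ?_, ?_⟩
  · show ((Nat.unpair (Nat.pair k n)).1 : ℝ) * dist x
      (TopologicalSpace.denseSeq M (Nat.unpair (Nat.pair k n)).2) - 1 ≤ 0
    rw [Nat.unpair_pair]
    linarith
  · show 1 ≤ ((Nat.unpair (Nat.pair k n)).1 : ℝ) * dist y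
      (TopologicalSpace.denseSeq M (Nat.unpair (Nat.pair k n)).2) - 1
    rw [Nat.unpair_pair]
    linarith

theorem Skeleton.core {M : Type*} [MetricSpace M] {S : Set M} {p : ℕ → M} (hS : Skeleton S p) :
    Core (hull p) where
  triodHit := hS.triodHit.mono hS.subset_hull
  mem := fun _ _ h ⟨k, hk⟩ => ⟨k, hk.trans h⟩

section

variable {M : Type*} [MetricSpace M]

/-- Elementary adjacency of crossings: the lower ends are joined below level `1`, or the upper ends
are joined above level `0`. -/
def Link (f : C(M, ℝ)) : Bool → Pth M → Pth M → Prop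
  | false, α, β => JoinedIn {y | f y < 1} (α 0) (β 0)
  | true, α, β => JoinedIn {y | 0 < f y} (α 1) (β 1)

theorem Link.joined {f : C(M, ℝ)} {c : Bool} {α β : Pth M} (h : Link f c α β) :
    Joined (α 0) (β 0) := by
  cases c
  · exact JoinedIn.joined h
  · exact (joined_pth α 0 1).trans ((JoinedIn.joined h).trans (joined_pth β 1 0))

theorem Link.symm {f : C(M, ℝ)} {c : Bool} {α β : Pth M} (h : Link f c α β) : Link f c β α := by
  cases c <;> exact JoinedIn.symm h

theorem Link.trans {f : C(M, ℝ)} {c : Bool} {α β γ : Pth M} (h : Link f c α β)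
    (h' : Link f c β γ) : Link f c α γ := by
  cases c <;> exact JoinedIn.trans h h'

theorem Link.exists_eq [SecondCountableTopology M] [Nonempty M] {T : Set M} (hT : Core T) {f : C(M, ℝ)} {c : Bool} {a : Fin 3 → Pth M}
    (ha : ∀ i, a i ∈ CanCrossing T f) (h : ∀ i j, Link f c (a i) (a j)) :
    ∃ i j, i ≠ j ∧ a i = a j := by
  cases c
  · exact Crossing.eq_of_joinedIn_zero hT (fun i => (ha i).1) (fun i => (ha i).2) h
  · exact Crossing.eq_of_joinedIn_one hT (fun i => (ha i).1) (fun i => (ha i).2) h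

end

variable {M : Type*} [MetricSpace M] [PolishSpace M] [MeasurableSpace M] [BorelSpace M]
  [Nonempty M] {T : Set M}

theorem measurableSet_joinedIn (hT : Core T) (hTm : MeasurableSet T) {O : Set M} (hO : IsOpen O) :
    MeasurableSet {q : M × M | q.1 ∉ T ∧ JoinedIn O q.1 q.2} := by
  have hP : MeasurableSet {q : (M × M) × Pth M | Can q.2 ∧ (∀ s, q.2 s ∈ O) ∧
      (q.2 0, q.2 1) = q.1 ∧ q.1.1 ∉ T} := by
    refine (measurable_snd measurableSet_can).inter (MeasurableSet.inter ?_
      (MeasurableSet.inter ?_ ?_))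
    · have : MeasurableSet {α : Pth M | ∀ s ∈ univ, α s ∈ O} :=
        (isOpen_forall_mem isCompact_univ hO).measurableSet
      have h1 : Measurable fun q : (M × M) × Pth M => q.2 := measurable_snd
      have e : {α : Pth M | ∀ s, α s ∈ O} = {α : Pth M | ∀ s ∈ univ, α s ∈ O} := by
        ext α
        exact ⟨fun h s _ => h s, fun h s => h s trivial⟩
      rw [← e] at this
      exact h1 this
    · have h1 : Measurable fun q : (M × M) × Pth M => (q.2 0, q.2 1) :=
        ((measurable_eval 0).comp measurable_snd).prodMk ((measurable_eval 1).comp measurable_snd)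
      exact measurableSet_eq_fun h1 measurable_fst
    · have h1 : Measurable fun q : (M × M) × Pth M => q.1.1 := measurable_fst.comp measurable_fst
      exact h1 hTm.compl
  have : Nonempty (Pth M) := ‹Nonempty M›.map (ContinuousMap.const I)
  have h := (image_fst_of_sections_le_two hP fun x a b c ha hb hc => exists_eq_vec (by
    have hcan : ∀ i, Can (![a, b, c] i) := fun i => by
      fin_cases i
      · exact ha.1
      · exact hb.1
      · exact hc.1
    have hends : ∀ i, (![a, b, c] i 0, ![a, b, c] i 1) = x := fun i => by
      fin_cases i
      · exact ha.2.2.1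
      · exact hb.2.2.1
      · exact hc.2.2.1
    have h0 : ∀ i, ![a, b, c] i 0 = x.1 := fun i => congrArg Prod.fst (hends i)
    have h1 : ∀ i, ![a, b, c] i 1 = x.2 := fun i => congrArg Prod.snd (hends i)
    obtain ⟨i, j, hij, hs⟩ := hT.triodHit.exists_nested ![a, b, c] (fun i => (hcan i).1)
      (fun i j => by rw [h0, h0]) fun i s _ => hT.notMem _ (s := 0) (by
        rw [h0]; exact ha.2.2.2) s
    have h01 : ![a, b, c] i 0 = ![a, b, c] j 0 := by rw [h0, h0]
    exact ⟨i, j, hij, (hcan i).ext (hcan j) h01 (range_eq_of_ends_eq (hcan i).1 (hcan j).1 h01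
      (by rw [h1, h1]) hs)⟩)).1
  have hd : MeasurableSet {q : M × M | q.1 ∉ T ∧ q.1 ∈ O ∧ q.1 = q.2} :=
    (measurable_fst hTm.compl).inter ((measurable_fst hO.measurableSet).inter
      (measurableSet_eq_fun measurable_fst measurable_snd))
  convert hd.union h using 1
  ext ⟨x, y⟩
  constructor
  · rintro ⟨hx, hj⟩
    by_cases hxy : x = y
    · exact Or.inl ⟨hx, hj.source_mem, hxy⟩
    · obtain ⟨γ, h0, h1, hγ⟩ := hj.exists_pth
      obtain ⟨α, hα, hα0, hα1, hr⟩ := exists_can γ (by rwa [h0, h1])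
      refine Or.inr ⟨((x, y), α), ⟨hα, fun s => ?_, ?_, hx⟩, rfl⟩
      · obtain ⟨t, ht⟩ := hr ⟨s, rfl⟩
        rw [← ht]
        exact hγ t
      · show (α 0, α 1) = (x, y)
        rw [hα0, hα1, h0, h1]
  · rintro (⟨hx, hxO, hxy⟩ | ⟨⟨⟨x', y'⟩, α⟩, ⟨-, hα, hends, hx⟩, h⟩)
    · exact ⟨hx, by rw [← show x = y from hxy]; exact JoinedIn.refl hxO⟩
    · obtain ⟨rfl, rfl⟩ := Prod.mk.inj ((show (α 0, α 1) = (x', y') from hends).trans h)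
      have h' : α 0 = x' := congrArg Prod.fst hends
      exact ⟨by rw [h']; exact hx, joinedIn_range α hα⟩

theorem measurableSet_canCrossing (hTm : MeasurableSet T) (f : C(M, ℝ)) :
    MeasurableSet (CanCrossing T f) := by
  have h0 := f.continuous.measurable.comp (measurable_eval (M := M) 0)
  have h1 := f.continuous.measurable.comp (measurable_eval (M := M) 1)
  have hm := measurableSet_forall_Ioo (M := M) (O := {x | 0 < f x ∧ f x < 1})
    ((isOpen_lt continuous_const f.continuous).inter (isOpen_lt f.continuous continuous_const))
  convert measurableSet_can.inter ((h0 (measurableSet_singleton 0)).inter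
    ((h1 (measurableSet_singleton 1)).inter (hm.inter (measurable_eval (M := M) 0 hTm.compl))))
    using 1
  ext α
  constructor
  · rintro ⟨hc, hα⟩
    exact ⟨hc, hα.zero, hα.one, fun s hs0 hs1 => ⟨hα.pos s hs0 hs1, hα.lt s hs0 hs1⟩, hα.notMem⟩
  · rintro ⟨hc, h0, h1, hm, hn⟩
    exact ⟨hc, hc.1, h0, h1, fun s hs0 hs1 => (hm s hs0 hs1).1, fun s hs0 hs1 => (hm s hs0 hs1).2, hn⟩

theorem measurableSet_link (hT : Core T) (hTm : MeasurableSet T) (f : C(M, ℝ)) (c : Bool) :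
    MeasurableSet {q : Pth M × Pth M | q.1 ∈ CanCrossing T f ∧ q.2 ∈ CanCrossing T f ∧
      Link f c q.1 q.2} := by
  have hC := measurableSet_canCrossing hTm f
  have key : ∀ (s : I) (O : Set M), IsOpen O → MeasurableSet {q : Pth M × Pth M |
      q.1 ∈ CanCrossing T f ∧ q.2 ∈ CanCrossing T f ∧ JoinedIn O (q.1 s) (q.2 s)} := by
    intro s O hO
    have h1 : Measurable fun q : Pth M × Pth M => (q.1 s, q.2 s) :=
      ((measurable_eval s).comp measurable_fst).prodMk ((measurable_eval s).comp measurable_snd)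
    convert (measurable_fst hC).inter ((measurable_snd hC).inter
      (h1 (measurableSet_joinedIn hT hTm hO))) using 1
    ext q
    exact ⟨fun h => ⟨h.1, h.2.1, hT.notMem _ h.1.2.notMem s, h.2.2⟩,
      fun h => ⟨h.1, h.2.1, h.2.2.2⟩⟩
  cases c
  · exact key 0 _ (isOpen_lt f.continuous continuous_const)
  · exact key 1 _ (isOpen_lt continuous_const f.continuous)

/-- The set of points near a crossing is measurable, and nearby crossings can be chosen
measurably. -/
theorem exists_near_selector (hT : Core T) (hTm : MeasurableSet T) (f : C(M, ℝ)) :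
    ∃ (X : Set M) (Φ : M → Pth M), MeasurableSet X ∧ Measurable Φ ∧
      (∀ x ∈ X, Φ x ∈ CanCrossing T f ∧ Near f x (Φ x)) ∧
      ∀ x, (∃ α ∈ CanCrossing T f, Near f x α) → x ∈ X := by
  have hC := measurableSet_canCrossing hTm f
  have : Nonempty (Pth M) := ‹Nonempty M›.map (ContinuousMap.const I)
  have key : ∀ (s : I) (O : Set M), IsOpen O → (∀ a : Fin 3 → Pth M,
      (∀ i, a i ∈ CanCrossing T f) → (∀ i j, JoinedIn O (a i s) (a j s)) →
      ∃ i j, i ≠ j ∧ a i = a j) → ∃ (A : Set M) (g : M → Pth M), MeasurableSet A ∧ Measurable g ∧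
      (∀ x ∈ A, g x ∈ CanCrossing T f ∧ JoinedIn O x (g x s)) ∧
      ∀ x, ∀ α ∈ CanCrossing T f, JoinedIn O x (α s) → x ∈ A := by
    intro s O hO h2
    have hP : MeasurableSet {q : M × Pth M | q.2 ∈ CanCrossing T f ∧ JoinedIn O q.1 (q.2 s)} := by
      have h1 : Measurable fun q : M × Pth M => (q.2 s, q.1) :=
        ((measurable_eval s).comp measurable_snd).prodMk measurable_fst
      convert (measurable_snd hC).inter (h1 (measurableSet_joinedIn hT hTm hO)) using 1
      ext q
      exact ⟨fun h => ⟨h.1, hT.notMem _ h.1.2.notMem s, h.2.symm⟩, fun h => ⟨h.1, h.2.2.symm⟩⟩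
    obtain ⟨hA, g, hg, hgA⟩ := image_fst_of_sections_le_two hP fun x a b c ha hb hc =>
      exists_eq_vec (h2 ![a, b, c] (fun i => by
        fin_cases i
        · exact ha.1
        · exact hb.1
        · exact hc.1) (fun i j => by
        have : ∀ i, JoinedIn O x (![a, b, c] i s) := fun i => by
          fin_cases i
          · exact ha.2
          · exact hb.2
          · exact hc.2
        exact (this i).symm.trans (this j)))
    exact ⟨_, g, hA, hg, hgA, fun x α hα hj => ⟨(x, α), ⟨hα, hj⟩, rfl⟩⟩
  obtain ⟨A, g, hA, hg, hgA, hA'⟩ := key 0 {y | f y < 1}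
    (isOpen_lt f.continuous continuous_const) fun a ha h => Link.exists_eq (c := false) hT ha h
  obtain ⟨B, k, hB, hk, hkB, hB'⟩ := key 1 {y | 0 < f y}
    (isOpen_lt continuous_const f.continuous) fun a ha h => Link.exists_eq (c := true) hT ha h
  classical
  refine ⟨A ∪ B, A.piecewise g k, hA.union hB, hg.piecewise hA hk, fun x hx => ?_, ?_⟩
  · by_cases hxA : x ∈ A
    · rw [piecewise_eq_of_mem _ _ _ hxA]
      exact ⟨(hgA x hxA).1, Or.inl (hgA x hxA).2⟩
    · rw [piecewise_eq_of_notMem _ _ _ hxA]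
      have := hkB x (hx.resolve_left hxA)
      exact ⟨this.1, Or.inr this.2⟩
  · rintro x ⟨α, hα, h | h⟩
    · exact Or.inl (hA' x α hα h)
    · exact Or.inr (hB' x α hα h)

end Linking

end

section

section Reduction

theorem exists_first_selection {X Y : Type*} [MeasurableSpace X] [MeasurableSpace Y]
    {A : ℕ → Set X} (hA : ∀ n, MeasurableSet (A n)) {f : ℕ → X → Y} (hf : ∀ n, Measurable (f n))
    {d : X → Y} (hd : Measurable d) : ∃ g : X → Y, Measurable g ∧ (∀ x, (∀ n, x ∉ A n) → g x = d x) ∧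
      ∀ x n, x ∈ A n → (∀ m, m < n → x ∉ A m) → g x = f n x := by
  classical
  have hU : MeasurableSet (⋃ n, A n)ᶜ := (MeasurableSet.iUnion hA).compl
  have h : ∀ x, ∃ n, x ∈ A n ∨ x ∈ (⋃ n, A n)ᶜ := fun x => by
    by_cases hx : x ∈ ⋃ n, A n
    · obtain ⟨n, hn⟩ := mem_iUnion.1 hx
      exact ⟨n, Or.inl hn⟩
    · exact ⟨0, Or.inr hx⟩
  have hg : Measurable fun x => f (Nat.find (h x)) x :=
    Measurable.find (p := fun n x => x ∈ A n ∨ x ∈ (⋃ n, A n)ᶜ) hf (fun n => (hA n).union hU) h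
  refine ⟨(⋃ n, A n).piecewise (fun x => f (Nat.find (h x)) x) d,
    hg.piecewise (MeasurableSet.iUnion hA) hd, fun x hx => ?_, fun x n hn hm => ?_⟩
  · exact piecewise_eq_of_notMem _ _ _ fun hx' => by
      obtain ⟨n, hn⟩ := mem_iUnion.1 hx'
      exact hx n hn
  · have hxU : x ∈ ⋃ n, A n := mem_iUnion.2 ⟨n, hn⟩
    rw [piecewise_eq_of_mem _ _ _ hxU]
    have : Nat.find (h x) = n := by
      rw [Nat.find_eq_iff]
      refine ⟨Or.inl hn, fun m hmn h => ?_⟩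
      rcases h with h | h
      · exact hm m hmn h
      · exact h hxU
    show f (Nat.find (h x)) x = f n x
    rw [this]

variable {M : Type} [MetricSpace M] [SecondCountableTopology M] [Nonempty M]

/-- The involutory relations on indexed crossings. -/
def Adj (T : Set M) (F : ℕ → C(M, ℝ)) (c : Bool) (v w : ℕ × Pth M) : Prop :=
  v = w ∨ ∃ n, v.1 = n ∧ w.1 = n ∧ v.2 ∈ CanCrossing T (F n) ∧ w.2 ∈ CanCrossing T (F n) ∧
    Link (F n) c v.2 w.2

variable {T : Set M} {F : ℕ → C(M, ℝ)}

theorem Adj.equivalence (c : Bool) : Equivalence (Adj T F c) where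
  refl _ := Or.inl rfl
  symm := by
    rintro v w (h | ⟨n, h1, h2, h3, h4, h5⟩)
    · exact Or.inl h.symm
    · exact Or.inr ⟨n, h2, h1, h4, h3, h5.symm⟩
  trans := by
    rintro u v w (rfl | ⟨n, h1, h2, h3, h4, h5⟩) h
    · exact h
    · rcases h with rfl | ⟨m, k1, k2, k3, k4, k5⟩
      · exact Or.inr ⟨n, h1, h2, h3, h4, h5⟩
      · obtain rfl : n = m := h2.symm.trans k1
        exact Or.inr ⟨n, h1, k2, h3, k4, h5.trans k5⟩

theorem Adj.eq_or_eq (hT : Core T) {c : Bool} {u v w : ℕ × Pth M} (h : Adj T F c u v)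
    (h' : Adj T F c u w) : u = v ∨ u = w ∨ v = w := by
  rcases h with h | ⟨n, h1, h2, h3, h4, h5⟩
  · exact Or.inl h
  rcases h' with h' | ⟨m, k1, k2, k3, k4, k5⟩
  · exact Or.inr (Or.inl h')
  obtain rfl : n = m := h1.symm.trans k1
  have hu : ∀ i, Link (F n) c u.2 (![u.2, v.2, w.2] i) := fun i => by
    fin_cases i
    · exact h5.trans h5.symm
    · exact h5
    · exact k5
  rcases exists_eq_vec (Link.exists_eq hT (f := F n) (c := c) (a := ![u.2, v.2, w.2]) (fun i => by
    fin_cases i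
    · exact h3
    · exact h4
    · exact k4) fun i j => (hu i).symm.trans (hu j)) with h | h | h
  · exact Or.inl (Prod.ext (h1.trans h2.symm) h)
  · exact Or.inr (Or.inl (Prod.ext (h1.trans k2.symm) h))
  · exact Or.inr (Or.inr (Prod.ext (h2.trans k2.symm) h))

/-- The equivalence relation generated by the adjacency relations. -/
abbrev Chain (T : Set M) (F : ℕ → C(M, ℝ)) : ℕ × Pth M → ℕ × Pth M → Prop :=
  Relation.EqvGen fun v w => ∃ c, Adj T F c v w

theorem Chain.eq_or {v w : ℕ × Pth M} (h : Chain T F v w) : v = w ∨ ∃ n, v.1 = n ∧ w.1 = n ∧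
    v.2 ∈ CanCrossing T (F n) ∧ w.2 ∈ CanCrossing T (F n) ∧ Joined (v.2 0) (w.2 0) := by
  induction h with
  | rel v w h =>
    obtain ⟨c, h | ⟨n, h1, h2, h3, h4, h5⟩⟩ := h
    · exact Or.inl h
    · exact Or.inr ⟨n, h1, h2, h3, h4, h5.joined⟩
  | refl v => exact Or.inl rfl
  | symm v w _ ih =>
    rcases ih with h | ⟨n, h1, h2, h3, h4, h5⟩
    · exact Or.inl h.symm
    · exact Or.inr ⟨n, h2, h1, h4, h3, h5.symm⟩
  | trans u v w _ _ ih ih' =>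
    rcases ih with rfl | ⟨n, h1, h2, h3, h4, h5⟩
    · exact ih'
    · rcases ih' with rfl | ⟨m, k1, k2, k3, k4, k5⟩
      · exact Or.inr ⟨n, h1, h2, h3, h4, h5⟩
      · obtain rfl : n = m := h2.symm.trans k1
        exact Or.inr ⟨n, h1, k2, h3, k4, h5.trans k5⟩

theorem Chain.of_joined (hT : Core T) {n : ℕ} {α β : Pth M} (hα : α ∈ CanCrossing T (F n))
    (hβ : β ∈ CanCrossing T (F n)) (h : Joined (α 0) (β 0)) : Chain T F (n, α) (n, β) := by
  have hr : Compatible T (F n) fun α β => Chain T F (n, α) (n, β) :=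
    { equivalence := ⟨fun _ => Relation.EqvGen.refl _, fun h => Relation.EqvGen.symm _ _ h,
        fun h h' => Relation.EqvGen.trans _ _ _ h h'⟩
      zero := fun α hα β hβ h =>
        Relation.EqvGen.rel _ _ ⟨false, Or.inr ⟨n, rfl, rfl, hα, hβ, h⟩⟩
      one := fun α hα β hβ h =>
        Relation.EqvGen.rel _ _ ⟨true, Or.inr ⟨n, rfl, rfl, hα, hβ, h⟩⟩ }
  exact hr.of_joined hT hα hβ h

theorem const_notMem_canCrossing (f : C(M, ℝ)) (z : M) :
    (ContinuousMap.const I z : Pth M) ∉ CanCrossing T f := fun h =>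
  zero_ne_one (h.1.1 (show (ContinuousMap.const I z : Pth M) 0 = ContinuousMap.const I z 1 from rfl))

/-- A map which on each path component is either constant with value a constant path in this
component, or takes values in the crossings with a fixed index, is a reduction. -/
theorem joined_iff_chain (hT : Core T) {g : M → ℕ × Pth M}
    (hg : ∀ x, (∃ z, g x = (0, ContinuousMap.const I z) ∧ Joined z x ∧ ∀ y, Joined x y → g y = g x) ∨
      ∃ n, ∀ y, Joined x y → (g y).1 = n ∧ (g y).2 ∈ CanCrossing T (F n) ∧ Joined y ((g y).2 0))
    (x y : M) : Joined x y ↔ Chain T F (g x) (g y) := by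
  constructor
  · intro hxy
    rcases hg x with ⟨z, -, -, h⟩ | ⟨n, h⟩
    · rw [h y hxy]
      exact Relation.EqvGen.refl _
    · obtain ⟨h1, h2, h3⟩ := h x (Joined.refl x)
      obtain ⟨k1, k2, k3⟩ := h y hxy
      have := Chain.of_joined hT h2 k2 (h3.symm.trans (hxy.trans k3))
      nth_rewrite 1 [← h1] at this
      rwa [← k1] at this
  · intro hxy
    rcases hxy.eq_or with e | ⟨n, h1, h2, h3, h4, h5⟩
    · have key : ∀ u, (∃ z, g u = (0, ContinuousMap.const I z) ∧ Joined z u) ∨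
          ∃ n, (g u).2 ∈ CanCrossing T (F n) ∧ Joined u ((g u).2 0) := fun u => by
        rcases hg u with ⟨z, h, h', -⟩ | ⟨n, h⟩
        · exact Or.inl ⟨z, h, h'⟩
        · exact Or.inr ⟨n, (h u (Joined.refl u)).2⟩
      rcases key x with ⟨z, h, h'⟩ | ⟨n, h, h'⟩ <;> rcases key y with ⟨w, k, k'⟩ | ⟨m, k, k'⟩
      · rw [h, k] at e
        have hzw : z = w := DFunLike.congr_fun (Prod.mk.inj e).2 0
        exact h'.symm.trans (hzw ▸ k')
      · rw [← e, h] at k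
        exact (const_notMem_canCrossing _ _ k).elim
      · rw [e, k] at h
        exact (const_notMem_canCrossing _ _ h).elim
      · rw [e] at h'
        exact h'.trans k'.symm
    · have key : ∀ u, (g u).2 ∈ CanCrossing T (F n) → Joined u ((g u).2 0) := fun u hu => by
        rcases hg u with ⟨z, h, -⟩ | ⟨m, h⟩
        · rw [h] at hu
          exact (const_notMem_canCrossing _ _ hu).elim
        · exact (h u (Joined.refl u)).2.2
      exact (key x h3).trans (h5.trans (key y h4).symm)

end Reduction

section Main

variable {M : Type} [MetricSpace M] [PolishSpace M] [MeasurableSpace M] [BorelSpace M] [Nonempty M]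

theorem measurableSet_adj {T : Set M} (hT : Core T) (hTm : MeasurableSet T) (F : ℕ → C(M, ℝ))
    (c : Bool) : MeasurableSet {q : (ℕ × Pth M) × (ℕ × Pth M) | Adj T F c q.1 q.2} := by
  have h1 : Measurable fun q : (ℕ × Pth M) × (ℕ × Pth M) => q.1.1 :=
    measurable_fst.comp measurable_fst
  have h2 : Measurable fun q : (ℕ × Pth M) × (ℕ × Pth M) => q.2.1 :=
    measurable_fst.comp measurable_snd
  have h3 : Measurable fun q : (ℕ × Pth M) × (ℕ × Pth M) => (q.1.2, q.2.2) :=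
    (measurable_snd.comp measurable_fst).prodMk (measurable_snd.comp measurable_snd)
  have : {q : (ℕ × Pth M) × (ℕ × Pth M) | Adj T F c q.1 q.2} = {q | q.1 = q.2} ∪
      ⋃ n, ((fun q => q.1.1) ⁻¹' {n} ∩ ((fun q => q.2.1) ⁻¹' {n} ∩ (fun q => (q.1.2, q.2.2)) ⁻¹'
        {q | q.1 ∈ CanCrossing T (F n) ∧ q.2 ∈ CanCrossing T (F n) ∧ Link (F n) c q.1 q.2})) := by
    ext q
    constructor
    · rintro (h | ⟨n, h⟩)
      · exact Or.inl h
      · exact Or.inr (mem_iUnion.2 ⟨n, h⟩)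
    · rintro (h | h)
      · exact Or.inl h
      · exact Or.inr (mem_iUnion.1 h)
  rw [this]
  exact (measurableSet_eq_fun measurable_fst measurable_snd).union (MeasurableSet.iUnion fun n =>
    (h1 (measurableSet_singleton n)).inter ((h2 (measurableSet_singleton n)).inter
      (h3 (measurableSet_link hT hTm (F n) c))))

theorem measurableSet_joined {p : ℕ → M} (hT : Core (hull p)) (hTm : MeasurableSet (hull p)) :
    MeasurableSet {q : M × M | Joined q.1 q.2} := by
  have h := measurableSet_joinedIn hT hTm isOpen_univ
  have hc := measurableSet_joined_of_hull hTm
  have : {q : M × M | Joined q.1 q.2} = {q : M × M | q.1 ∉ hull p ∧ JoinedIn univ q.1 q.2} ∪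
      ⋃ k, {x | Joined (p k) x} ×ˢ {x | Joined (p k) x} := by
    ext ⟨x, y⟩
    simp only [mem_union, mem_iUnion]
    constructor
    · intro hxy
      by_cases hx : x ∈ hull p
      · obtain ⟨k, hk⟩ := hx
        exact Or.inr ⟨k, hk, Joined.trans hk hxy⟩
      · exact Or.inl ⟨hx, joinedIn_univ.2 hxy⟩
    · rintro (h | ⟨k, h1, h2⟩)
      · exact joinedIn_univ.1 h.2
      · exact Joined.trans (Joined.symm h1) h2
  rw [this]
  exact h.union (MeasurableSet.iUnion fun k => (hc k).prod (hc k))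

/-- If a Polish metric space has no uncountable family of pairwise disjoint triods, then being
joined by a path is an essentially hyperfinite Borel equivalence relation. -/
theorem isEssentiallyHyperfinite_joined (hM : MooreProp M) :
    IsBorelEquivRel (fun x y : M => Joined x y) ∧
      IsEssentiallyHyperfinite (fun x y : M => Joined x y) := by
  obtain ⟨S, p, hS⟩ := exists_skeleton hM
  have hT := hS.core
  have hTm := hS.measurableSet_hull
  set T := hull p with hTdef
  refine ⟨⟨⟨Joined.refl, Joined.symm, Joined.trans⟩, measurableSet_joined hT hTm⟩, ?_⟩
  obtain ⟨F, hF⟩ := exists_separating_sequence M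
  have : Nonempty (Pth M) := ‹Nonempty M›.map (ContinuousMap.const I)
  have hmain := isHyperfinite_eqvGen (R := Adj T F) Adj.equivalence (measurableSet_adj hT hTm F)
    fun c x y z h h' => h.eq_or_eq hT h'
  refine ⟨ℕ × Pth M, inferInstance, inferInstance, Chain T F, hmain.1, hmain.2, ?_⟩
  choose X Φ hX hΦ hXΦ hX' using fun n => exists_near_selector hT hTm (F n)
  have hXT : ∀ n x, x ∈ X n → x ∉ T := fun n x hx hxT => by
    have := hXΦ n x hx
    exact this.1.2.notMem (hT.mem _ _ this.2.joined hxT)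
  have hXinv : ∀ n x y, Joined x y → x ∈ X n → y ∈ X n := fun n x y hxy hx =>
    hX' n y (exists_near_of_near hT (hXT n x hx) hxy ⟨_, hXΦ n x hx⟩)
  have hconst : Measurable fun x : M => ((0 : ℕ), (ContinuousMap.const I x : Pth M)) :=
    measurable_const.prodMk ContinuousMap.continuous_const'.measurable
  obtain ⟨g₁, hg₁, hd₁, hs₁⟩ := exists_first_selection hX
    (f := fun n x => (n, Φ n x)) (fun n => measurable_const.prodMk (hΦ n)) hconst
  obtain ⟨g, hg, hd, hs⟩ := exists_first_selection (measurableSet_joined_of_hull hTm)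
    (f := fun k _ => ((0 : ℕ), (ContinuousMap.const I (p k) : Pth M))) (fun k => measurable_const) hg₁
  refine ⟨g, hg, joined_iff_chain hT fun x => ?_⟩
  classical
  by_cases hx : x ∈ T
  · left
    have hk : ∀ y, Joined x y → g y = (0, ContinuousMap.const I (p (Nat.find hx))) := fun y hy =>
      hs y _ ((Nat.find_spec hx).trans hy) fun m hm hmy =>
        Nat.find_min hx hm (Joined.trans hmy hy.symm)
    exact ⟨_, hk x (Joined.refl x), Nat.find_spec hx, fun y hy => by
      rw [hk y hy, hk x (Joined.refl x)]⟩
  have hyT : ∀ y, Joined x y → y ∉ T := fun y hy h => hx (hT.mem _ _ hy.symm h)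
  have hgy : ∀ y, Joined x y → g y = g₁ y := fun y hy => hd y fun n h => hyT y hy ⟨n, h⟩
  by_cases hxX : ∃ n, x ∈ X n
  · right
    refine ⟨Nat.find hxX, fun y hy => ?_⟩
    have h1 : g₁ y = (Nat.find hxX, Φ _ y) := hs₁ y _ (hXinv _ _ _ hy (Nat.find_spec hxX))
      fun m hm hmy => Nat.find_min hxX hm (hXinv _ _ _ hy.symm hmy)
    have h2 := hXΦ _ y (hXinv _ _ _ hy (Nat.find_spec hxX))
    rw [hgy y hy, h1]
    exact ⟨rfl, h2.1, h2.2.joined⟩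
  · left
    refine ⟨x, ?_, Joined.refl x, fun y hy => ?_⟩
    · rw [hgy x (Joined.refl x)]
      exact hd₁ x fun n h => hxX ⟨n, h⟩
    · by_cases hxy : x = y
      · rw [hxy]
      · obtain ⟨n, h0, h1⟩ := hF x y hxy
        exact (hxX ⟨n, hX' n x (exists_near_of_joined hT hx hy h0 h1)⟩).elim

end Main

end

end

end PlanarPaths

/-- For every Polish subspace `H` of the plane, the path-connectedness
(equivalently, arc-connectedness) equivalence relation on `H` is a Borel
equivalence relation which is essentially hyperfinite. -/
theorem statement3 (H : Set (ℝ × ℝ)) (hH : PolishSpace H) :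
    IsBorelEquivRel (fun x y : H => JoinedIn H x.1 y.1) ∧
    IsEssentiallyHyperfinite (fun x y : H => JoinedIn H x.1 y.1) := by
  have hE : (fun x y : H => JoinedIn H x.1 y.1) = fun x y : H => Joined x y := by
    funext x y
    exact propext (joinedIn_iff_joined x.2 y.2)
  rw [hE]
  rcases isEmpty_or_nonempty H with h | h
  · refine ⟨⟨⟨Joined.refl, Joined.symm, Joined.trans⟩, ?_⟩, H, inferInstance, inferInstance,
      fun _ _ => True, ⟨⟨fun _ => trivial, fun _ => trivial, fun _ _ => trivial⟩, ?_⟩,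
      ⟨fun _ _ _ => True, fun _ => ⟨⟨⟨fun _ => trivial, fun _ => trivial, fun _ _ => trivial⟩, ?_⟩,
        fun x => h.elim x⟩, fun _ _ _ _ => trivial, fun x => h.elim x⟩,
      id, measurable_id, fun x => h.elim x⟩
    all_goals exact Subsingleton.measurableSet
  · refine PlanarPaths.isEssentiallyHyperfinite_joined
      (PlanarPaths.mooreProp_complex.of_injective
        ⟨fun x : H => Complex.equivRealProdCLM.symm x.1,
          Complex.equivRealProdCLM.symm.continuous.comp continuous_subtype_val⟩ fun x y hxy => ?_)
    exact Subtype.ext (Complex.equivRealProdCLM.symm.injective hxy)
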